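/- Let Ω ⊂ ℂⁿ be a bounded pseudoconvex domain and φ ∈ SPSH(Ω). For every continuous compactly supported function g : Ω → ℝ, ∫_Ω g(z) k^{−n} B_{kφ}(z) e^{−kφ(z)} dλ(z) → π^{−n} ∫_Ω g(z) det H_φ(z) dλ(z) as k → ∞ (convergence of the normalized Bergman measures to the Monge–Ampère measure (1/n!)(dd^c φ)^n). -/

import Mathlib

open MeasureTheory Complex Filter
open scoped ENNReal Topology BigOperators Real ComplexOrder

noncomputable section

variable {n : ℕ}

/-- Wirtinger derivative `∂f/∂z_j` of a function on `ℂⁿ`. -/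
def wDeriv (f : (Fin n → ℂ) → ℂ) (j : Fin n) (z : Fin n → ℂ) : ℂ :=
  (1/2) * (fderiv ℝ f z (Pi.single j 1) - Complex.I * fderiv ℝ f z (Pi.single j Complex.I))

/-- Wirtinger derivative `∂f/∂z̄_j` of a function on `ℂⁿ`. -/
def wDerivBar (f : (Fin n → ℂ) → ℂ) (j : Fin n) (z : Fin n → ℂ) : ℂ :=
  (1/2) * (fderiv ℝ f z (Pi.single j 1) + Complex.I * fderiv ℝ f z (Pi.single j Complex.I))

/-- Complex Hessian `H_φ(z) = (∂²φ/∂z_j∂z̄_k)_{j,k}` of a real-valued function on `ℂⁿ`. -/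
def cHessian (φ : (Fin n → ℂ) → ℝ) (z : Fin n → ℂ) : Matrix (Fin n) (Fin n) ℂ :=
  Matrix.of fun j k => wDerivBar (fun w => wDeriv (fun v => (φ v : ℂ)) j w) k z

/-- A function is plurisubharmonic on `Ω` if it is upper semicontinuous on `Ω` and satisfies
the sub-mean value inequality on every closed complex disc contained in `Ω`. -/
def PlurisubharmonicOn (Ω : Set (Fin n → ℂ)) (f : (Fin n → ℂ) → ℝ) : Prop :=
  UpperSemicontinuousOn f Ω ∧
  ∀ a b : Fin n → ℂ, (∀ ζ : ℂ, ‖ζ‖ ≤ 1 → a + ζ • b ∈ Ω) →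
    f a ≤ (2 * π)⁻¹ * ∫ θ in (0:ℝ)..(2*π), f (a + Complex.exp (θ * Complex.I) • b)

/-- A (bounded) open set `Ω ⊆ ℂⁿ` is pseudoconvex iff `z ↦ -log dist(z, Ωᶜ)` is
plurisubharmonic on `Ω`. -/
def Pseudoconvex (Ω : Set (Fin n → ℂ)) : Prop :=
  PlurisubharmonicOn Ω fun z => -Real.log (Metric.infDist z Ωᶜ)

/-- `φ ∈ SPSH(Ω)`: smooth on `Ω` with positive definite complex Hessian at every point of `Ω`. -/
def SPSHOn (Ω : Set (Fin n → ℂ)) (φ : (Fin n → ℂ) → ℝ) : Prop :=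
  ContDiffOn ℝ (⊤ : ℕ∞) φ Ω ∧ ∀ z ∈ Ω, (cHessian φ z).PosDef

/-- Squared weighted Bergman norm `∫_Ω |f|² e^{-ψ} dλ` (as an extended real,
so that finiteness encodes square-integrability). -/
def wnorm2 (Ω : Set (Fin n → ℂ)) (ψ : (Fin n → ℂ) → ℝ) (f : (Fin n → ℂ) → ℂ) : ℝ≥0∞ :=
  ∫⁻ z in Ω, ENNReal.ofReal (‖f z‖ ^ 2 * Real.exp (-ψ z))

/-- Membership in the weighted Bergman space `H(ψ)`: holomorphic on `Ω` and
`∫_Ω |f|² e^{-ψ} dλ < ∞`. -/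
def MemBergman (Ω : Set (Fin n → ℂ)) (ψ : (Fin n → ℂ) → ℝ) (f : (Fin n → ℂ) → ℂ) : Prop :=
  DifferentiableOn ℂ f Ω ∧ wnorm2 Ω ψ f < ⊤

/-- The diagonal of the Bergman kernel of `H(ψ)`:
`B_ψ(z) = sup {|f(z)|² : f ∈ H(ψ), ‖f‖_ψ ≤ 1}`. -/
def bergmanDiag (Ω : Set (Fin n → ℂ)) (ψ : (Fin n → ℂ) → ℝ) (z : Fin n → ℂ) : ℝ :=
  sSup {t : ℝ | ∃ f, DifferentiableOn ℂ f Ω ∧ wnorm2 Ω ψ f ≤ 1 ∧ t = ‖f z‖ ^ 2}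

/-- Weighted inner product `⟨f,g⟩_ψ = ∫_Ω f ḡ e^{-ψ} dλ`. -/
def wInner (Ω : Set (Fin n → ℂ)) (ψ : (Fin n → ℂ) → ℝ) (f g : (Fin n → ℂ) → ℂ) : ℂ :=
  ∫ z in Ω, f z * (starRingEnd ℂ) (g z) * Real.exp (-ψ z)

/-- Mixed determinants `D_j(A,B)`, defined so that
`det (s•A + r•B) = ∑_j (n choose j) s^j r^(n-j) D_j(A,B)`: explicitly `D_j(A,B)` is
`(n choose j)⁻¹` times the sum over all `j`-element subsets `S` of the row indices of the
determinant of the matrix whose rows are those of `A` on `S` and those of `B` elsewhere. -/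
def mixedDet (A B : Matrix (Fin n) (Fin n) ℂ) (j : ℕ) : ℂ :=
  ((n.choose j : ℂ))⁻¹ *
    ∑ S ∈ Finset.univ.powersetCard j,
      Matrix.det (Matrix.of fun i k => if i ∈ S then A i k else B i k)


open scoped ContDiff ComplexConjugate
local notation "XX" => Fin n → ℂ
def wD (c : ℂ) (f : XX → ℂ) (j : Fin n) (z : XX) : ℂ :=
  (1/2) * (fderiv ℝ f z (Pi.single j 1) + c * fderiv ℝ f z (Pi.single j Complex.I))
local notation "dz" => wD (-I)
lemma wDeriv_eq (f : XX → ℂ) (j : Fin n) : wDeriv f j = dz f j := by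
  funext z; simp [wDeriv, wD, sub_eq_add_neg]
lemma wDerivBar_eq (f : XX → ℂ) (j : Fin n) : wDerivBar f j = wD I f j := by
  funext z; simp [wDerivBar, wD]
def Sm (f : XX → ℂ) : Prop := ContDiff ℝ ∞ f
def SmR (f : XX → ℝ) : Prop := ContDiff ℝ ∞ f
lemma Sm.diff {f : XX → ℂ} (hf : Sm f) : Differentiable ℝ f :=
  ContDiff.differentiable hf (by simp)
lemma Sm.cont {f : XX → ℂ} (hf : Sm f) : Continuous f := ContDiff.continuous hf
lemma Sm.mul {f g : XX → ℂ} (hf : Sm f) (hg : Sm g) : Sm (fun z => f z * g z) :=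
  ContDiff.mul hf hg
lemma Sm.add {f g : XX → ℂ} (hf : Sm f) (hg : Sm g) : Sm (fun z => f z + g z) :=
  ContDiff.add hf hg
lemma Sm.sub {f g : XX → ℂ} (hf : Sm f) (hg : Sm g) : Sm (fun z => f z - g z) :=
  ContDiff.sub hf hg
lemma Sm.neg {f : XX → ℂ} (hf : Sm f) : Sm (fun z => - f z) :=
  ContDiff.neg hf
lemma Sm.const (c : ℂ) : Sm (fun _ : XX => c) := contDiff_const
lemma Sm.conj {f : XX → ℂ} (hf : Sm f) : Sm (fun z => conj (f z)) :=
  (Complex.conjCLE.contDiff (𝕜 := ℝ)).comp hf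
lemma SmR.ofReal {f : XX → ℝ} (hf : SmR f) : Sm (fun z => (f z : ℂ)) :=
  (Complex.ofRealCLM.contDiff (𝕜 := ℝ)).comp hf
lemma Sm.sum {ι : Type*} {s : Finset ι} {f : ι → XX → ℂ} (hf : ∀ i, Sm (f i)) :
    Sm (fun z => ∑ i ∈ s, f i z) := ContDiff.sum fun i _ => hf i
lemma Sm.fd {f : XX → ℂ} (hf : Sm f) (v : XX) : Sm (fun z => fderiv ℝ f z v) :=
  (ContDiff.fderiv_right (m := ∞) hf (by simp)).clm_apply contDiff_const
lemma Sm.wD {f : XX → ℂ} (hf : Sm f) (c : ℂ) (j : Fin n) : Sm (wD c f j) :=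
  (Sm.const (1/2)).mul ((hf.fd _).add ((Sm.const c).mul (hf.fd _)))
lemma wD_mul (c : ℂ) {f g : XX → ℂ} (j : Fin n) {z : XX}
    (hf : DifferentiableAt ℝ f z) (hg : DifferentiableAt ℝ g z) :
    wD c (fun z => f z * g z) j z = wD c f j z * g z + f z * wD c g j z := by
  simp only [wD]; rw [fderiv_fun_mul hf hg]; simp; ring
lemma wD_add (c : ℂ) {f g : XX → ℂ} (j : Fin n) {z : XX}
    (hf : DifferentiableAt ℝ f z) (hg : DifferentiableAt ℝ g z) :
    wD c (fun z => f z + g z) j z = wD c f j z + wD c g j z := by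
  simp only [wD]; rw [fderiv_fun_add hf hg]; simp; ring
lemma wD_sub (c : ℂ) {f g : XX → ℂ} (j : Fin n) {z : XX}
    (hf : DifferentiableAt ℝ f z) (hg : DifferentiableAt ℝ g z) :
    wD c (fun z => f z - g z) j z = wD c f j z - wD c g j z := by
  simp only [wD]; rw [fderiv_fun_sub hf hg]; simp; ring
lemma wD_const (c a : ℂ) (j : Fin n) (z : XX) : wD c (fun _ => a) j z = 0 := by
  simp [wD]
lemma wD_conj (c : ℂ) {f : XX → ℂ} (j : Fin n) {z : XX}
    (hf : DifferentiableAt ℝ f z) :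
    wD c (fun z => conj (f z)) j z
      = conj (wD (conj c) f j z) := by
  have : fderiv ℝ (fun z => conj (f z)) z
      = (Complex.conjCLE : ℂ →L[ℝ] ℂ).comp (fderiv ℝ f z) :=
    ((Complex.conjCLE : ℂ →L[ℝ] ℂ).hasFDerivAt.comp z hf.hasFDerivAt).fderiv
  simp only [wD]; rw [this]; simp
  exact Or.inl (map_ofNat _ 2).symm
lemma wD_comp (c : ℂ) {f : XX → ℝ} {g : ℝ → ℝ} {g' : ℝ} (j : Fin n) {z : XX}
    (hf : DifferentiableAt ℝ f z) (hg : HasDerivAt g g' (f z)) :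
    wD c (fun z => ((g (f z) : ℝ) : ℂ)) j z = g' * wD c (fun z => (f z : ℂ)) j z := by
  have h1 : fderiv ℝ (fun z => ((g (f z) : ℝ) : ℂ)) z
      = Complex.ofRealCLM.comp (g' • fderiv ℝ f z) :=
    (Complex.ofRealCLM.hasFDerivAt.comp z (hg.comp_hasFDerivAt z hf.hasFDerivAt)).fderiv
  have h2 : fderiv ℝ (fun z => ((f z : ℝ) : ℂ)) z = Complex.ofRealCLM.comp (fderiv ℝ f z) :=
    (Complex.ofRealCLM.hasFDerivAt.comp z hf.hasFDerivAt).fderiv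
  simp only [wD]; rw [h1, h2]; simp; ring
lemma wD_congr (c : ℂ) {f g : XX → ℂ} (j : Fin n) {z : XX}
    (h : f =ᶠ[𝓝 z] g) : wD c f j z = wD c g j z := by
  simp only [wD]; rw [h.fderiv_eq]
lemma wD_comm (c d : ℂ) {f : XX → ℂ} (hf : Sm f) (j k : Fin n) (z : XX) :
    wD c (wD d f j) k z = wD d (wD c f k) j z := by
  have key : ∀ u v : XX, fderiv ℝ (fun z => fderiv ℝ f z u) z v
      = fderiv ℝ (fun z => fderiv ℝ f z v) z u := by
    intro u v
    have h1 : ∀ w : XX, fderiv ℝ (fun z => fderiv ℝ f z w) z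
        = (fderiv ℝ (fderiv ℝ f) z).flip w := by
      intro w
      have hd : DifferentiableAt ℝ (fderiv ℝ f) z :=
        ((ContDiff.fderiv_right (m := ∞) hf (by simp)).differentiable (by simp)) z
      ext v
      rw [fderiv_clm_apply hd (by fun_prop)]
      simp
    rw [h1, h1]
    simp only [ContinuousLinearMap.flip_apply]
    exact ((ContDiff.contDiffAt hf).isSymmSndFDerivAt (by simp; exact WithTop.coe_le_coe.2 (le_top (a := (2 : ℕ∞))))) v u
  have e : ∀ (c d : ℂ) (j k : Fin n), wD c (wD d f j) k z = (1/4) *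
      (fderiv ℝ (fun z => fderiv ℝ f z (Pi.single j 1)) z (Pi.single k 1)
        + d * fderiv ℝ (fun z => fderiv ℝ f z (Pi.single j I)) z (Pi.single k 1)
        + c * (fderiv ℝ (fun z => fderiv ℝ f z (Pi.single j 1)) z (Pi.single k I)
        + d * fderiv ℝ (fun z => fderiv ℝ f z (Pi.single j I)) z (Pi.single k I))) := by
    intro c d j k
    have : fderiv ℝ (wD d f j) z = (1/2 : ℂ) • (fderiv ℝ (fun z => fderiv ℝ f z (Pi.single j 1)) z
        + d • fderiv ℝ (fun z => fderiv ℝ f z (Pi.single j I)) z) := by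
      have h1 := (hf.fd (Pi.single j 1)).diff z
      have h2 := (hf.fd (Pi.single j I)).diff z
      exact ((h1.hasFDerivAt.add (h2.hasFDerivAt.const_mul d)).const_mul (1/2)).fderiv
    simp only [wD]
    change _ * (fderiv ℝ (wD d f j) z _ + _ * fderiv ℝ (wD d f j) z _) = _
    rw [this]; simp; ring
  rw [e, e, key (Pi.single j 1) (Pi.single k 1), key (Pi.single j I) (Pi.single k 1),
    key (Pi.single j 1) (Pi.single k I), key (Pi.single j I) (Pi.single k I)]
  ring
lemma wD_tsupport (c : ℂ) (f : XX → ℂ) (j : Fin n) :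
    tsupport (wD c f j) ⊆ tsupport f := by
  refine (closure_minimal ?_ (isClosed_tsupport _))
  intro z hz
  by_contra h
  apply hz
  have : f =ᶠ[𝓝 z] fun _ => 0 := notMem_tsupport_iff_eventuallyEq.mp h
  rw [wD_congr c j this, wD_const]
lemma wD_cs (c : ℂ) {f : XX → ℂ} (hf : HasCompactSupport f) (j : Fin n) :
    HasCompactSupport (wD c f j) := hf.of_isClosed_subset (isClosed_tsupport _) (wD_tsupport c f j)
lemma wD_ibp (c : ℂ) {f g : XX → ℂ} (hf : Sm f) (hg : Sm g) (hc : HasCompactSupport f)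
    (j : Fin n) : ∫ z, f z * wD c g j z = - ∫ z, wD c f j z * g z := by
  have I1 : ∀ v : XX, Integrable (fun z => f z * fderiv ℝ g z v) := fun v =>
    (hf.mul (hg.fd v)).cont.integrable_of_hasCompactSupport hc.mul_right
  have I2 : ∀ v : XX, Integrable (fun z => fderiv ℝ f z v * g z) := fun v =>
    ((hf.fd v).mul hg).cont.integrable_of_hasCompactSupport
      (HasCompactSupport.mul_right (hc.fderiv_apply ℝ v))
  have I3 : Integrable (fun z => f z * g z) :=
    (hf.mul hg).cont.integrable_of_hasCompactSupport hc.mul_right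
  have key : ∀ v : XX, ∫ z, f z * fderiv ℝ g z v = - ∫ z, fderiv ℝ f z v * g z := fun v =>
    integral_mul_fderiv_eq_neg_fderiv_mul_of_integrable (I2 v) (I1 v) I3
      (fun x _ => hf.diff x) (fun x _ => hg.diff x)
  have e1 : ∀ z, f z * wD c g j z = (1/2) * (f z * fderiv ℝ g z (Pi.single j 1)
      + c * (f z * fderiv ℝ g z (Pi.single j I))) := fun z => by simp only [wD]; ring
  have e2 : ∀ z, wD c f j z * g z = (1/2) * (fderiv ℝ f z (Pi.single j 1) * g z
      + c * (fderiv ℝ f z (Pi.single j I) * g z)) := fun z => by simp only [wD]; ring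
  simp_rw [e1, e2]
  rw [integral_const_mul, integral_const_mul, integral_add (I1 _) ((I1 _).const_mul c),
    integral_add (I2 _) ((I2 _).const_mul c), integral_const_mul, integral_const_mul, key, key]
  ring
lemma cHessian_eq (φ : XX → ℝ) (z : XX) (j k : Fin n) :
    cHessian φ z j k = wD I (dz (fun v => (φ v : ℂ)) j) k z := by
  simp only [cHessian, Matrix.of_apply]
  rw [wDerivBar_eq]
  congr 1
  exact wDeriv_eq _ _
def lev (φ : XX → ℝ) (z : XX) (b : XX) : ℝ :=
  (∑ j, ∑ k, cHessian φ z j k * b j * conj (b k)).re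
lemma Sm.expW {ψ : XX → ℝ} (hψ : SmR ψ) : Sm (fun z => ((rexp (-ψ z) : ℝ) : ℂ)) :=
  SmR.ofReal (Real.contDiff_exp.comp (ContDiff.neg hψ))
lemma SmR.diff {f : XX → ℝ} (hf : SmR f) : Differentiable ℝ f :=
  ContDiff.differentiable hf (by simp)
lemma wD_expW (c : ℂ) {ψ : XX → ℝ} (j : Fin n) {z : XX}
    (hψ : DifferentiableAt ℝ ψ z) : wD c (fun z => ((rexp (-ψ z) : ℝ) : ℂ)) j z
      = - wD c (fun z => (ψ z : ℂ)) j z * rexp (-ψ z) := by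
  rw [wD_comp c (g := fun t => rexp (-t)) (g' := - rexp (-ψ z)) j hψ]
  · push_cast; ring
  · simpa using ((hasDerivAt_neg (ψ z)).exp)
lemma delta_adj {ψ : XX → ℝ} (hψ : SmR ψ) {f g : XX → ℂ} (hf : Sm f) (hg : Sm g)
    (hc : HasCompactSupport f) (j : Fin n) :
    ∫ z, (dz f j z - dz (fun z => (ψ z : ℂ)) j z * f z) * conj (g z)
        * rexp (-ψ z)
      = - ∫ z, f z * conj (wD I g j z) * rexp (-ψ z) := by
  have h := wD_ibp (-I) (hf.mul (Sm.expW hψ)) hg.conj hc.mul_right j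
  have e1 : ∀ z, dz (fun z => f z * ((rexp (-ψ z) : ℝ) : ℂ)) j z * conj (g z)
      = (dz f j z - dz (fun z => (ψ z : ℂ)) j z * f z) * conj (g z)
        * rexp (-ψ z) := by
    intro z
    rw [wD_mul _ j (hf.diff z) ((Sm.expW hψ).diff z), wD_expW _ _ (hψ.diff z)]; ring
  have e2 : ∀ z, f z * ((rexp (-ψ z) : ℝ) : ℂ) * dz (fun z => conj (g z)) j z
      = f z * conj (wD I g j z) * rexp (-ψ z) := by
    intro z
    rw [wD_conj _ j (hg.diff z)]
    simp only [map_neg, Complex.conj_I, neg_neg]; ring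
  simp_rw [e1, e2] at h
  rw [h, neg_neg]
def del (ψ : XX → ℝ) (f : XX → ℂ) (j : Fin n) (z : XX) : ℂ :=
  dz f j z - dz (fun z => (ψ z : ℂ)) j z * f z
lemma Sm.del {ψ : XX → ℝ} (hψ : SmR ψ) {f : XX → ℂ} (hf : Sm f) (j : Fin n) :
    Sm (del ψ f j) := (hf.wD _ j).sub ((hψ.ofReal.wD _ j).mul hf)
lemma del_cs (ψ : XX → ℝ) {f : XX → ℂ} (hf : HasCompactSupport f) (j : Fin n) :
    HasCompactSupport (del ψ f j) := (wD_cs _ hf j).sub hf.mul_left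
lemma basic_jk {ψ : XX → ℝ} (hψ : SmR ψ) {f g : XX → ℂ}
    (hf : Sm f) (hg : Sm g) (hfc : HasCompactSupport f) (hgc : HasCompactSupport g) (j k : Fin n) :
    ∫ z, del ψ f j z * conj (del ψ g k z) * rexp (-ψ z)
      = ∫ z, (wD I f k z * conj (wD I g j z)
        + cHessian ψ z j k * f z * conj (g z)) * rexp (-ψ z) := by
  have h1 := delta_adj hψ hg (Sm.del hψ hf j) hgc k
  have h2 := delta_adj hψ (hf.wD I k) hg (wD_cs I hfc k) j
  have i1 : Integrable (fun z => wD I f k z * conj (wD I g j z) * rexp (-ψ z)) :=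
    (((hf.wD I k).mul (hg.wD I j).conj).mul (Sm.expW hψ)).cont.integrable_of_hasCompactSupport
      (HasCompactSupport.mul_right (wD_cs I hfc k).mul_right)
  have hH : Sm (fun z => cHessian ψ z j k) := by
    simp_rw [cHessian_eq]; exact ((hψ.ofReal.wD _ j).wD I k)
  have i2 : Integrable (fun z => cHessian ψ z j k * f z * conj (g z)
      * rexp (-ψ z)) :=
    (((hH.mul hf).mul hg.conj).mul (Sm.expW hψ)).cont.integrable_of_hasCompactSupport
      (HasCompactSupport.mul_right (HasCompactSupport.mul_right hfc.mul_left))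
  have i3 : Integrable (fun z => del ψ (wD I f k) j z * conj (g z) * rexp (-ψ z)) :=
    (((Sm.del hψ (hf.wD I k) j).mul hg.conj).mul (Sm.expW hψ)).cont.integrable_of_hasCompactSupport
      (HasCompactSupport.mul_right (del_cs ψ (wD_cs I hfc k) j).mul_right)
  have e0 : ∀ z, del ψ f j z * conj (del ψ g k z) * (rexp (-ψ z) : ℂ)
      = conj ((dz g k z - dz (fun z => (ψ z : ℂ)) k z * g z)
        * conj (del ψ f j z) * rexp (-ψ z)) := by
    intro z; simp only [map_mul, Complex.conj_conj, Complex.conj_ofReal, del]; ring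
  have e1 : ∀ z, conj (g z * conj (wD I (del ψ f j) k z) * rexp (-ψ z))
      = del ψ (wD I f k) j z * conj (g z) * rexp (-ψ z)
        - cHessian ψ z j k * f z * conj (g z) * rexp (-ψ z) := by
    intro z
    have : wD I (del ψ f j) k z = del ψ (wD I f k) j z - cHessian ψ z j k * f z := by
      have hψj := hψ.ofReal.wD (-I) j
      unfold del
      rw [wD_sub _ _ ((hf.wD _ j).diff z) ((hψj.mul hf).diff z),
        wD_mul _ _ (hψj.diff z) (hf.diff z), wD_comm _ _ hf, cHessian_eq]
      ring
    rw [this]; simp only [map_mul, Complex.conj_conj, Complex.conj_ofReal]; ring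
  simp_rw [e0]
  rw [integral_conj, h1, map_neg, ← integral_conj]
  simp_rw [e1]
  rw [integral_sub i3 i2]
  simp_rw [add_mul]
  rw [integral_add i1 i2]
  unfold del
  rw [h2]; ring
lemma alg_ineq (M : Fin n → XX) :
    -(1/2) * ∑ j, ∑ k, ‖M j k - M k j‖ ^ 2 ≤ (∑ j, ∑ k, M j k * conj (M k j)).re := by
  have h : ∀ j k, ‖M j k - M k j‖ ^ 2 = ‖M j k‖ ^ 2 + ‖M k j‖ ^ 2
      - 2 * (M j k * conj (M k j)).re := by
    intro j k
    simp only [← Complex.normSq_eq_norm_sq, Complex.normSq_sub]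
  simp_rw [h, Finset.sum_sub_distrib, Finset.sum_add_distrib, Complex.re_sum, ← Finset.mul_sum]
  rw [Finset.sum_comm (f := fun j k => ‖M k j‖ ^ 2)]
  have : 0 ≤ ∑ j, ∑ k, ‖M j k‖ ^ 2 := by positivity
  linarith
lemma basic_ineq {ψ : XX → ℝ} (hψ : SmR ψ) {β : Fin n → XX → ℂ}
    (hβ : ∀ j, Sm (β j)) (hc : ∀ j, HasCompactSupport (β j)) :
    ∫ z, lev ψ z (fun j => β j z) * rexp (-ψ z)
      ≤ (∫ z, ‖∑ j, del ψ (β j) j z‖ ^ 2 * rexp (-ψ z))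
        + (1/2) * ∑ j, ∑ k, ∫ z, ‖wD I (β j) k z - wD I (β k) j z‖ ^ 2 * rexp (-ψ z) := by
  have hW := Sm.expW hψ
  have hH : ∀ j k, Sm (fun z => cHessian ψ z j k) := fun j k => by
    simp_rw [cHessian_eq]; exact ((hψ.ofReal.wD _ j).wD I k)
  have i0 : ∀ j k, Integrable (fun z => del ψ (β j) j z * conj (del ψ (β k) k z)
      * (rexp (-ψ z) : ℂ)) := fun j k =>
    (((Sm.del hψ (hβ j) j).mul (Sm.del hψ (hβ k) k).conj).mul
      hW).cont.integrable_of_hasCompactSupport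
      (HasCompactSupport.mul_right (del_cs ψ (hc j) j).mul_right)
  have i1 : ∀ j k, Integrable (fun z => wD I (β j) k z * conj (wD I (β k) j z)
      * rexp (-ψ z)) := fun j k =>
    ((((hβ j).wD I k).mul ((hβ k).wD I j).conj).mul hW).cont.integrable_of_hasCompactSupport
      (HasCompactSupport.mul_right (wD_cs I (hc j) k).mul_right)
  have i2 : ∀ j k, Integrable (fun z => cHessian ψ z j k * β j z * conj (β k z)
      * rexp (-ψ z)) := fun j k =>
    ((((hH j k).mul (hβ j)).mul (hβ k).conj).mul hW).cont.integrable_of_hasCompactSupport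
      (HasCompactSupport.mul_right (HasCompactSupport.mul_right (hc j).mul_left))
  have i3 : ∀ j k, Integrable (fun z => ‖wD I (β j) k z - wD I (β k) j z‖ ^ 2
      * rexp (-ψ z)) := fun j k => by
    have : Integrable (fun z => (wD I (β j) k z - wD I (β k) j z)
      * conj (wD I (β j) k z - wD I (β k) j z) * (rexp (-ψ z) : ℂ)) :=
      (((((hβ j).wD I k).sub ((hβ k).wD I j)).mul (((hβ j).wD I k).sub ((hβ k).wD I j)).conj).mul
        hW).cont.integrable_of_hasCompactSupport
        (HasCompactSupport.mul_right (((wD_cs I (hc j) k).sub (wD_cs I (hc k) j)).mul_right))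
    refine this.re.congr (Eventually.of_forall fun z => ?_)
    simp only [Complex.mul_conj, ← Complex.ofReal_mul, Complex.normSq_eq_norm_sq]
    exact Complex.ofReal_re _
  have key : ∑ j, ∑ k, ∫ z, del ψ (β j) j z * conj (del ψ (β k) k z)
        * (rexp (-ψ z) : ℂ)
      = (∑ j, ∑ k, ∫ z, wD I (β j) k z * conj (wD I (β k) j z) * rexp (-ψ z))
      + ∑ j, ∑ k, ∫ z, cHessian ψ z j k * β j z * conj (β k z) * rexp (-ψ z) := by
    rw [← Finset.sum_add_distrib]
    refine Finset.sum_congr rfl fun j _ => ?_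
    rw [← Finset.sum_add_distrib]
    refine Finset.sum_congr rfl fun k _ => ?_
    rw [basic_jk hψ (hβ j) (hβ k) (hc j) (hc k), ← integral_add (i1 j k) (i2 j k)]
    simp_rw [add_mul]
  have S : ∀ F : Fin n → Fin n → XX → ℂ, (∀ j k, Integrable (F j k)) →
      (∑ j, ∑ k, ∫ z, F j k z).re = ∫ z, (∑ j, ∑ k, F j k z).re := by
    intro F hF
    have h1 : ∀ j, ∑ k, ∫ z, F j k z = ∫ z, ∑ k, F j k z := fun j =>
      (integral_finsetSum _ fun k _ => hF j k).symm
    simp_rw [h1]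
    rw [← integral_finsetSum _ fun j _ => integrable_finsetSum _ fun k _ => hF j k]
    exact (integral_re (𝕜 := ℂ) (integrable_finsetSum _ fun j _ =>
      integrable_finsetSum _ fun k _ => hF j k)).symm
  have key2 := congrArg Complex.re key
  rw [Complex.add_re, S _ i0, S _ i1, S _ i2] at key2
  have e0 : ∀ z, (∑ j, ∑ k, del ψ (β j) j z * conj (del ψ (β k) k z)
        * (rexp (-ψ z) : ℂ)).re = ‖∑ j, del ψ (β j) j z‖ ^ 2 * rexp (-ψ z) := by
    intro z
    have : (∑ j, ∑ k, del ψ (β j) j z * conj (del ψ (β k) k z)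
        * (rexp (-ψ z) : ℂ)) = (∑ j, del ψ (β j) j z) * conj (∑ j, del ψ (β j) j z)
        * (rexp (-ψ z) : ℂ) := by
      rw [map_sum, Finset.sum_mul_sum, Finset.sum_mul]
      simp_rw [Finset.sum_mul]
    rw [this, Complex.mul_conj, ← Complex.ofReal_mul, Complex.ofReal_re,
      Complex.normSq_eq_norm_sq]
  have e2 : ∀ z, (∑ j, ∑ k, cHessian ψ z j k * β j z * conj (β k z)
      * (rexp (-ψ z) : ℂ)).re = lev ψ z (fun j => β j z) * rexp (-ψ z) := by
    intro z
    simp_rw [← Finset.sum_mul]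
    rw [Complex.re_mul_ofReal]; rfl
  simp_rw [e0, e2] at key2
  have e1 : -(1/2) * ∑ j, ∑ k, ∫ z, ‖wD I (β j) k z - wD I (β k) j z‖ ^ 2 * rexp (-ψ z)
      ≤ ∫ z, (∑ j, ∑ k, wD I (β j) k z * conj (wD I (β k) j z)
        * (rexp (-ψ z) : ℂ)).re := by
    have h1 : ∀ j, ∑ k, ∫ z, ‖wD I (β j) k z - wD I (β k) j z‖ ^ 2 * rexp (-ψ z)
      = ∫ z, ∑ k, ‖wD I (β j) k z - wD I (β k) j z‖ ^ 2 * rexp (-ψ z) := fun j =>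
      (integral_finsetSum _ fun k _ => i3 j k).symm
    simp_rw [h1]
    rw [← integral_finsetSum _ fun j _ => integrable_finsetSum _ fun k _ => i3 j k,
      ← integral_const_mul]
    refine integral_mono ((integrable_finsetSum _ fun j _ =>
      integrable_finsetSum _ fun k _ => i3 j k).const_mul _)
      (integrable_finsetSum _ fun j _ => integrable_finsetSum _ fun k _ => i1 j k).re ?_
    intro z
    have := alg_ineq (fun j k => wD I (β j) k z)
    simp_rw [← Finset.sum_mul]
    rw [Complex.re_mul_ofReal, ← mul_assoc]
    exact mul_le_mul_of_nonneg_right this (Real.exp_pos _).le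
  linarith
structure Moll (ε : ℝ) (m : XX → ℝ) : Prop where
  sm : SmR m
  nn : ∀ w, 0 ≤ m w
  supp : ∀ w, ε ≤ ‖w‖ → m w = 0
  int : ∫ w, m w = 1
  circ : ∀ (ζ : ℂ) w, ‖ζ‖ = 1 → m (ζ • w) = m w
lemma cs_of_zero {F : Type*} [Zero F] {f : XX → F} {r : ℝ} (h : ∀ w, r ≤ ‖w‖ → f w = 0) :
    HasCompactSupport f :=
  HasCompactSupport.intro (isCompact_closedBall 0 r) fun x hx => h x (by
    simp only [Metric.mem_closedBall, dist_zero_right, not_le] at hx; exact hx.le)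
lemma Moll.cs {ε : ℝ} {m : XX → ℝ} (h : Moll ε m) : HasCompactSupport m :=
  cs_of_zero h.supp
lemma Moll.cont {ε : ℝ} {m : XX → ℝ} (h : Moll ε m) : Continuous m :=
  ContDiff.continuous h.sm
lemma Moll.integrable {ε : ℝ} {m : XX → ℝ} (h : Moll ε m) : Integrable m :=
  h.cont.integrable_of_hasCompactSupport h.cs
def bmp (ε : ℝ) (w : XX) : ℝ := Real.smoothTransition (1 - (ε ^ 2)⁻¹ * ∑ j, ‖w j‖ ^ 2)
lemma sq_le_sum (w : XX) {ε : ℝ} (hε : 0 < ε) (hw : ε ≤ ‖w‖) : ε ^ 2 ≤ ∑ j, ‖w j‖ ^ 2 := by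
  by_contra hlt
  push Not at hlt
  have : ‖w‖ < ε := (pi_norm_lt_iff hε).2 fun j => by
    have h1 : ‖w j‖ ^ 2 ≤ ∑ j, ‖w j‖ ^ 2 :=
      Finset.single_le_sum (f := fun j => ‖w j‖ ^ 2) (fun _ _ => by positivity) (Finset.mem_univ j)
    exact lt_of_pow_lt_pow_left₀ 2 hε.le (h1.trans_lt hlt)
  linarith
lemma bmp_sm (ε : ℝ) : SmR (bmp (n := n) ε) := by
  refine Real.smoothTransition.contDiff.comp ?_
  refine contDiff_const.sub (contDiff_const.mul (ContDiff.sum fun j _ => ?_))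
  exact (contDiff_norm_sq ℝ (E := ℂ)).comp (contDiff_apply ℝ ℂ j)
lemma bmp_zero {ε : ℝ} (hε : 0 < ε) (w : XX) (hw : ε ≤ ‖w‖) : bmp ε w = 0 := by
  apply Real.smoothTransition.zero_of_nonpos
  have h2 := sq_le_sum w hε hw
  have h3 : 1 ≤ (ε ^ 2)⁻¹ * ∑ j, ‖w j‖ ^ 2 := by
    rw [inv_mul_eq_div, le_div_iff₀ (by positivity)]; linarith
  linarith
lemma bmp_nn (ε : ℝ) (w : XX) : 0 ≤ bmp ε w := Real.smoothTransition.nonneg _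
lemma bmp_circ (ε : ℝ) (ζ : ℂ) (w : XX) (hζ : ‖ζ‖ = 1) : bmp ε (ζ • w) = bmp ε w := by
  simp [bmp, hζ]
lemma bmp_0 (ε : ℝ) : bmp ε (0 : XX) = 1 := by simp [bmp]
lemma exists_moll (n : ℕ) {ε : ℝ} (hε : 0 < ε) : ∃ m : (Fin n → ℂ) → ℝ, Moll ε m := by
  have hb : SmR (bmp (n := n) ε) := bmp_sm ε
  have hcs : HasCompactSupport (bmp (n := n) ε) := cs_of_zero (bmp_zero hε)
  have hpos : 0 < ∫ w : (Fin n → ℂ), bmp ε w := by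
    refine (ContDiff.continuous hb).integral_pos_of_hasCompactSupport_nonneg_nonzero (x := 0) hcs
      (bmp_nn ε) ?_
    rw [bmp_0]; exact one_ne_zero
  obtain ⟨c, hc⟩ : ∃ c, c = ∫ w : (Fin n → ℂ), bmp ε w := ⟨_, rfl⟩
  rw [← hc] at hpos
  refine ⟨fun w => c⁻¹ * bmp ε w, contDiff_const.mul hb,
    fun w => mul_nonneg (inv_nonneg.2 hpos.le) (bmp_nn ε w),
    fun w hw => by rw [bmp_zero hε w hw, mul_zero], ?_, ?_⟩
  · rw [integral_const_mul, ← hc, inv_mul_cancel₀ hpos.ne']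
  · intro ζ w hζ
    rw [bmp_circ ε ζ w hζ]
def mol (m : XX → ℝ) (f : XX → ℂ) (x : XX) : ℂ :=
  ∫ y, f y * (m (x - y) : ℂ)
lemma mol_eq (m : XX → ℝ) (f : XX → ℂ) (x : XX) :
    mol m f x = ∫ y, f (x - y) * (m y : ℂ) := by
  have := integral_sub_left_eq_self (fun y => f y * (m (x - y) : ℂ)) volume x
  simp only [sub_sub_cancel] at this
  exact this.symm
lemma mol_conv (m : XX → ℝ) (f : XX → ℂ) :
    mol m f = convolution f (fun z => (m z : ℂ)) (ContinuousLinearMap.mul ℝ ℂ) volume := by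
  funext x; rfl
lemma mol_sm {ε : ℝ} {m : XX → ℝ} (hm : Moll ε m) {f : XX → ℂ}
    (hf : LocallyIntegrable f) : Sm (mol m f) := by
  rw [mol_conv]
  exact HasCompactSupport.contDiff_convolution_right _
    (hm.cs.comp_left (g := fun x : ℝ => (x : ℂ)) (by simp)) hf hm.sm.ofReal
lemma mol_fderiv {ε : ℝ} {m : XX → ℝ} (hm : Moll ε m) {f : XX → ℂ}
    (hf : LocallyIntegrable f) (x v : XX) :
    fderiv ℝ (mol m f) x v = ∫ y, f y * fderiv ℝ (fun z => (m z : ℂ)) (x - y) v := by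
  have hcs : HasCompactSupport (fun z => (m z : ℂ)) :=
    hm.cs.comp_left (g := fun x : ℝ => (x : ℂ)) (by simp)
  have h := HasCompactSupport.hasFDerivAt_convolution_right (ContinuousLinearMap.mul ℝ ℂ)
    (μ := volume) hcs hf (ContDiff.of_le hm.sm.ofReal (by simp)) x
  rw [mol_conv, h.fderiv]
  have hi := HasCompactSupport.convolutionExists_right
    ((ContinuousLinearMap.mul ℝ ℂ).precompR XX) (μ := volume) (hcs.fderiv (𝕜 := ℝ)) hf
    ((ContDiff.continuous_fderiv hm.sm.ofReal (by simp))) x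
  unfold convolution
  rw [ContinuousLinearMap.integral_apply hi]
  rfl
lemma mul_int_test {f g : XX → ℂ} (hf : LocallyIntegrable f) (hg : Continuous g)
    (hc : HasCompactSupport g) : Integrable (fun y => f y * g y) := by
  have := hf.integrable_smul_right_of_hasCompactSupport hg hc
  simpa [smul_eq_mul, mul_comm] using this
lemma Moll.refl_sm {ε : ℝ} {m : XX → ℝ} (hm : Moll ε m) (x : XX) :
    Sm (fun y => (m (x - y) : ℂ)) :=
  (show ContDiff ℝ ∞ (fun y => (m (x - y) : ℂ)) from
    ContDiff.comp (g := fun z => (m z : ℂ)) hm.sm.ofReal (contDiff_const.sub contDiff_id))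
lemma Moll.refl_cs {ε : ℝ} {m : XX → ℝ} (hm : Moll ε m) (x : XX) :
    HasCompactSupport (fun y => (m (x - y) : ℂ)) := by
  have := (hm.cs.comp_left (g := fun x : ℝ => (x : ℂ)) (by simp)).comp_homeomorph (Homeomorph.subLeft x)
  exact this
lemma mol_wD {ε : ℝ} {m : XX → ℝ} (hm : Moll ε m) {f : XX → ℂ}
    (hf : LocallyIntegrable f) (c : ℂ) (j : Fin n) (x : XX) :
    wD c (mol m f) j x = - ∫ y, f y * wD c (fun y => (m (x - y) : ℂ)) j y := by
  have hd : ∀ y v, fderiv ℝ (fun y => (m (x - y) : ℂ)) y v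
      = - fderiv ℝ (fun z => (m z : ℂ)) (x - y) v := by
    intro y v
    have h1 : HasFDerivAt (fun y => (m (x - y) : ℂ)) _ y :=
      (hm.sm.ofReal.diff (x - y)).hasFDerivAt.comp y ((hasFDerivAt_id y).const_sub x)
    rw [h1.fderiv]; simp
  have hi : ∀ v, Integrable (fun y => f y * fderiv ℝ (fun y => (m (x - y) : ℂ)) y v) := fun v =>
    mul_int_test hf ((hm.refl_sm x).fd v).cont ((hm.refl_cs x).fderiv_apply ℝ v)
  have e : ∀ y, f y * wD c (fun y => (m (x - y) : ℂ)) j y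
      = (1/2) * (f y * fderiv ℝ (fun y => (m (x - y) : ℂ)) y (Pi.single j 1)
      + c * (f y * fderiv ℝ (fun y => (m (x - y) : ℂ)) y (Pi.single j I))) := by
    intro y; simp only [wD]; ring
  simp_rw [e]
  rw [integral_const_mul, integral_add (hi _) ((hi _).const_mul c), integral_const_mul]
  simp_rw [hd, mul_neg]
  rw [integral_neg, integral_neg, ← mol_fderiv hm hf, ← mol_fderiv hm hf, wD]
  ring
lemma mol_zero {ε : ℝ} {m : XX → ℝ} (hm : Moll ε m) {f : XX → ℂ}
    (hf : HasCompactSupport f) : HasCompactSupport (mol m f) := by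
  obtain ⟨R, hR⟩ := hf.isCompact.isBounded.exists_norm_le
  refine cs_of_zero (r := R + ε) fun x hx => ?_
  unfold mol
  rw [← integral_zero (α := XX) (μ := volume) (G := ℂ)]
  congr 1
  funext y
  by_cases hy : y ∈ tsupport f
  · rw [hm.supp (x - y), Complex.ofReal_zero, mul_zero]
    have := norm_sub_norm_le x y
    have := hR y hy
    linarith
  · rw [image_eq_zero_of_notMem_tsupport hy, zero_mul]
lemma trans_L2 {f : XX → ℂ} (hf : MemLp f 2) {η : ℝ≥0∞} (hη : 0 < η) :
    ∃ ε > 0, ∀ y : XX, ‖y‖ < ε → eLpNorm (fun x => f (x - y) - f x) 2 ≤ η := by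
  let g : XX → C(XX, XX) := fun y => ⟨fun x => x - y, by fun_prop⟩
  have hg : Continuous g := ContinuousMap.continuous_of_continuous_uncurry _ (by
    show Continuous fun p : XX × XX => p.2 - p.1; fun_prop)
  have hmp : ∀ y, MeasurePreserving (g y) (volume : Measure XX) volume := fun y =>
    measurePreserving_sub_right volume y
  have hc := (continuous_const (y := hf.toLp f)).compMeasurePreservingLp hg hmp (by simp)
  have := Metric.continuous_iff'.1 hc
  have h2 := (EMetric.tendsto_nhds.1 (hc.tendsto 0)) η hη
  obtain ⟨ε, hε, h3⟩ := Metric.eventually_nhds_iff.1 h2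
  refine ⟨ε, hε, fun y hy => ?_⟩
  have h4 := h3 (y := y) (by simpa using hy)
  have h0 : Lp.compMeasurePreserving (g 0) (hmp 0) (hf.toLp f) = (hf.comp_measurePreserving (hmp 0)).toLp _ :=
    Lp.toLp_compMeasurePreserving hf (hmp 0)
  rw [Lp.toLp_compMeasurePreserving hf (hmp y), h0, Lp.edist_toLp_toLp] at h4
  refine le_trans (le_of_eq ?_) h4.le
  congr 1
  funext x
  simp [g]
lemma sq_lint {μ : Measure XX} [IsProbabilityMeasure μ] {f : XX → ℝ≥0∞}
    (hf : AEMeasurable f μ) : (∫⁻ y, f y ∂μ) ^ 2 ≤ ∫⁻ y, f y ^ 2 ∂μ := by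
  have := ENNReal.lintegral_mul_le_Lp_mul_Lq μ (Real.HolderConjugate.two_two) hf (aemeasurable_const (b := 1))
  simp only [Pi.mul_apply, mul_one, ENNReal.one_rpow, lintegral_const, measure_univ] at this
  calc (∫⁻ y, f y ∂μ) ^ 2 ≤ ((∫⁻ y, f y ^ (2:ℝ) ∂μ) ^ (1/2 : ℝ)) ^ 2 := by gcongr
    _ = _ := by
      rw [← ENNReal.rpow_natCast, ← ENNReal.rpow_mul]; norm_num
lemma eLp_sq {F : Type*} [NormedAddCommGroup F] (f : XX → F) :
    eLpNorm f 2 volume ^ 2 = ∫⁻ x, ‖f x‖ₑ ^ 2 := by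
  have := eLpNorm_nnreal_pow_eq_lintegral (f := f) (μ := (volume : Measure XX))
    (p := 2) (by simp)
  simp only [NNReal.coe_ofNat, ENNReal.rpow_ofNat, ENNReal.coe_ofNat] at this
  exact this
lemma mol_L2 {f : XX → ℂ} (hf : MemLp f 2) {η : ℝ≥0∞} (hη : 0 < η) :
    ∃ ε > 0, ∀ m, Moll ε m → eLpNorm (fun x => mol m f x - f x) 2 ≤ η := by
  obtain ⟨ε, hε, H⟩ := trans_L2 hf hη
  refine ⟨ε, hε, fun m hm => ?_⟩
  obtain ⟨f', hf'm, hff'⟩ := hf.1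
  have hf'L : MemLp f' 2 := hf.ae_eq hff'
  have hmol : ∀ x, mol m f x = mol m f' x := fun x =>
    integral_congr_ae (hff'.mono fun y hy => by simp only [hy])
  have H' : ∀ y : XX, ‖y‖ < ε → eLpNorm (fun x => f' (x - y) - f' x) 2 ≤ η := by
    intro y hy
    rw [← eLpNorm_congr_ae (f := fun x => f (x - y) - f x)]
    · exact H y hy
    · have := (measurePreserving_sub_right volume y).quasiMeasurePreserving.ae_eq_comp hff'
      filter_upwards [this, hff'] with x h1 h2
      simp only [Function.comp] at h1
      rw [h1, h2]
  rw [eLpNorm_congr_ae (g := fun x => mol m f' x - f' x)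
    (hff'.mono fun x hx => by simp only [hmol, hx])]
  rw [← ENNReal.pow_le_pow_left_iff two_ne_zero, eLp_sq]
  let μ : Measure XX := volume.withDensity (fun y => ENNReal.ofReal (m y))
  have hmm : Measurable (fun y => ENNReal.ofReal (m y)) := hm.cont.measurable.ennreal_ofReal
  have hμ1 : ∫⁻ y, ENNReal.ofReal (m y) = 1 := by
    rw [← ofReal_integral_eq_lintegral_ofReal hm.integrable (Eventually.of_forall hm.nn), hm.int]
    simp
  haveI : IsProbabilityMeasure μ := ⟨by simp [μ, withDensity_apply, hμ1]⟩
  have step : ∀ x, ‖mol m f' x - f' x‖ₑ ^ 2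
      ≤ ∫⁻ y, ENNReal.ofReal (m y) * ‖f' (x - y) - f' x‖ₑ ^ 2 := by
    intro x
    have hl : LocallyIntegrable f' := hf'L.locallyIntegrable (by norm_num)
    have i1 : Integrable (fun y => f' (x - y) * (m y : ℂ)) := by
      have := (mul_int_test hl (hm.refl_sm x).cont (hm.refl_cs x)).comp_sub_left x
      simpa using this
    have i2 : Integrable (fun y => f' x * (m y : ℂ)) := hm.integrable.ofReal.const_mul _
    have e : mol m f' x - f' x = ∫ y, (f' (x - y) - f' x) * (m y : ℂ) := by
      simp_rw [sub_mul]
      rw [integral_sub i1 i2, mol_eq, integral_const_mul, integral_complex_ofReal, hm.int]; simp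
    have hmeas : Measurable fun y => ‖f' (x - y) - f' x‖ₑ :=
      ((hf'm.comp_measurable (measurable_const.sub measurable_id)).sub
        stronglyMeasurable_const).enorm
    calc ‖mol m f' x - f' x‖ₑ ^ 2 ≤ (∫⁻ y, ‖f' (x - y) - f' x‖ₑ ∂μ) ^ 2 := by
          gcongr
          rw [e, lintegral_withDensity_eq_lintegral_mul _ hmm hmeas]
          refine (enorm_integral_le_lintegral_enorm _).trans (le_of_eq ?_)
          congr 1; funext y
          rw [enorm_mul, mul_comm, Pi.mul_apply]
          congr 1
          rw [← ofReal_norm, Complex.norm_real, Real.norm_of_nonneg (hm.nn y)]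
      _ ≤ ∫⁻ y, ‖f' (x - y) - f' x‖ₑ ^ 2 ∂μ := sq_lint hmeas.aemeasurable
      _ = _ := by
          rw [lintegral_withDensity_eq_lintegral_mul _ hmm (hmeas.pow_const 2)]; rfl
  calc ∫⁻ x, ‖mol m f' x - f' x‖ₑ ^ 2
      ≤ ∫⁻ x, ∫⁻ y, ENNReal.ofReal (m y) * ‖f' (x - y) - f' x‖ₑ ^ 2 := lintegral_mono step
    _ = ∫⁻ y, ∫⁻ x, ENNReal.ofReal (m y) * ‖f' (x - y) - f' x‖ₑ ^ 2 := by
        refine lintegral_lintegral_swap (Measurable.aemeasurable ?_)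
        refine (hmm.comp measurable_snd).mul (Measurable.pow_const ?_ 2)
        exact ((hf'm.comp_measurable (measurable_fst.sub measurable_snd)).sub
          (hf'm.comp_measurable measurable_fst)).enorm
    _ ≤ ∫⁻ y, ENNReal.ofReal (m y) * η ^ 2 := by
        refine lintegral_mono fun y => ?_
        simp only
        by_cases hy : ‖y‖ < ε
        · rw [lintegral_const_mul' _ _ ENNReal.ofReal_ne_top, ← eLp_sq]
          gcongr
          exact H' y hy
        · simp [hm.supp y (not_lt.1 hy)]
    _ = η ^ 2 := by rw [lintegral_mul_const _ hmm, hμ1, one_mul]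
structure L2T (F : ℕ → XX → ℂ) (f : XX → ℂ) : Prop where
  mF : ∀ k, MemLp (F k) 2
  mf : MemLp f 2
  t : Tendsto (fun k => eLpNorm (fun x => F k x - f x) 2) atTop (𝓝 0)
lemma L2T.add {F G : ℕ → XX → ℂ} {f g : XX → ℂ} (h1 : L2T F f) (h2 : L2T G g) :
    L2T (fun k x => F k x + G k x) (fun x => f x + g x) := by
  refine ⟨fun k => (h1.mF k).add (h2.mF k), h1.mf.add h2.mf, ?_⟩
  have := h1.t.add h2.t
  rw [add_zero] at this
  refine tendsto_of_tendsto_of_tendsto_of_le_of_le tendsto_const_nhds this (fun _ => zero_le) ?_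
  intro k
  have e : (fun x => F k x + G k x - (f x + g x))
      = (fun x => F k x - f x) + (fun x => G k x - g x) := by
    funext x; simp only [Pi.add_apply]; ring
  beta_reduce
  rw [e]
  exact eLpNorm_add_le ((h1.mF k).sub h1.mf).1 ((h2.mF k).sub h2.mf).1 (by norm_num)
lemma L2T.sum {ι : Type*} {s : Finset ι} {F : ι → ℕ → XX → ℂ} {f : ι → XX → ℂ}
    (h : ∀ i, L2T (F i) (f i)) :
    L2T (fun k x => ∑ i ∈ s, F i k x) (fun x => ∑ i ∈ s, f i x) := by
  classical
  induction s using Finset.induction_on with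
  | empty =>
    simp only [Finset.sum_empty]
    exact ⟨fun _ => MemLp.zero', MemLp.zero', by simp⟩
  | insert i s hi ih =>
    simp only [Finset.sum_insert hi]
    exact (h i).add ih
lemma memLp_bmul {c f : XX → ℂ} {C : ℝ} (hc : AEStronglyMeasurable c) (hb : ∀ x, ‖c x‖ ≤ C)
    (hf : MemLp f 2) : MemLp (fun x => c x * f x) 2 :=
  hf.of_le_mul (c := C) (hc.mul hf.1) (Eventually.of_forall fun x => by
    rw [norm_mul]; gcongr; exact hb x)
lemma L2T.bmul {F : ℕ → XX → ℂ} {f c : XX → ℂ} (h1 : L2T F f) {C : ℝ}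
    (hc : AEStronglyMeasurable c) (hb : ∀ x, ‖c x‖ ≤ C) :
    L2T (fun k x => c x * F k x) (fun x => c x * f x) := by
  refine ⟨fun k => memLp_bmul hc hb (h1.mF k), memLp_bmul hc hb h1.mf, ?_⟩
  have := ENNReal.Tendsto.const_mul (a := ENNReal.ofReal C) h1.t (Or.inr ENNReal.ofReal_ne_top)
  rw [mul_zero] at this
  refine tendsto_of_tendsto_of_tendsto_of_le_of_le tendsto_const_nhds this (fun _ => zero_le) ?_
  intro k
  refine eLpNorm_le_mul_eLpNorm_of_ae_le_mul (Eventually.of_forall fun x => ?_) 2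
  rw [← mul_sub, norm_mul]
  gcongr
  exact hb x
lemma L2T.neg {F : ℕ → XX → ℂ} {f : XX → ℂ} (h1 : L2T F f) :
    L2T (fun k x => - F k x) (fun x => - f x) := by
  have := h1.bmul (c := fun _ => -1) (C := 1) aestronglyMeasurable_const (by simp)
  simpa using this
lemma L2T.inner {F G : ℕ → XX → ℂ} {f g : XX → ℂ} (h1 : L2T F f) (h2 : L2T G g) :
    Tendsto (fun k => ∫ x, F k x * conj (G k x)) atTop
      (𝓝 (∫ x, f x * conj (g x))) := by
  have t1 := (Lp.tendsto_Lp_iff_tendsto_eLpNorm'' F h1.mF f h1.mf).2 h1.t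
  have t2 := (Lp.tendsto_Lp_iff_tendsto_eLpNorm'' G h2.mF g h2.mf).2 h2.t
  have e : ∀ {u v : XX → ℂ} (hu : MemLp u 2) (hv : MemLp v 2),
      Inner.inner ℂ (hv.toLp v) (hu.toLp u) = ∫ x, u x * conj (v x) := by
    intro u v hu hv
    rw [L2.inner_def]
    refine integral_congr_ae ?_
    filter_upwards [hu.coeFn_toLp, hv.coeFn_toLp] with x h1 h2
    rw [h1, h2]; rfl
  have := t2.inner (𝕜 := ℂ) t1
  simp_rw [e] at this
  exact this
lemma memLp_inner_int {u v : XX → ℂ} (hu : MemLp u 2) (hv : MemLp v 2) :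
    Integrable (fun x => u x * conj (v x)) :=
  hu.integrable_mul (q := 2) hv.star
lemma bdd_cs {f : XX → ℂ} (hf : Continuous f) (hc : HasCompactSupport f) :
    ∃ C, ∀ x, ‖f x‖ ≤ C := hc.exists_bound_of_continuous hf
lemma L2T.norm_sq {F : ℕ → XX → ℂ} {f : XX → ℂ} {w : XX → ℝ}
    (h1 : L2T F f) {C : ℝ} (hw : Continuous w) (hb : ∀ x, ‖w x‖ ≤ C) :
    Tendsto (fun k => ∫ x, ‖F k x‖ ^ 2 * w x) atTop (𝓝 (∫ x, ‖f x‖ ^ 2 * w x)) := by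
  have := (h1.bmul (c := fun x => (w x : ℂ)) (C := C) (by fun_prop) (by simpa using hb)).inner h1
  have e : ∀ u : XX → ℂ, ∫ x, (w x : ℂ) * u x * conj (u x)
      = ((∫ x, ‖u x‖ ^ 2 * w x : ℝ) : ℂ) := by
    intro u
    rw [← integral_complex_ofReal]
    congr 1; funext x
    rw [mul_assoc, Complex.mul_conj, Complex.normSq_eq_norm_sq]; push_cast; ring
  simp_rw [e] at this
  exact (Complex.continuous_re.tendsto _).comp this
lemma exists_seq {ι : Type*} [Finite ι] {f : ι → XX → ℂ} (hf : ∀ i, MemLp (f i) 2)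
    (hc : ∀ i, HasCompactSupport (f i)) :
    ∃ m : ℕ → XX → ℝ, (∀ k, Moll 1 (m k)) ∧ ∀ i, L2T (fun k => mol (m k) (f i)) (f i) := by
  classical
  cases nonempty_fintype ι
  have H : ∀ k : ℕ, ∃ m : XX → ℝ, Moll 1 m ∧
      ∀ i, eLpNorm (fun x => mol m (f i) x - f i x) 2 ≤ ENNReal.ofReal (1 / ((k:ℝ) + 1)) := by
    intro k
    choose ε hε h using fun i => mol_L2 (hf i) (η := ENNReal.ofReal (1 / ((k:ℝ) + 1)))
      (by simp; positivity)
    obtain ⟨δ, hδ, hδ1, hδε⟩ : ∃ δ > 0, δ ≤ 1 ∧ ∀ i, δ ≤ ε i := by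
      rcases isEmpty_or_nonempty ι with hi | hi
      · exact ⟨1, one_pos, le_rfl, fun i => (hi.false i).elim⟩
      · obtain ⟨i0, h0⟩ := Finite.exists_min ε
        exact ⟨min 1 (ε i0), lt_min one_pos (hε i0), min_le_left _ _,
          fun i => (min_le_right _ _).trans (h0 i)⟩
    obtain ⟨m, hm⟩ := exists_moll n hδ
    have up : ∀ {e}, δ ≤ e → Moll e m := fun he =>
      ⟨hm.sm, hm.nn, fun w hw => hm.supp w (he.trans hw), hm.int, hm.circ⟩
    exact ⟨m, up hδ1, fun i => h i m (up (hδε i))⟩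
  choose m hm1 hm2 using H
  refine ⟨m, hm1, fun i => ⟨fun k => ?_, hf i, ?_⟩⟩
  · exact (mol_sm (hm1 k) ((hf i).locallyIntegrable (by norm_num))).cont.memLp_of_hasCompactSupport
      (mol_zero (hm1 k) (hc i))
  · refine tendsto_of_tendsto_of_tendsto_of_le_of_le tendsto_const_nhds ?_ (fun _ => zero_le)
      (fun k => hm2 k i)
    have := ENNReal.tendsto_ofReal tendsto_one_div_add_atTop_nhds_zero_nat
    simpa using this
lemma Sm.hess {ψ : XX → ℝ} (hψ : SmR ψ) (j k : Fin n) : Sm (fun z => cHessian ψ z j k) := by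
  simp_rw [cHessian_eq]; exact ((hψ.ofReal.wD _ j).wD I k)
lemma prop_B {ψ : XX → ℝ} (hψ : SmR ψ) (hψc : HasCompactSupport ψ)
    {γ : Fin n → XX → ℂ} {a : Fin n → Fin n → XX → ℂ} {d : XX → ℂ}
    (hγ : ∀ j, MemLp (γ j) 2) (hγc : ∀ j, HasCompactSupport (γ j))
    (ha : ∀ j k, MemLp (a j k) 2) (hac : ∀ j k, HasCompactSupport (a j k))
    (hd : MemLp d 2) (hdc : HasCompactSupport d)
    (h1 : ∀ j k τ, Sm τ → HasCompactSupport τ →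
      ∫ z, (γ j z * wD I τ k z - γ k z * wD I τ j z) = - ∫ z, a j k z * τ z)
    (h2 : ∀ τ, Sm τ → HasCompactSupport τ →
      ∫ z, ∑ j, γ j z * dz τ j z = - ∫ z, d z * τ z) :
    ∫ z, lev ψ z (fun j => γ j z) * rexp (-ψ z)
      ≤ (∫ z, ‖d z - ∑ j, dz (fun z => (ψ z : ℂ)) j z * γ j z‖ ^ 2 * rexp (-ψ z))
        + (1/2) * ∑ j, ∑ k, ∫ z, ‖a j k z‖ ^ 2 * rexp (-ψ z) := by
  obtain ⟨m, hm, hL⟩ := exists_seq (ι := Fin n ⊕ ((Fin n × Fin n) ⊕ Unit))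
    (f := Sum.elim γ (Sum.elim (fun p => a p.1 p.2) (fun _ => d)))
    (by rintro (j | p | u) <;> simp [hγ, ha, hd]) (by rintro (j | p | u) <;> simp [hγc, hac, hdc])
  have Lγ : ∀ j, L2T (fun k => mol (m k) (γ j)) (γ j) := fun j => hL (.inl j)
  have La : ∀ i j, L2T (fun k => mol (m k) (a i j)) (a i j) := fun i j => hL (.inr (.inl (i, j)))
  have Ld : L2T (fun k => mol (m k) d) d := hL (.inr (.inr ()))
  clear hL
  have lγ : ∀ j, LocallyIntegrable (γ j) := fun j => (hγ j).locallyIntegrable (by norm_num)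
  have hψC := hψ.ofReal
  have hψCc : HasCompactSupport (fun z => (ψ z : ℂ)) :=
    hψc.comp_left (g := fun x : ℝ => (x : ℂ)) (by simp)
  obtain ⟨P, hP⟩ := hψc.exists_bound_of_continuous (ContDiff.continuous hψ)
  have hW : ∀ x, ‖rexp (-ψ x)‖ ≤ Real.exp P := fun x => by
    rw [Real.norm_of_nonneg (Real.exp_pos _).le, Real.exp_le_exp]
    have := abs_le.1 (hP x); linarith
  have hWc : Continuous fun x => rexp (-ψ x) :=
    Real.continuous_exp.comp (ContDiff.continuous hψ).neg
  have key : ∀ i, ∫ z, lev ψ z (fun j => mol (m i) (γ j) z) * rexp (-ψ z)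
      ≤ (∫ z, ‖mol (m i) d z + -∑ j, dz (fun z => (ψ z : ℂ)) j z * mol (m i) (γ j) z‖ ^ 2 * rexp (-ψ z))
        + (1/2) * ∑ j, ∑ k, ∫ z, ‖mol (m i) (a j k) z‖ ^ 2 * rexp (-ψ z) := by
    intro i
    have := basic_ineq hψ (β := fun j => mol (m i) (γ j)) (fun j => mol_sm (hm i) (lγ j))
      (fun j => mol_zero (hm i) (hγc j))
    have e1 : ∀ j k z, wD I (mol (m i) (γ j)) k z - wD I (mol (m i) (γ k)) j z
        = mol (m i) (a j k) z := by
      intro j k z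
      rw [mol_wD (hm i) (lγ j), mol_wD (hm i) (lγ k)]
      have := h1 j k _ ((hm i).refl_sm z) ((hm i).refl_cs z)
      rw [integral_sub] at this
      · rw [mol, ← neg_inj, ← this]; ring
      · exact mul_int_test (lγ j) (((hm i).refl_sm z).wD _ _).cont (wD_cs _ ((hm i).refl_cs z) _)
      · exact mul_int_test (lγ k) (((hm i).refl_sm z).wD _ _).cont (wD_cs _ ((hm i).refl_cs z) _)
    have e2 : ∀ z, ∑ j, del ψ (mol (m i) (γ j)) j z
        = mol (m i) d z + -∑ j, dz (fun z => (ψ z : ℂ)) j z * mol (m i) (γ j) z := by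
      intro z
      simp only [del]
      rw [Finset.sum_sub_distrib, ← sub_eq_add_neg]
      congr 1
      have := h2 _ ((hm i).refl_sm z) ((hm i).refl_cs z)
      rw [integral_finsetSum] at this
      · rw [mol, ← neg_inj, ← this, ← Finset.sum_neg_distrib]
        refine Finset.sum_congr rfl fun j _ => ?_
        rw [mol_wD (hm i) (lγ j)]; ring
      · intro j _
        exact mul_int_test (lγ j) (((hm i).refl_sm z).wD _ _).cont (wD_cs _ ((hm i).refl_cs z) _)
    simp_rw [e1, e2] at this
    exact this
  refine le_of_tendsto_of_tendsto' (b := atTop) ?_ ?_ key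
  · have hcm : ∀ j k, AEStronglyMeasurable (fun z => cHessian ψ z j k * (rexp (-ψ z) : ℂ)) volume :=
      fun j k => ((Sm.hess hψ j k).mul (Sm.expW hψ)).cont.aestronglyMeasurable
    have hcb' : ∀ j k, ∃ C, ∀ z, ‖cHessian ψ z j k * (rexp (-ψ z) : ℂ)‖ ≤ C := fun j k => by
      refine bdd_cs ((Sm.hess hψ j k).mul (Sm.expW hψ)).cont (HasCompactSupport.mul_right ?_)
      simp_rw [cHessian_eq]
      exact wD_cs _ (wD_cs _ hψCc _) _
    choose C hcb using hcb'
    have hform : ∀ u : Fin n → XX → ℂ, (∀ j, MemLp (u j) 2) →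
        ∫ z, lev ψ z (fun j => u j z) * rexp (-ψ z)
        = (∑ j, ∑ k, ∫ z, ((cHessian ψ z j k * rexp (-ψ z)) * u j z) * conj (u k z)).re := by
      intro u hu
      have hi : ∀ j k, Integrable (fun z => ((cHessian ψ z j k * rexp (-ψ z)) * u j z) * conj (u k z)) :=
        fun j k => memLp_inner_int (memLp_bmul (hcm j k) (hcb j k) (hu j)) (hu k)
      rw [Finset.sum_congr rfl fun j _ => (integral_finsetSum _ fun k _ => hi j k).symm,
        ← integral_finsetSum _ fun j _ => integrable_finsetSum _ fun k _ => hi j k]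
      rw [← RCLike.re_eq_complex_re, ← integral_re (integrable_finsetSum _ fun j _ => integrable_finsetSum _ fun k _ => hi j k)]
      congr 1; funext z
      rw [lev, ← Complex.re_mul_ofReal, RCLike.re_eq_complex_re, Finset.sum_mul]
      congr 1
      refine Finset.sum_congr rfl fun j _ => ?_
      rw [Finset.sum_mul]
      refine Finset.sum_congr rfl fun k _ => ?_
      ring
    rw [hform γ hγ]
    simp_rw [fun i => hform (fun j => mol (m i) (γ j)) (fun j => (Lγ j).mF i)]
    refine (Complex.continuous_re.tendsto _).comp ?_
    exact tendsto_finsetSum _ fun j _ => tendsto_finsetSum _ fun k _ =>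
      ((Lγ j).bmul (hcm j k) (hcb j k)).inner (Lγ k)
  · refine Tendsto.add ?_ (Tendsto.const_mul _ ?_)
    · refine (Ld.add (L2T.neg (L2T.sum fun j => ?_))).norm_sq hWc hW
      obtain ⟨C, hC⟩ := bdd_cs (hψC.wD (-I) j).cont (wD_cs (-I) hψCc j)
      exact (Lγ j).bmul (hψC.wD (-I) j).cont.aestronglyMeasurable hC
    · exact tendsto_finsetSum _ fun j _ => tendsto_finsetSum _ fun k _ =>
        (La j k).norm_sq hWc hW
lemma proj_abs {H : Type*} [NormedAddCommGroup H] [InnerProductSpace ℂ H] [CompleteSpace H]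
    (S : Set H) (x : H) : ∃ b : H, (∀ X ∈ S, inner ℂ X b = inner ℂ X x) ∧
      (∀ l : H →L[ℂ] ℂ, (∀ X ∈ S, l X = 0) → l b = 0) ∧
      (∀ C : ℝ, 0 ≤ C → (∀ X ∈ Submodule.span ℂ S, ‖inner ℂ X x‖ ≤ C * ‖X‖) → ‖b‖ ≤ C) := by
  let Z := (Submodule.span ℂ S).topologicalClosure
  have hZc : IsClosed (Z : Set H) := Submodule.isClosed_topologicalClosure _
  have : CompleteSpace Z := hZc.completeSpace_coe
  have hsub : Submodule.span ℂ S ≤ Z := Submodule.le_topologicalClosure _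
  let b : Z := ⟨Z.starProjection x, Z.starProjection_apply_mem x⟩
  have hb : ∀ X ∈ Z, inner ℂ X (b : H) = inner ℂ X x := by
    intro X hX
    have := Submodule.starProjection_inner_eq_zero (K := Z) x X hX
    rw [inner_sub_left, sub_eq_zero] at this
    rw [← inner_conj_symm, ← inner_conj_symm X x, this]
  refine ⟨b, fun X hX => hb X (hsub (Submodule.subset_span hX)), ?_, ?_⟩
  · intro l hl
    have h1 : Submodule.span ℂ S ≤ l.ker := Submodule.span_le.2 hl
    have h2 : Z ≤ l.ker := Submodule.topologicalClosure_minimal _ h1 l.isClosed_ker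
    exact h2 b.2
  · intro C hC0 hC
    have hcl : IsClosed {X : H | ‖inner ℂ X x‖ ≤ C * ‖X‖} :=
      isClosed_le (by fun_prop) (by fun_prop)
    have h2 : (Z : Set H) ⊆ {X : H | ‖inner ℂ X x‖ ≤ C * ‖X‖} := by
      rw [Submodule.topologicalClosure_coe]
      exact closure_minimal hC hcl
    have h3 : ‖inner ℂ (b : H) x‖ ≤ C * ‖(b : H)‖ := h2 b.2
    rw [← hb b b.2, inner_self_eq_norm_sq_to_K, norm_pow] at h3
    simp only [RCLike.norm_ofReal, abs_norm] at h3
    by_cases h0 : ‖(b : H)‖ = 0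
    · rw [h0]; exact hC0
    · have : 0 < ‖(b : H)‖ := lt_of_le_of_ne (norm_nonneg _) (Ne.symm h0)
      nlinarith
lemma toLp_inner {u v : XX → ℂ} (hu : MemLp u 2) (hv : MemLp v 2) :
    Inner.inner ℂ (hv.toLp v) (hu.toLp u) = ∫ x, u x * conj (v x) := by
  rw [L2.inner_def]
  refine integral_congr_ae ?_
  filter_upwards [hu.coeFn_toLp, hv.coeFn_toLp] with x h1 h2
  rw [h1, h2]; rfl
lemma exists_b (U : Set XX) {w : XX → ℂ} (hw : Continuous w)
    {bh : Fin n → XX → ℂ} (hbh : ∀ j, MemLp (bh j) 2) :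
    ∃ b : Fin n → XX → ℂ, (∀ j, MemLp (b j) 2) ∧
      (∀ G, Sm G → HasCompactSupport G → tsupport G ⊆ U →
        ∑ j, ∫ z, b j z * conj (w z * wD I G j z)
          = ∑ j, ∫ z, bh j z * conj (w z * wD I G j z)) ∧
      (∀ j k A B, MemLp A 2 → MemLp B 2 →
        (∀ G, Sm G → HasCompactSupport G → tsupport G ⊆ U →
          ∫ z, w z * wD I G j z * A z = ∫ z, w z * wD I G k z * B z) →
        ∫ z, b j z * A z = ∫ z, b k z * B z) := by
  have hm : ∀ G, Sm G → HasCompactSupport G → ∀ j, MemLp (fun z => w z * wD I G j z) 2 :=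
    fun G hG hc j => (hw.mul (hG.wD _ _).cont).memLp_of_hasCompactSupport
      (HasCompactSupport.mul_left (wD_cs _ hc _))
  let S : Set (PiLp 2 fun _ : Fin n => Lp ℂ 2 (volume : Measure XX)) :=
    {X | ∃ G, ∃ hG : Sm G, ∃ hc : HasCompactSupport G, tsupport G ⊆ U ∧
      X = WithLp.toLp 2 fun j => (hm G hG hc j).toLp _}
  obtain ⟨b, hb1, hb2, -⟩ := proj_abs S (WithLp.toLp 2 fun j => (hbh j).toLp _)
  have hbj : ∀ j, b j = (Lp.memLp (b j)).toLp (b j) := fun j => by simp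
  refine ⟨fun j => b j, fun j => Lp.memLp _, ?_, ?_⟩
  · intro G hG hc hs
    have := hb1 _ ⟨G, hG, hc, hs, rfl⟩
    rw [PiLp.inner_apply, PiLp.inner_apply] at this
    simp only [toLp_inner] at this
    rw [← this]
    refine Finset.sum_congr rfl fun j _ => ?_
    rw [← toLp_inner (Lp.memLp (b j)) (hm G hG hc j)]
    congr 1; exact (hbj j).symm
  · intro j k A B hA hB hAB
    have hA' : MemLp (fun z => conj (A z)) 2 := hA.star
    have hB' : MemLp (fun z => conj (B z)) 2 := hB.star
    let l : (PiLp 2 fun _ : Fin n => Lp ℂ 2 (volume : Measure XX)) →L[ℂ] ℂ :=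
      (innerSL ℂ (hA'.toLp _)).comp (PiLp.proj 2 _ j) - (innerSL ℂ (hB'.toLp _)).comp (PiLp.proj 2 _ k)
    have hl := hb2 l (by
      rintro X ⟨G, hG, hc, hs, rfl⟩
      have := hAB G hG hc hs
      simp only [l, sub_apply, ContinuousLinearMap.comp_apply, PiLp.proj_apply,
        innerSL_apply_apply, toLp_inner, Complex.conj_conj, this, sub_self])
    have e1 := toLp_inner (Lp.memLp (b j)) hA'
    have e2 := toLp_inner (Lp.memLp (b k)) hB'
    simp only [Complex.conj_conj] at e1 e2
    rw [← e1, ← e2, ← hbj, ← hbj]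
    exact sub_eq_zero.1 hl
lemma lev_integrable {ψ : XX → ℝ} (hψ : SmR ψ) {w : XX → ℝ} (hw : Continuous w)
    (hb : ∀ j k, ∃ C, ∀ z, ‖cHessian ψ z j k * (w z : ℂ)‖ ≤ C)
    {u : Fin n → XX → ℂ} (hu : ∀ j, MemLp (u j) 2) :
    Integrable (fun z => lev ψ z (fun j => u j z) * w z) := by
  choose C hC using hb
  have hi : ∀ j k, Integrable (fun z => ((cHessian ψ z j k * (w z : ℂ)) * u j z) * conj (u k z)) :=
    fun j k => memLp_inner_int (memLp_bmul (((Sm.hess hψ j k).cont.mul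
      (Complex.continuous_ofReal.comp hw)).aestronglyMeasurable) (hC j k) (hu j)) (hu k)
  have := (integrable_finsetSum Finset.univ fun j _ =>
    integrable_finsetSum Finset.univ fun k _ => hi j k).re
  refine this.congr (Eventually.of_forall fun z => ?_)
  simp only
  rw [lev, ← Complex.re_mul_ofReal, RCLike.re_eq_complex_re, Finset.sum_mul]
  congr 1
  refine Finset.sum_congr rfl fun j _ => ?_
  rw [Finset.sum_mul]
  refine Finset.sum_congr rfl fun k _ => ?_
  ring
lemma norm_sq_integrable {f : XX → ℂ} (hf : MemLp f 2) {w : XX → ℝ}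
    (hw : Continuous w) {C : ℝ} (hb : ∀ x, ‖w x‖ ≤ C) : Integrable (fun z => ‖f z‖ ^ 2 * w z) := by
  have h1 : Integrable (fun z => ‖f z‖ ^ 2) := by
    have := hf.integrable_norm_pow (p := 2) (by norm_num)
    simpa using this
  have := h1.bdd_mul (c := C) (f := w) hw.aestronglyMeasurable (Eventually.of_forall hb)
  simpa only [mul_comm] using this
lemma lev_congr {φ ψ : XX → ℝ} {z : XX} (h : φ =ᶠ[𝓝 z] ψ) (b : XX) :
    lev φ z b = lev ψ z b := by
  have hh : ∀ j k, cHessian φ z j k = cHessian ψ z j k := by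
    intro j k
    rw [cHessian_eq, cHessian_eq]
    refine wD_congr _ _ ?_
    have := h.eventually_nhds
    filter_upwards [this] with y hy
    exact wD_congr _ _ (hy.mono fun x hx => by simp [hx])
  simp only [lev, hh]
lemma lev_smul (φ : XX → ℝ) (z : XX) (c : ℝ) (b : XX) :
    lev φ z (fun j => (c : ℂ) * b j) = c ^ 2 * lev φ z b := by
  simp only [lev]
  rw [← Complex.re_ofReal_mul, Finset.mul_sum]
  congr 1
  refine Finset.sum_congr rfl fun j _ => ?_
  rw [Finset.mul_sum]
  refine Finset.sum_congr rfl fun k _ => ?_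
  rw [map_mul, Complex.conj_ofReal]; push_cast; ring
lemma lev_lin {φ l : XX → ℝ} (hφ : SmR φ) (hl : SmR l) (c : ℝ) (z b : XX) :
    lev (fun z => φ z - c * l z) z b = lev φ z b - c * lev l z b := by
  have h1 : ∀ j, dz (fun v => ((φ v - c * l v : ℝ) : ℂ)) j
      = fun z => dz (fun v => (φ v : ℂ)) j z - c * dz (fun v => (l v : ℂ)) j z := by
    intro j; funext z
    have := wD_sub (-I) j (hφ.ofReal.diff z) (((Sm.const c).mul hl.ofReal).diff z)
    rw [wD_mul _ _ ((Sm.const c).diff z) (hl.ofReal.diff z), wD_const] at this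
    simp only [zero_mul, zero_add] at this
    rw [← this]; congr 1; funext v; push_cast; ring
  have h2 : ∀ j k, cHessian (fun z => φ z - c * l z) z j k
      = cHessian φ z j k - c * cHessian l z j k := by
    intro j k
    rw [cHessian_eq, cHessian_eq, cHessian_eq, h1]
    have := wD_sub I k ((hφ.ofReal.wD (-I) j).diff z) (((Sm.const c).mul (hl.ofReal.wD (-I) j)).diff z)
    rw [wD_mul _ _ ((Sm.const c).diff z) ((hl.ofReal.wD (-I) j).diff z), wD_const] at this
    simp only [zero_mul, zero_add] at this
    exact this
  simp only [lev, h2]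
  rw [← Complex.re_ofReal_mul, ← Complex.sub_re, Finset.mul_sum, ← Finset.sum_sub_distrib]
  congr 1
  refine Finset.sum_congr rfl fun j _ => ?_
  rw [Finset.mul_sum, ← Finset.sum_sub_distrib]
  refine Finset.sum_congr rfl fun k _ => ?_
  ring
lemma norm3 (x y z : ℂ) : ‖x + y + z‖ ^ 2 ≤ 3 * (‖x‖ ^ 2 + ‖y‖ ^ 2 + ‖z‖ ^ 2) := by
  have h := norm_add₃_le (a := x) (b := y) (c := z)
  have h0 := norm_nonneg (x + y + z)
  nlinarith [sq_nonneg (‖x‖ - ‖y‖), sq_nonneg (‖y‖ - ‖z‖), sq_nonneg (‖x‖ - ‖z‖),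
    norm_nonneg x, norm_nonneg y, norm_nonneg z]
lemma core_pt (K L Φ lφ ll : ℝ) (X Y D : ℂ) (hll : ll ≤ - ‖Y‖ ^ 2) (A : ℝ) :
    K ^ 2 * rexp (2 * L) * lφ - 3 * K ^ 2 * rexp (-8 * L - Φ) * ‖D‖ ^ 2
        - rexp (2 * L) * (3 * ‖X‖ ^ 2 + A)
      ≤ (K * rexp (-(5 * L - Φ / 2))) ^ 2 * (lφ - 12 * ll) * rexp (-(Φ - 12 * L))
        - ‖(rexp (-(5 * L - Φ / 2)) : ℂ) * X + 2 * K * rexp (-(5 * L - Φ / 2)) * Y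
            + K * rexp (-(5 * L - Φ / 2)) ^ 2 * rexp (-Φ) * D‖ ^ 2 * rexp (-(Φ - 12 * L))
        - (rexp (-(5 * L - Φ / 2))) ^ 2 * A * rexp (-(Φ - 12 * L)) := by
  obtain ⟨ρ, hρ⟩ : ∃ ρ, ρ = rexp (-(5 * L - Φ / 2)) := ⟨_, rfl⟩
  obtain ⟨E, hE⟩ : ∃ E, E = rexp (-(Φ - 12 * L)) := ⟨_, rfl⟩
  obtain ⟨e, he⟩ : ∃ e, e = rexp (-Φ) := ⟨_, rfl⟩
  have h1 : rexp (2 * L) = ρ ^ 2 * E := by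
    rw [hρ, hE, ← Real.exp_nat_mul, ← Real.exp_add]; congr 1; push_cast; ring
  have h2 : rexp (-8 * L - Φ) = ρ ^ 4 * e ^ 2 * E := by
    rw [hρ, hE, he, ← Real.exp_nat_mul, ← Real.exp_nat_mul, ← Real.exp_add, ← Real.exp_add]
    congr 1; push_cast; ring
  have hρ0 : 0 < ρ := hρ ▸ Real.exp_pos _
  have hE0 : 0 < E := hE ▸ Real.exp_pos _
  have he0 : 0 < e := he ▸ Real.exp_pos _
  rw [h1, h2, ← hρ, ← hE, ← he]
  have h3 := norm3 ((ρ : ℂ) * X) (2 * K * ρ * Y) (K * ρ ^ 2 * e * D)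
  have n1 : ‖(ρ : ℂ) * X‖ ^ 2 = ρ ^ 2 * ‖X‖ ^ 2 := by
    rw [norm_mul, mul_pow, Complex.norm_real, Real.norm_eq_abs, sq_abs]
  have n2 : ‖2 * K * ρ * Y‖ ^ 2 = 4 * K ^ 2 * ρ ^ 2 * ‖Y‖ ^ 2 := by
    rw [norm_mul, norm_mul, norm_mul, mul_pow, mul_pow, mul_pow, Complex.norm_real, Complex.norm_real,
      Real.norm_eq_abs, Real.norm_eq_abs, sq_abs, sq_abs]; norm_num
  have n3 : ‖K * ρ ^ 2 * e * D‖ ^ 2 = K ^ 2 * ρ ^ 4 * e ^ 2 * ‖D‖ ^ 2 := by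
    rw [norm_mul, norm_mul, norm_mul, norm_pow, mul_pow, mul_pow, mul_pow, Complex.norm_real,
      Complex.norm_real, Complex.norm_real,
      Real.norm_eq_abs, Real.norm_eq_abs, Real.norm_eq_abs, sq_abs, sq_abs, ← pow_mul,
      abs_of_pos he0]
  rw [n1, n2, n3] at h3
  have h4 := mul_le_mul_of_nonneg_right h3 hE0.le
  have h5 : 0 ≤ 12 * K ^ 2 * ρ ^ 2 * E * (- ‖Y‖ ^ 2 - ll) := by
    have : 0 ≤ - ‖Y‖ ^ 2 - ll := by linarith
    positivity
  nlinarith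
lemma core_A {κ l φ ψ : XX → ℝ} (hκ : SmR κ) (hκc : HasCompactSupport κ) (hl : SmR l)
    (hφ : SmR φ) (hψ : SmR ψ) (hψc : HasCompactSupport ψ)
    (hψe : ∀ z ∈ tsupport κ, ψ =ᶠ[𝓝 z] fun z => φ z - 12 * l z)
    (hlev : ∀ z ∈ tsupport κ, ∀ b : XX,
      lev l z b ≤ - ‖∑ j, dz (fun z => (l z : ℂ)) j z * b j‖ ^ 2)
    {b : Fin n → XX → ℂ} (hb : ∀ j, MemLp (b j) 2) {D : XX → ℂ} (hD : Continuous D)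
    (P1 : ∀ G, Sm G → HasCompactSupport G → tsupport G ⊆ tsupport κ →
      ∑ j, ∫ z, b j z * conj ((rexp (5 * l z - φ z / 2) : ℂ) * wD I G j z)
        = - ∫ z, conj (G z) * D z * rexp (-φ z))
    (P2 : ∀ j k τ, Sm τ → HasCompactSupport τ → tsupport τ ⊆ tsupport κ →
      ∫ z, b j z * (wD I τ k z * rexp (-(5 * l z - φ z / 2)))
        = ∫ z, b k z * (wD I τ j z * rexp (-(5 * l z - φ z / 2))))
    {S : XX → ℝ} (hS : Integrable S)
    (hST : ∀ z, S z ≤ κ z ^ 2 * rexp (2 * l z) * lev φ z (fun j => b j z)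
      - 3 * κ z ^ 2 * rexp (-8 * l z - φ z) * ‖D z‖ ^ 2
      - rexp (2 * l z) * (3 * ‖∑ j, b j z * dz (fun z => (κ z : ℂ)) j z‖ ^ 2
        + (1/2) * ∑ j, ∑ k, ‖b j z * wD I (fun z => (κ z : ℂ)) k z
            - b k z * wD I (fun z => (κ z : ℂ)) j z‖ ^ 2)) :
    ∫ z, S z ≤ 0 := by
  have hθ : SmR (fun z => 5 * l z - φ z / 2) :=
    (ContDiff.sub (contDiff_const.mul hl) (ContDiff.div_const hφ 2))
  have hκC := hκ.ofReal
  have hκCc : HasCompactSupport (fun z => (κ z : ℂ)) :=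
    hκc.comp_left (g := fun x : ℝ => (x : ℂ)) (by simp)
  have hts : tsupport (fun z => (κ z : ℂ)) ⊆ tsupport κ :=
    closure_mono fun z hz => by simpa using hz
  obtain ⟨κ1, hκ1⟩ : ∃ κ1 : XX → ℂ, κ1 = fun z => (κ z : ℂ) := ⟨_, rfl⟩
  obtain ⟨e1, he1⟩ : ∃ e1 : XX → ℂ,
    e1 = fun z => ((rexp (-(5 * l z - φ z / 2)) : ℝ) : ℂ) := ⟨_, rfl⟩
  obtain ⟨θ1, hθ1⟩ : ∃ θ1 : XX → ℂ,
    θ1 = fun z => ((5 * l z - φ z / 2 : ℝ) : ℂ) := ⟨_, rfl⟩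
  have se1 : Sm e1 := he1 ▸ Sm.expW hθ
  have sθ1 : Sm θ1 := hθ1 ▸ hθ.ofReal
  have lb : ∀ j, LocallyIntegrable (b j) := fun j => (hb j).locallyIntegrable (by norm_num)
  rw [← hκ1] at hκC hκCc hts
  simp only [← hκ1] at hST
  have de1 : ∀ c j z, wD c e1 j z = - wD c θ1 j z * e1 z := by
    intro c j z; rw [he1, hθ1]; exact wD_expW c j (hθ.diff z)
  have hcb : ∀ {c : XX → ℂ}, Continuous c → HasCompactSupport c → ∀ j,
      MemLp (fun z => c z * b j z) 2 := by
    intro c h1 h2 j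
    obtain ⟨C, hC⟩ := bdd_cs h1 h2
    exact memLp_bmul h1.aestronglyMeasurable hC (hb j)
  let γ : Fin n → XX → ℂ := fun j z => (κ1 z * e1 z) * b j z
  let a : Fin n → Fin n → XX → ℂ := fun j k z =>
    (e1 z * wD I κ1 k z) * b j z - (e1 z * wD I κ1 j z) * b k z
  let d : XX → ℂ := fun z => (∑ j, (e1 z * (dz κ1 j z - 2 * κ1 z * dz θ1 j z)) * b j z)
    + κ1 z * e1 z ^ 2 * (rexp (-φ z) : ℂ) * D z
  have sdk : ∀ j, Sm (fun z => e1 z * (dz κ1 j z - 2 * κ1 z * dz θ1 j z)) := fun j =>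
    se1.mul ((hκC.wD _ _).sub (((Sm.const 2).mul hκC).mul (sθ1.wD _ _)))
  have cdk : ∀ j, HasCompactSupport (fun z => e1 z * (dz κ1 j z - 2 * κ1 z * dz θ1 j z)) :=
    fun j => HasCompactSupport.mul_left (HasCompactSupport.sub (wD_cs _ hκCc _)
      (HasCompactSupport.mul_right (HasCompactSupport.mul_left hκCc)))
  have cD : Continuous (fun z => κ1 z * e1 z ^ 2 * (rexp (-φ z) : ℂ) * D z) :=
    ((hκC.cont.mul (se1.cont.pow 2)).mul (Sm.expW hφ).cont).mul hD
  have cDc : HasCompactSupport (fun z => κ1 z * e1 z ^ 2 * (rexp (-φ z) : ℂ) * D z) :=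
    HasCompactSupport.mul_right (HasCompactSupport.mul_right (HasCompactSupport.mul_right hκCc))
  have hγ : ∀ j, MemLp (γ j) 2 := hcb (hκC.mul se1).cont (HasCompactSupport.mul_right hκCc)
  have ha : ∀ j k, MemLp (a j k) 2 := fun j k =>
    (hcb (se1.mul (hκC.wD _ _)).cont (HasCompactSupport.mul_left (wD_cs _ hκCc _)) j).sub
    (hcb (se1.mul (hκC.wD _ _)).cont (HasCompactSupport.mul_left (wD_cs _ hκCc _)) k)
  have hd : MemLp d 2 :=
    (memLp_finsetSum _ fun j _ => hcb (sdk j).cont (cdk j) j).add (cD.memLp_of_hasCompactSupport cDc)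
  have hγc : ∀ j, HasCompactSupport (γ j) := fun j =>
    HasCompactSupport.mul_right (HasCompactSupport.mul_right hκCc)
  have hac : ∀ j k, HasCompactSupport (a j k) := fun j k =>
    HasCompactSupport.sub (HasCompactSupport.mul_right (HasCompactSupport.mul_left (wD_cs _ hκCc _)))
     (HasCompactSupport.mul_right (HasCompactSupport.mul_left (wD_cs _ hκCc _)))
  have out : ∀ z, z ∉ tsupport κ → κ1 z = 0 ∧ ∀ c j, wD c κ1 j z = 0 := fun z hz =>
    ⟨image_eq_zero_of_notMem_tsupport fun h => hz (hts h), fun c j =>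
      image_eq_zero_of_notMem_tsupport fun h => hz (hts (wD_tsupport c _ j h))⟩
  have hdc : HasCompactSupport d := HasCompactSupport.intro hκc.isCompact fun z hz => by
    simp [d, (out z hz).1, (out z hz).2]
  have hbi : ∀ (j : Fin n) (g : XX → ℂ), Sm g → HasCompactSupport g →
    Integrable (fun y => b j y * g y) := fun j g h1 h2 => mul_int_test (lb j) h1.cont h2
  have h1 : ∀ j k τ, Sm τ → HasCompactSupport τ →
      ∫ z, (γ j z * wD I τ k z - γ k z * wD I τ j z) = - ∫ z, a j k z * τ z := by
    intro j k τ hτ hτc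
    have := P2 j k (fun z => κ1 z * τ z) (hκC.mul hτ) hτc.mul_left
      ((tsupport_mul_subset_left).trans hts)
    simp only [wD_mul _ _ (hκC.diff _) (hτ.diff _)] at this
    have ee : ∀ z, ((rexp (-(5 * l z - φ z / 2)) : ℝ) : ℂ) = e1 z := fun z => by rw [he1]
    simp only [ee] at this
    have i1 : ∀ i j, Integrable fun z => b i z * ((wD I κ1 j z * τ z + κ1 z * wD I τ j z) * e1 z) :=
      fun i j => hbi i _ ((((hκC.wD _ _).mul hτ).add (hκC.mul (hτ.wD _ _))).mul se1)
       (HasCompactSupport.mul_right (HasCompactSupport.add hτc.mul_left (HasCompactSupport.mul_right hκCc)))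
    have i2 : Integrable fun z => a j k z * τ z := by
      have u1 := hbi j (fun z => e1 z * wD I κ1 k z * τ z) ((se1.mul (hκC.wD _ _)).mul hτ) hτc.mul_left
      have u2 := hbi k (fun z => e1 z * wD I κ1 j z * τ z) ((se1.mul (hκC.wD _ _)).mul hτ) hτc.mul_left
      refine (u1.sub u2).congr (Eventually.of_forall fun z => ?_)
      simp only [a, Pi.sub_apply]; ring
    rw [← sub_eq_zero, ← integral_sub (i1 _ _) (i1 _ _)] at this
    refine eq_neg_of_add_eq_zero_left ?_
    rw [← integral_add _ i2, ← this]
    · congr 1; funext z; simp only [γ, a]; ring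
    · have u1 := hbi j (fun z => κ1 z * e1 z * wD I τ k z) ((hκC.mul se1).mul (hτ.wD _ _))
        (HasCompactSupport.mul_left (wD_cs _ hτc _))
      have u2 := hbi k (fun z => κ1 z * e1 z * wD I τ j z) ((hκC.mul se1).mul (hτ.wD _ _))
        (HasCompactSupport.mul_left (wD_cs _ hτc _))
      refine (u1.sub u2).congr (Eventually.of_forall fun z => ?_)
      simp only [γ, Pi.sub_apply]; ring
  have h2 : ∀ τ, Sm τ → HasCompactSupport τ →
      ∫ z, ∑ j, γ j z * dz τ j z = - ∫ z, d z * τ z := by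
    intro τ hτ hτc
    have sH : Sm (fun z => κ1 z * τ z * (e1 z * e1 z)) := (hκC.mul hτ).mul (se1.mul se1)
    have cH : HasCompactSupport (fun z => κ1 z * τ z * (e1 z * e1 z)) :=
      HasCompactSupport.mul_right hτc.mul_left
    have := P1 (fun z => conj (κ1 z * τ z * (e1 z * e1 z))) sH.conj
      (cH.comp_left (map_zero _)) (by
        refine Set.Subset.trans (closure_mono ?_) hts
        intro z hz h0
        simp [h0] at hz)
    have dH : ∀ j z, dz (fun z => κ1 z * τ z * (e1 z * e1 z)) j z
        = ((dz κ1 j z * τ z + κ1 z * dz τ j z) - 2 * κ1 z * τ z * dz θ1 j z) * (e1 z * e1 z) := by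
      intro j z
      rw [wD_mul _ _ ((hκC.mul hτ).diff z) ((se1.mul se1).diff z), wD_mul _ _ (hκC.diff z) (hτ.diff z),
        wD_mul _ _ (se1.diff z) (se1.diff z), de1]; ring
    have ee : ∀ z, ((rexp (5 * l z - φ z / 2) : ℝ) : ℂ) * e1 z = 1 := fun z => by
      rw [he1]; beta_reduce; rw [← Complex.ofReal_mul, ← Real.exp_add]; simp
    have lhs : ∀ j z, b j z * conj ((rexp (5 * l z - φ z / 2) : ℂ)
          * wD I (fun z => conj (κ1 z * τ z * (e1 z * e1 z))) j z)
        = γ j z * dz τ j z + (e1 z * (dz κ1 j z - 2 * κ1 z * dz θ1 j z)) * b j z * τ z := by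
      intro j z
      rw [wD_conj I j (sH.diff z), map_mul, Complex.conj_conj, Complex.conj_ofReal, Complex.conj_I, dH]
      simp only [γ]
      linear_combination (b j z * e1 z * ((dz κ1 j z * τ z + κ1 z * dz τ j z) - 2 * κ1 z * τ z * dz θ1 j z)) * ee z
    simp only [lhs, Complex.conj_conj] at this
    have i1 : ∀ j, Integrable fun z => γ j z * dz τ j z := fun j => by
      refine (hbi j (fun z => κ1 z * e1 z * dz τ j z) ((hκC.mul se1).mul (hτ.wD _ _))
        (HasCompactSupport.mul_left (wD_cs _ hτc _))).congr (Eventually.of_forall fun z => ?_)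
      simp only [γ]; ring
    have i2 : ∀ j, Integrable fun z => (e1 z * (dz κ1 j z - 2 * κ1 z * dz θ1 j z)) * b j z * τ z :=
      fun j => by
      refine (hbi j _ ((sdk j).mul hτ) hτc.mul_left).congr (Eventually.of_forall fun z => ?_)
      simp only; ring
    have i3 : Integrable (fun z => κ1 z * e1 z ^ 2 * (rexp (-φ z) : ℂ) * D z * τ z) :=
      (cD.mul hτ.cont).integrable_of_hasCompactSupport hτc.mul_left
    have e3 : ∫ z, d z * τ z = (∑ j, ∫ z, (e1 z * (dz κ1 j z - 2 * κ1 z * dz θ1 j z)) * b j z * τ z)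
        + ∫ z, κ1 z * e1 z ^ 2 * (rexp (-φ z) : ℂ) * D z * τ z := by
      rw [← integral_finsetSum _ fun j _ => i2 j, ← integral_add (integrable_finsetSum _ fun j _ => i2 j) i3]
      congr 1; funext z; simp only [d, add_mul, Finset.sum_mul]
    rw [Finset.sum_congr rfl fun j _ => integral_add (i1 j) (i2 j), Finset.sum_add_distrib] at this
    rw [integral_finsetSum _ fun j _ => i1 j, e3]
    have e4 : ∫ z, κ1 z * τ z * (e1 z * e1 z) * D z * (rexp (-φ z) : ℂ)
        = ∫ z, κ1 z * e1 z ^ 2 * (rexp (-φ z) : ℂ) * D z * τ z := by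
      congr 1; funext z; ring
    rw [e4] at this
    linear_combination this
  have hB := prop_B hψ hψc hγ hγc ha hac hd hdc h1 h2
  obtain ⟨P, hP⟩ := hψc.exists_bound_of_continuous (ContDiff.continuous hψ)
  have hW : ∀ x, ‖rexp (-ψ x)‖ ≤ Real.exp P := fun x => by
    rw [Real.norm_of_nonneg (Real.exp_pos _).le, Real.exp_le_exp]
    have := abs_le.1 (hP x); linarith
  have hWc : Continuous fun x => rexp (-ψ x) :=
    Real.continuous_exp.comp (ContDiff.continuous hψ).neg
  have hψCc : HasCompactSupport (fun z => (ψ z : ℂ)) :=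
    hψc.comp_left (g := fun x : ℝ => (x : ℂ)) (by simp)
  have iP : Integrable (fun z => lev ψ z (fun j => γ j z) * rexp (-ψ z)) := by
    refine lev_integrable hψ hWc (fun j k => ?_) hγ
    refine bdd_cs ((Sm.hess hψ j k).mul (Sm.expW hψ)).cont (HasCompactSupport.mul_right ?_)
    simp_rw [cHessian_eq]
    exact wD_cs _ (wD_cs _ hψCc _) _
  have iQ : Integrable (fun z => ‖d z - ∑ j, dz (fun z => (ψ z : ℂ)) j z * γ j z‖ ^ 2 * rexp (-ψ z)) := by
    refine norm_sq_integrable (hd.sub (memLp_finsetSum _ fun j _ => ?_)) hWc hW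
    obtain ⟨C, hC⟩ := bdd_cs (hψ.ofReal.wD (-I) j).cont (wD_cs (-I) hψCc j)
    exact memLp_bmul (hψ.ofReal.wD (-I) j).cont.aestronglyMeasurable hC (hγ j)
  have iA : ∀ j k, Integrable (fun z => ‖a j k z‖ ^ 2 * rexp (-ψ z)) := fun j k =>
    norm_sq_integrable (ha j k) hWc hW
  have iAA := (integrable_finsetSum Finset.univ fun j _ =>
    integrable_finsetSum Finset.univ fun k _ => iA j k).const_mul (1/2)
  rw [← Finset.sum_congr rfl fun j _ => integral_finsetSum _ fun k _ => iA j k,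
    ← integral_finsetSum _ fun j _ => integrable_finsetSum _ fun k _ => iA j k,
    ← integral_const_mul, ← integral_add iQ iAA, ← sub_nonpos, ← integral_sub iP (iQ.fun_add iAA)] at hB
  refine le_trans (integral_mono hS (iP.sub (iQ.fun_add iAA)) fun z => (hST z).trans ?_) hB
  simp only [Pi.sub_apply]
  by_cases hz : z ∈ tsupport κ
  · have hz1 := hψe z hz
    have e0 : ψ z = φ z - 12 * l z := hz1.self_of_nhds
    have eD : ∀ j, dz (fun z => (ψ z : ℂ)) j z
        = dz (fun z => (φ z : ℂ)) j z - 12 * dz (fun z => (l z : ℂ)) j z := by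
      intro j
      rw [wD_congr (g := fun z => (φ z : ℂ) - 12 * (l z : ℂ)) (-I) j (hz1.mono fun x hx => by simp [hx]),
        wD_sub _ _ (hφ.ofReal.diff z) (((Sm.const 12).mul hl.ofReal).diff z),
        wD_mul _ _ ((Sm.const 12).diff z) (hl.ofReal.diff z), wD_const]; ring
    have eθ : ∀ j, dz θ1 j z
        = 5 * dz (fun z => (l z : ℂ)) j z - (1/2) * dz (fun z => (φ z : ℂ)) j z := by
      intro j
      rw [hθ1, show (fun z => ((5 * l z - φ z / 2 : ℝ) : ℂ)) = fun z => 5 * (l z : ℂ) - (1/2) * (φ z : ℂ) by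
          funext z; push_cast; ring,
        wD_sub _ _ (((Sm.const 5).mul hl.ofReal).diff z) (((Sm.const (1/2)).mul hφ.ofReal).diff z),
        wD_mul _ _ ((Sm.const 5).diff z) (hl.ofReal.diff z),
        wD_mul _ _ ((Sm.const (1/2)).diff z) (hφ.ofReal.diff z), wD_const, wD_const]; ring
    have hpt := core_pt (κ z) (l z) (φ z) (lev φ z (fun j => b j z)) (lev l z (fun j => b j z))
      (∑ j, b j z * dz κ1 j z) (∑ j, dz (fun z => (l z : ℂ)) j z * b j z) (D z)
      (hlev z hz _) ((1/2) * ∑ j, ∑ k, ‖b j z * wD I κ1 k z - b k z * wD I κ1 j z‖ ^ 2)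
    refine hpt.trans (le_of_eq ?_)
    have ez : e1 z = (rexp (-(5 * l z - φ z / 2)) : ℂ) := by rw [he1]
    have kz : κ1 z = (κ z : ℂ) := by rw [hκ1]
    have t1 : lev ψ z (fun j => γ j z) = (κ z * rexp (-(5 * l z - φ z / 2))) ^ 2 *
        (lev φ z (fun j => b j z) - 12 * lev l z (fun j => b j z)) := by
      rw [lev_congr hz1, ← lev_lin hφ hl, ← lev_smul]
      simp only [γ, ez, kz]; push_cast; rfl
    have t2 : d z - ∑ j, dz (fun z => (ψ z : ℂ)) j z * γ j z
        = (rexp (-(5 * l z - φ z / 2)) : ℂ) * (∑ j, b j z * dz κ1 j z)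
          + 2 * κ z * rexp (-(5 * l z - φ z / 2)) * (∑ j, dz (fun z => (l z : ℂ)) j z * b j z)
          + κ z * rexp (-(5 * l z - φ z / 2)) ^ 2 * rexp (-φ z) * D z := by
      simp only [d, γ, ← ez, ← kz, eD, eθ]
      rw [add_sub_right_comm, ← Finset.sum_sub_distrib, Finset.mul_sum, Finset.mul_sum,
        ← Finset.sum_add_distrib]
      congr 1
      refine Finset.sum_congr rfl fun j _ => ?_
      ring
    have t3 : ∀ j k, ‖a j k z‖ ^ 2 = rexp (-(5 * l z - φ z / 2)) ^ 2 *
        ‖b j z * wD I κ1 k z - b k z * wD I κ1 j z‖ ^ 2 := by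
      intro j k
      rw [show a j k z = (rexp (-(5 * l z - φ z / 2)) : ℂ) * (b j z * wD I κ1 k z - b k z * wD I κ1 j z) by
        simp only [a, ← ez]; ring, norm_mul, mul_pow, Complex.norm_real, Real.norm_eq_abs, sq_abs]
    rw [t1, t2, e0]
    simp only [t3, ← Finset.mul_sum, ← Finset.sum_mul]
    ring
  · have kz : κ z = 0 := image_eq_zero_of_notMem_tsupport hz
    simp [kz, γ, d, a, (out z hz).1, (out z hz).2, lev]
lemma cs_sum {f g : Fin n → XX → ℂ} (hf : ∀ j, MemLp (f j) 2) (hg : ∀ j, MemLp (g j) 2) :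
    ‖∑ j, ∫ z, f j z * conj (g j z)‖ ^ 2
      ≤ (∫ z, ∑ j, ‖f j z‖ ^ 2) * (∫ z, ∑ j, ‖g j z‖ ^ 2) := by
  let x : PiLp 2 fun _ : Fin n => Lp ℂ 2 (volume : Measure XX) :=
    WithLp.toLp 2 fun j => (hf j).toLp _
  let y : PiLp 2 fun _ : Fin n => Lp ℂ 2 (volume : Measure XX) :=
    WithLp.toLp 2 fun j => (hg j).toLp _
  have h1 : inner ℂ y x = ∑ j, ∫ z, f j z * conj (g j z) := by
    rw [PiLp.inner_apply]; simp only [x, y, toLp_inner]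
  have h2 : ∀ {u : Fin n → XX → ℂ} (hu : ∀ j, MemLp (u j) 2),
      ‖(WithLp.toLp 2 fun j => (hu j).toLp _ :
        PiLp 2 fun _ : Fin n => Lp ℂ 2 (volume : Measure XX))‖ ^ 2 = ∫ z, ∑ j, ‖u j z‖ ^ 2 := by
    intro u hu
    rw [← inner_self_eq_norm_sq (𝕜 := ℂ), PiLp.inner_apply]
    simp only [toLp_inner]
    rw [integral_finsetSum _ fun j _ => by simpa using (hu j).integrable_norm_pow (p := 2) (by norm_num), map_sum]
    refine Finset.sum_congr rfl fun j _ => ?_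
    rw [← integral_re (memLp_inner_int (hu j) (hu j))]
    congr 1; funext z
    rw [Complex.mul_conj, Complex.normSq_eq_norm_sq]; simp [← Complex.ofReal_pow]
  have h3 := norm_inner_le_norm (𝕜 := ℂ) y x
  rw [← h1, ← h2 hf, ← h2 hg]
  calc _ ≤ (‖y‖ * ‖x‖) ^ 2 := by gcongr
    _ = _ := by rw [mul_pow, mul_comm]
lemma cont_div {f w : XX → ℂ} (hf : Continuous f) (hw : Continuous w)
    (h : ∀ z ∈ tsupport f, w z ≠ 0) : Continuous (fun z => f z * (w z)⁻¹) := by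
  rw [continuous_iff_continuousAt]
  intro z
  by_cases hz : z ∈ tsupport f
  · exact hf.continuousAt.mul (hw.continuousAt.inv₀ (h z hz))
  · have h0 : f =ᶠ[𝓝 z] fun _ => 0 := notMem_tsupport_iff_eventuallyEq.mp hz
    have : (fun z => f z * (w z)⁻¹) =ᶠ[𝓝 z] fun _ => 0 := h0.mono fun x hx => by simp [hx]
    exact continuousAt_const.congr this.symm
lemma wD_real_conj {q : XX → ℝ} (hq : SmR q) (c : ℂ) (j : Fin n) (z : XX) :
    wD c (fun z => (q z : ℂ)) j z = conj (wD (conj c) (fun z => (q z : ℂ)) j z) := by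
  have := wD_conj c j (hq.ofReal.diff z)
  simp only [Complex.conj_ofReal] at this
  exact this
lemma lev_log {q l : XX → ℝ} (hq : SmR q) {z : XX} (hz : 0 < q z)
    (hl : l =ᶠ[𝓝 z] fun z => Real.log (q z)) (b : XX) :
    lev l z b = (q z)⁻¹ * lev q z b - ‖∑ j, dz (fun z => (l z : ℂ)) j z * b j‖ ^ 2 := by
  have hpos : ∀ᶠ y in 𝓝 z, 0 < q y :=
    (ContDiff.continuous hq).continuousAt.eventually (lt_mem_nhds hz)
  have h1 : ∀ c j, wD c (fun z => (l z : ℂ)) j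
      =ᶠ[𝓝 z] fun y => (((q y)⁻¹ : ℝ) : ℂ) * wD c (fun z => (q z : ℂ)) j y := by
    intro c j
    filter_upwards [hl.eventually_nhds, hpos] with y hy hy0
    rw [wD_congr (g := fun z => ((Real.log (q z) : ℝ) : ℂ)) c j (hy.mono fun x hx => by simp [hx])]
    rw [wD_comp c (g := Real.log) j (hq.diff y) (Real.hasDerivAt_log hy0.ne')]
  have h1z : ∀ c j, wD c (fun z => (l z : ℂ)) j z = (((q z)⁻¹ : ℝ) : ℂ) * wD c (fun z => (q z : ℂ)) j z :=
    fun c j => (h1 c j).self_of_nhds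
  have hinv : DifferentiableAt ℝ (fun y => (((q y)⁻¹ : ℝ) : ℂ)) z :=
    Complex.ofRealCLM.differentiableAt.comp z ((hq.diff z).inv hz.ne')
  have h2 : ∀ j k, cHessian l z j k = (((q z)⁻¹ : ℝ) : ℂ) * cHessian q z j k
      - dz (fun z => (l z : ℂ)) j z * conj (dz (fun z => (l z : ℂ)) k z) := by
    intro j k
    rw [cHessian_eq, cHessian_eq, wD_congr I k (h1 (-I) j),
      wD_mul _ _ hinv ((hq.ofReal.wD _ _).diff z),
      wD_comp I (g := fun t => t⁻¹) k (hq.diff z) (hasDerivAt_inv hz.ne'), h1z, h1z, map_mul,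
      Complex.conj_ofReal, wD_real_conj hq I k, Complex.conj_I]
    push_cast
    field_simp
    ring
  have h3 : ((‖∑ j, dz (fun z => (l z : ℂ)) j z * b j‖ ^ 2 : ℝ) : ℂ)
      = ∑ j, ∑ k, dz (fun z => (l z : ℂ)) j z * b j *
        conj (dz (fun z => (l z : ℂ)) k z * b k) := by
    rw [← Complex.normSq_eq_norm_sq, ← Complex.mul_conj, map_sum, Finset.sum_mul_sum]
  have h4 : ‖∑ j, dz (fun z => (l z : ℂ)) j z * b j‖ ^ 2
     = (∑ j, ∑ k, dz (fun z => (l z : ℂ)) j z * b j *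
        conj (dz (fun z => (l z : ℂ)) k z * b k)).re := by
    rw [← h3, Complex.ofReal_re]
  rw [h4, lev, lev, ← Complex.re_ofReal_mul, ← Complex.sub_re, Finset.mul_sum, ← Finset.sum_sub_distrib]
  congr 1
  refine Finset.sum_congr rfl fun j _ => ?_
  rw [Finset.mul_sum, ← Finset.sum_sub_distrib]
  refine Finset.sum_congr rfl fun k _ => ?_
  rw [h2, map_mul]; ring
lemma term3 {m r : ℝ} (hr : 0 ≤ r) {b c c' : XX} (h1 : ∀ j, r * ‖c j‖ ≤ m)
    (h2 : ∀ j, r * ‖c' j‖ ≤ m) :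
    r ^ 2 * (3 * ‖∑ j, b j * c j‖ ^ 2 + (1/2) * ∑ j, ∑ k, ‖b j * c' k - b k * c' j‖ ^ 2)
      ≤ 5 * n * m ^ 2 * ∑ j, ‖b j‖ ^ 2 := by
  have s0 : r ^ 2 * ‖∑ j, b j * c j‖ ^ 2 ≤ n * m ^ 2 * ∑ j, ‖b j‖ ^ 2 := by
    have : r * ‖∑ j, b j * c j‖ ≤ ∑ j, m * ‖b j‖ := by
      calc r * ‖∑ j, b j * c j‖ ≤ r * ∑ j, ‖b j * c j‖ := by gcongr; exact norm_sum_le _ _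
        _ = ∑ j, (r * ‖c j‖) * ‖b j‖ := by
          rw [Finset.mul_sum]; refine Finset.sum_congr rfl fun j _ => ?_
          rw [norm_mul]; ring
        _ ≤ _ := by gcongr with j; exact h1 j
    calc r ^ 2 * ‖∑ j, b j * c j‖ ^ 2 = (r * ‖∑ j, b j * c j‖) ^ 2 := by ring
      _ ≤ (∑ j, m * ‖b j‖) ^ 2 := by gcongr
      _ ≤ (Finset.univ : Finset (Fin n)).card * ∑ j, (m * ‖b j‖) ^ 2 := sq_sum_le_card_mul_sum_sq
      _ = _ := by simp only [Finset.card_univ, Fintype.card_fin, mul_pow, ← Finset.mul_sum]; ring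
  have s1 : ∀ j k, r ^ 2 * ‖b j * c' k - b k * c' j‖ ^ 2 ≤ 2 * m ^ 2 * (‖b j‖ ^ 2 + ‖b k‖ ^ 2) := by
    intro j k
    have : r * ‖b j * c' k - b k * c' j‖ ≤ m * ‖b j‖ + m * ‖b k‖ := by
      calc r * ‖b j * c' k - b k * c' j‖ ≤ r * (‖b j * c' k‖ + ‖b k * c' j‖) := by
            gcongr; exact norm_sub_le _ _
        _ = (r * ‖c' k‖) * ‖b j‖ + (r * ‖c' j‖) * ‖b k‖ := by rw [norm_mul, norm_mul]; ring
        _ ≤ _ := by gcongr <;> apply h2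
    have h0 : 0 ≤ r * ‖b j * c' k - b k * c' j‖ := by positivity
    nlinarith [sq_nonneg (m * ‖b j‖ - m * ‖b k‖)]
  have s2 : r ^ 2 * ∑ j, ∑ k, ‖b j * c' k - b k * c' j‖ ^ 2 ≤ 4 * n * m ^ 2 * ∑ j, ‖b j‖ ^ 2 := by
    rw [Finset.mul_sum]
    calc ∑ j, r ^ 2 * ∑ k, ‖b j * c' k - b k * c' j‖ ^ 2
        ≤ ∑ j, ∑ k, 2 * m ^ 2 * (‖b j‖ ^ 2 + ‖b k‖ ^ 2) := by
          refine Finset.sum_le_sum fun j _ => ?_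
          rw [Finset.mul_sum]
          exact Finset.sum_le_sum fun k _ => s1 j k
      _ = _ := by
          simp only [← Finset.mul_sum, Finset.sum_add_distrib, Finset.sum_const, Finset.card_univ,
            Fintype.card_fin, nsmul_eq_mul]
          ring
  nlinarith
lemma st_deriv : ∃ C : ℝ, 0 ≤ C ∧ (∀ t, |deriv Real.smoothTransition t| ≤ C) ∧
    ∀ t, t ≤ 0 ∨ 1 ≤ t → deriv Real.smoothTransition t = 0 := by
  have h0 : ∀ t, t ≤ 0 ∨ 1 ≤ t → deriv Real.smoothTransition t = 0 := by
    have hc : Continuous (deriv Real.smoothTransition) :=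
      (Real.smoothTransition.contDiff (n := 1)).continuous_deriv le_rfl
    have hcl : IsClosed {t : ℝ | deriv Real.smoothTransition t = 0} := isClosed_eq hc continuous_const
    have a1 : Set.Iic (0:ℝ) ⊆ {t : ℝ | deriv Real.smoothTransition t = 0} := by
      rw [← closure_Iio]
      refine closure_minimal (fun t ht => ?_) hcl
      have : Real.smoothTransition =ᶠ[𝓝 t] fun _ => 0 :=
        Filter.mem_of_superset (Iio_mem_nhds (Set.mem_Iio.1 ht)) fun x hx => Real.smoothTransition.zero_of_nonpos (le_of_lt hx)
      simp [this.deriv_eq]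
    have a2 : Set.Ici (1:ℝ) ⊆ {t : ℝ | deriv Real.smoothTransition t = 0} := by
      rw [← closure_Ioi]
      refine closure_minimal (fun t ht => ?_) hcl
      have : Real.smoothTransition =ᶠ[𝓝 t] fun _ => 1 :=
        Filter.mem_of_superset (Ioi_mem_nhds (Set.mem_Ioi.1 ht)) fun x hx => Real.smoothTransition.one_of_one_le (le_of_lt hx)
      simp [this.deriv_eq]
    rintro t (h | h)
    exacts [a1 h, a2 h]
  have hc : Continuous (deriv Real.smoothTransition) :=
    (Real.smoothTransition.contDiff (n := 1)).continuous_deriv le_rfl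
  obtain ⟨C, hC⟩ := (isCompact_Icc (a := (0:ℝ)) (b := 1)).exists_bound_of_continuousOn hc.continuousOn
  refine ⟨|C|, abs_nonneg _, fun t => ?_, h0⟩
  by_cases h : t ∈ Set.Icc (0:ℝ) 1
  · exact (hC t h).trans (le_abs_self _)
  · rw [h0 t, abs_zero]; · positivity
    rw [Set.mem_Icc, not_and_or] at h
    rcases h with h | h
    · left; linarith
    · right; linarith
lemma hlog_sm {ν : ℝ} (hν : 0 < ν) :
    ContDiff ℝ ∞ (fun t => Real.smoothTransition (4 * ν * t - 1) * Real.log t) := by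
  rw [contDiff_iff_contDiffAt]
  intro t
  by_cases ht : 0 < t
  · exact (Real.smoothTransition.contDiff.comp
      ((contDiff_const.mul contDiff_id).sub contDiff_const)).contDiffAt.mul
      (Real.contDiffAt_log.2 ht.ne')
  · have : (fun t => Real.smoothTransition (4 * ν * t - 1) * Real.log t) =ᶠ[𝓝 t] fun _ => 0 := by
      have h1 : t < 1 / (4 * ν) := lt_of_le_of_lt (not_lt.1 ht) (by positivity)
      filter_upwards [Iio_mem_nhds h1] with x hx
      rw [Real.smoothTransition.zero_of_nonpos, zero_mul]
      rw [Set.mem_Iio, lt_div_iff₀ (by positivity)] at hx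
      linarith
    exact contDiffAt_const.congr_of_eventuallyEq this
lemma prop_A1 {q φ : XX → ℝ} (hq : SmR q) (hφ : SmR φ) (hK : IsCompact {z | 0 ≤ q z})
    (h1 : ∀ z, 0 < q z → ∀ b, 0 ≤ lev φ z b) (h2 : ∀ z, 0 < q z → ∀ b, lev q z b ≤ 0)
    {K : Set XX} (hKm : MeasurableSet K) (hKq : ∀ z ∈ K, 1/2 ≤ q z)
    {lam : ℝ} (hlam : 0 < lam) (h3 : ∀ z ∈ K, ∀ b : XX, lam * ∑ j, ‖b j‖ ^ 2 ≤ lev φ z b)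
    {b : Fin n → XX → ℂ} (hb : ∀ j, MemLp (b j) 2) {D : XX → ℂ} (hD : Continuous D)
    (hDq : ∀ z, D z ≠ 0 → 1/2 ≤ q z) (hDc : HasCompactSupport D)
    (P1 : ∀ G, Sm G → HasCompactSupport G → tsupport G ⊆ {z | 0 < q z} →
      ∑ j, ∫ z, b j z * conj (((q z ^ 5 * rexp (-φ z / 2) : ℝ) : ℂ) * wD I G j z)
        = - ∫ z, conj (G z) * D z * rexp (-φ z))
    (P2 : ∀ j k τ, Sm τ → HasCompactSupport τ → tsupport τ ⊆ {z | 0 < q z} →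
      ∫ z, b j z * (wD I τ k z * ((q z ^ 5 * rexp (-φ z / 2) : ℝ) : ℂ)⁻¹)
        = ∫ z, b k z * (wD I τ j z * ((q z ^ 5 * rexp (-φ z / 2) : ℝ) : ℂ)⁻¹))
    {Cs Cq : ℝ} (hCs0 : 0 ≤ Cs) (hCs : ∀ t, |deriv Real.smoothTransition t| ≤ Cs)
    (hCs' : ∀ t, t ≤ 0 ∨ 1 ≤ t → deriv Real.smoothTransition t = 0)
    (hCq0 : 0 ≤ Cq) (hCq : ∀ z, 0 ≤ q z → ∀ j, ‖wD I (fun z => (q z : ℂ)) j z‖ ≤ Cq ∧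
      ‖dz (fun z => (q z : ℂ)) j z‖ ≤ Cq) {ν : ℝ} (hν : 4 ≤ ν) :
    lam / 4 * ∫ z in K, ∑ j, ‖b j z‖ ^ 2 ≤ 768 * (∫ z, ‖D z‖ ^ 2 * rexp (-φ z))
      + 5 * n * (2 * Cs * Cq) ^ 2 * ∫ z in {z | 0 < q z ∧ ν * q z ≤ 2}, ∑ j, ‖b j z‖ ^ 2 := by
  have hν0 : 0 < ν := by linarith
  have hqc : Continuous q := ContDiff.continuous hq
  obtain ⟨κ, hκ⟩ : ∃ κ : XX → ℝ, κ = fun z => Real.smoothTransition (ν * q z - 1) := ⟨_, rfl⟩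
  obtain ⟨l, hl⟩ : ∃ l : XX → ℝ,
    l = fun z => Real.smoothTransition (4 * ν * q z - 1) * Real.log (q z) := ⟨_, rfl⟩
  have sκ : SmR κ := hκ ▸ Real.smoothTransition.contDiff.comp ((contDiff_const.mul hq).sub contDiff_const)
  have sl : SmR l := hl ▸ (hlog_sm hν0).comp hq
  have κ0 : ∀ z, q z ≤ 1 / ν → κ z = 0 := fun z hz => by
    rw [hκ]; apply Real.smoothTransition.zero_of_nonpos
    rw [le_div_iff₀ hν0] at hz; linarith
  have κc : HasCompactSupport κ := HasCompactSupport.intro hK fun z hz => κ0 z (by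
    simp only [Set.mem_ofPred_eq, not_le] at hz
    exact hz.le.trans (by positivity))
  have tκ : ∀ z ∈ tsupport κ, 1 / ν ≤ q z := by
    refine closure_minimal (fun z hz => ?_) (isClosed_le continuous_const hqc)
    by_contra h
    exact hz (κ0 z (not_le.1 h).le)
  have l_eq : ∀ z, 1 / ν ≤ q z → l =ᶠ[𝓝 z] (fun z => Real.log (q z)) ∧
      ∀ᶠ y in 𝓝 z, Real.smoothTransition (4 * ν * q y - 1) = 1 := by
    intro z hz
    have : ∀ᶠ y in 𝓝 z, Real.smoothTransition (4 * ν * q y - 1) = 1 := by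
      have : 1 / (2 * ν) < q z := lt_of_lt_of_le (by
        apply one_div_lt_one_div_of_lt hν0; linarith) hz
      filter_upwards [hqc.continuousAt.eventually (lt_mem_nhds this)] with y hy
      apply Real.smoothTransition.one_of_one_le
      rw [div_lt_iff₀ (by positivity)] at hy
      linarith
    refine ⟨this.mono fun y hy => ?_, this⟩
    rw [hl]; simp only [hy, one_mul]
  have qpos : ∀ z, 1 / ν ≤ q z → 0 < q z := fun z hz => lt_of_lt_of_le (by positivity) hz
  have el : ∀ z, 1 / ν ≤ q z → rexp (l z) = q z := fun z hz => by
    rw [(l_eq z hz).1.self_of_nhds, Real.exp_log (qpos z hz)]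
  have ew : ∀ z, 1 / ν ≤ q z → rexp (5 * l z - φ z / 2) = q z ^ 5 * rexp (-φ z / 2) := by
    intro z hz
    rw [← el z hz, ← Real.exp_nat_mul, ← Real.exp_add]; congr 1; push_cast; ring
  have dκ : ∀ c j z, wD c (fun z => (κ z : ℂ)) j z
      = ((deriv Real.smoothTransition (ν * q z - 1) * ν : ℝ) : ℂ) * wD c (fun z => (q z : ℂ)) j z := by
    intro c j z
    have hd : HasDerivAt (fun t => Real.smoothTransition (ν * t - 1))
        (deriv Real.smoothTransition (ν * q z - 1) * ν) (q z) := by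
      have a := ((Real.smoothTransition.contDiff (n := 1)).differentiable (by norm_num)
        (ν * q z - 1)).hasDerivAt
      have b : HasDerivAt (fun t => ν * t - 1) ν (q z) := by
        simpa using ((hasDerivAt_id (q z)).const_mul ν).sub_const 1
      exact a.comp (q z) b
    rw [hκ]
    exact wD_comp c (g := fun t => Real.smoothTransition (ν * t - 1)) j (hq.diff z) hd
  have hsum : Integrable (fun z => ∑ j, ‖b j z‖ ^ 2) :=
    integrable_finsetSum _ fun j _ => (hb j).integrable_norm_pow (p := 2) (by norm_num)
  have hDi : Integrable (fun z => ‖D z‖ ^ 2 * rexp (-φ z)) :=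
    Continuous.integrable_of_hasCompactSupport
      ((hD.norm.pow 2).mul (Real.continuous_exp.comp (ContDiff.continuous hφ).neg))
      (HasCompactSupport.mul_right (by
        exact hDc.comp_left (g := fun x : ℂ => ‖x‖ ^ 2) (by simp)))
  have hAm : MeasurableSet {z | 0 < q z ∧ ν * q z ≤ 2} :=
    (measurableSet_lt measurable_const hqc.measurable).inter
      (measurableSet_le (hqc.measurable.const_mul ν) measurable_const)
  have key := core_A sκ κc sl hφ (ψ := fun z => Real.smoothTransition (4 * ν * q z - 1) * φ z - 12 * l z)
    (ContDiff.sub ((Real.smoothTransition.contDiff.comp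
      ((contDiff_const.mul hq).sub contDiff_const)).mul hφ) (contDiff_const.mul sl))
    (HasCompactSupport.intro hK fun z hz => by
      simp only [Set.mem_ofPred_eq, not_le] at hz
      have : Real.smoothTransition (4 * ν * q z - 1) = 0 := by
        apply Real.smoothTransition.zero_of_nonpos
        nlinarith
      simp only [hl, this]; ring)
    (fun z hz => by
      filter_upwards [(l_eq z (tκ z hz)).2] with y hy
      rw [hy, one_mul])
    (fun z hz c => by
      rw [lev_log hq (qpos z (tκ z hz)) (l_eq z (tκ z hz)).1]
      have := mul_nonneg (inv_nonneg.2 (qpos z (tκ z hz)).le) (neg_nonneg.2 (h2 z (qpos z (tκ z hz)) c))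
      linarith)
    hb hD
    (fun G hG hc ht => by
      rw [← P1 G hG hc (ht.trans fun z hz => qpos z (tκ z hz))]
      refine Finset.sum_congr rfl fun j _ => ?_
      congr 1; funext z
      by_cases hz : z ∈ tsupport G
      · rw [ew z (tκ z (ht hz))]
      · have : wD I G j z = 0 := image_eq_zero_of_notMem_tsupport fun h => hz (wD_tsupport _ _ _ h)
        simp [this])
    (fun j k τ hτ hc ht => by
      have e : ∀ j z, wD I τ j z * ((rexp (-(5 * l z - φ z / 2)) : ℝ) : ℂ)
          = wD I τ j z * ((q z ^ 5 * rexp (-φ z / 2) : ℝ) : ℂ)⁻¹ := by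
        intro j z
        by_cases hz : z ∈ tsupport τ
        · rw [Real.exp_neg, ew z (tκ z (ht hz)), Complex.ofReal_inv]
        · have : wD I τ j z = 0 := image_eq_zero_of_notMem_tsupport fun h => hz (wD_tsupport _ _ _ h)
          simp [this]
      simp only [e]
      exact P2 j k τ hτ hc (ht.trans fun z hz => qpos z (tκ z hz)))
    (S := fun z => lam / 4 * K.indicator (fun z => ∑ j, ‖b j z‖ ^ 2) z - 768 * (‖D z‖ ^ 2 * rexp (-φ z))
      - 5 * n * (2 * Cs * Cq) ^ 2 *
        ({z | 0 < q z ∧ ν * q z ≤ 2} : Set XX).indicator (fun z => ∑ j, ‖b j z‖ ^ 2) z)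
    ((((hsum.indicator hKm).const_mul _).sub (hDi.const_mul _)).sub ((hsum.indicator hAm).const_mul _))
    (fun z => by
      have bs : 0 ≤ ∑ j, ‖b j z‖ ^ 2 := by positivity
      have Ai : 0 ≤ ({z | 0 < q z ∧ ν * q z ≤ 2} : Set XX).indicator
        (fun z => ∑ j, ‖b j z‖ ^ 2) z := Set.indicator_nonneg (fun z _ => by positivity) z
      have M0 : 0 ≤ 5 * n * (2 * Cs * Cq) ^ 2 := by positivity
      have kinv : 1 / ν ≤ 1 / 4 := one_div_le_one_div_of_le (by norm_num) hν
      by_cases hz : 1 / ν ≤ q z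
      · have hz0 := qpos z hz
        have e1 : rexp (2 * l z) = q z ^ 2 := by
          rw [← el z hz, ← Real.exp_nat_mul]; norm_num
        have t1 : lam / 4 * K.indicator (fun z => ∑ j, ‖b j z‖ ^ 2) z
            ≤ κ z ^ 2 * rexp (2 * l z) * lev φ z (fun j => b j z) := by
          have h10 := h1 z hz0 (fun j => b j z)
          by_cases hk : z ∈ K
          · rw [Set.indicator_of_mem hk, e1]
            have k1 : κ z = 1 := by
              rw [hκ]; apply Real.smoothTransition.one_of_one_le
              have := hKq z hk; nlinarith
            have := h3 z hk (fun j => b j z)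
            have q4 : 1/4 ≤ q z ^ 2 := by have := hKq z hk; nlinarith
            rw [k1]
            calc lam / 4 * ∑ j, ‖b j z‖ ^ 2 = 1/4 * (lam * ∑ j, ‖b j z‖ ^ 2) := by ring
              _ ≤ q z ^ 2 * lev φ z (fun j => b j z) := by gcongr
              _ = _ := by ring
          · rw [Set.indicator_of_notMem hk, mul_zero]; positivity
        have t2 : 3 * κ z ^ 2 * rexp (-8 * l z - φ z) * ‖D z‖ ^ 2
            ≤ 768 * (‖D z‖ ^ 2 * rexp (-φ z)) := by
          by_cases hd : D z = 0
          · simp [hd]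
          have hq2 := hDq z hd
          have e2 : rexp (-8 * l z - φ z) = (q z ^ 8)⁻¹ * rexp (-φ z) := by
            rw [← el z hz, ← Real.exp_nat_mul, ← Real.exp_neg, ← Real.exp_add]
            congr 1; push_cast; ring
          have q8 : (q z ^ 8)⁻¹ ≤ 256 := by
            rw [inv_le_comm₀ (by positivity) (by norm_num)]
            calc (256:ℝ)⁻¹ = (1/2)^8 := by norm_num
              _ ≤ _ := by gcongr
          have k1 : κ z ^ 2 ≤ 1 := by
            rw [hκ]; exact pow_le_one₀ (Real.smoothTransition.nonneg _) (Real.smoothTransition.le_one _)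
          rw [e2]
          calc 3 * κ z ^ 2 * ((q z ^ 8)⁻¹ * rexp (-φ z)) * ‖D z‖ ^ 2
              ≤ 3 * 1 * (256 * rexp (-φ z)) * ‖D z‖ ^ 2 := by gcongr
            _ = _ := by ring
        have t3 : rexp (2 * l z) * (3 * ‖∑ j, b j z * dz (fun z => (κ z : ℂ)) j z‖ ^ 2
            + (1/2) * ∑ j, ∑ k, ‖b j z * wD I (fun z => (κ z : ℂ)) k z
            - b k z * wD I (fun z => (κ z : ℂ)) j z‖ ^ 2) ≤ 5 * n * (2 * Cs * Cq) ^ 2 *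
        ({z | 0 < q z ∧ ν * q z ≤ 2} : Set XX).indicator (fun z => ∑ j, ‖b j z‖ ^ 2) z := by
          by_cases h2 : ν * q z ≤ 2
          · have hm : z ∈ {z | 0 < q z ∧ ν * q z ≤ 2} := ⟨hz0, h2⟩
            rw [Set.indicator_of_mem hm, e1]
            have gen : ∀ c : ℂ, (∀ j, ‖wD c (fun z => (q z : ℂ)) j z‖ ≤ Cq) → ∀ j,
                q z * ‖wD c (fun z => (κ z : ℂ)) j z‖ ≤ 2 * Cs * Cq := by
              intro c hc j
              rw [dκ, norm_mul, Complex.norm_real, norm_mul, Real.norm_eq_abs, Real.norm_eq_abs,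
                abs_of_pos hν0]
              calc q z * (|deriv Real.smoothTransition (ν * q z - 1)| * ν
                    * ‖wD c (fun z => (q z : ℂ)) j z‖)
                  = (ν * q z) * |deriv Real.smoothTransition (ν * q z - 1)|
                    * ‖wD c (fun z => (q z : ℂ)) j z‖ := by ring
                _ ≤ 2 * Cs * Cq := by gcongr; exacts [hCs _, hc j]
            exact term3 hz0.le (gen _ fun j => (hCq z hz0.le j).2) (gen _ fun j => (hCq z hz0.le j).1)
          · have : ∀ c j, wD c (fun z => (κ z : ℂ)) j z = 0 := fun c j => by
              rw [dκ, hCs' _ (Or.inr (by linarith))]; simp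
            simp only [this]
            simp only [mul_zero, Finset.sum_const_zero, norm_zero, sub_zero]
            norm_num
            positivity
        linarith
      · have hz' := (not_le.1 hz).le
        have k0 := κ0 z hz'
        have : ∀ c j, wD c (fun z => (κ z : ℂ)) j z = 0 := fun c j => by
          rw [dκ, hCs' _ (Or.inl _)]; · simp
          rw [le_div_iff₀ hν0] at hz'; linarith
        have hk : z ∉ K := fun h => hz ((kinv.trans (by norm_num)).trans (hKq z h))
        rw [Set.indicator_of_notMem hk]
        simp only [this, k0]
        simp only [mul_zero, Finset.sum_const_zero, norm_zero, sub_zero]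
        have : 0 ≤ 768 * (‖D z‖ ^ 2 * rexp (-φ z)) := by positivity
        have := mul_nonneg M0 Ai
        norm_num
        linarith)
  have hi1 : Integrable (fun z => lam / 4 * K.indicator (fun z => ∑ j, ‖b j z‖ ^ 2) z
      - 768 * (‖D z‖ ^ 2 * rexp (-φ z))) :=
    ((hsum.indicator hKm).const_mul _).sub (hDi.const_mul _)
  rw [integral_sub hi1 ((hsum.indicator hAm).const_mul _),
    integral_sub ((hsum.indicator hKm).const_mul _) (hDi.const_mul _), integral_const_mul,
    integral_const_mul, integral_const_mul, integral_indicator hKm, integral_indicator hAm] at key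
  linarith
lemma prop_A {q φ : XX → ℝ} (hq : SmR q) (hφ : SmR φ) (hK : IsCompact {z | 0 ≤ q z})
    (h1 : ∀ z, 0 < q z → ∀ b, 0 ≤ lev φ z b) (h2 : ∀ z, 0 < q z → ∀ b, lev q z b ≤ 0)
    {F : XX → ℂ} (hF : Sm F) (hFc : HasCompactSupport F)
    (hFq : ∀ z ∈ tsupport F, 1/2 ≤ q z ∧ q z ≤ 2)
    {lam : ℝ} (hlam : 0 < lam)
    (h3 : ∀ z ∈ tsupport F, ∀ b : XX, lam * ∑ j, ‖b j‖ ^ 2 ≤ lev φ z b)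
    {β : Fin n → XX → ℂ} (hβ : ∀ j, Sm (β j)) (hβc : ∀ j, HasCompactSupport (β j))
    (hβq : ∀ j, ∀ z ∈ tsupport (β j), 1/2 ≤ q z) :
    ‖∑ j, ∫ z, β j z * conj (wD I F j z) * rexp (-φ z)‖ ^ 2
      ≤ 3 * 2 ^ 20 / lam * (∫ z, (∑ j, ‖wD I F j z‖ ^ 2) * rexp (-φ z))
        * ∫ z, ‖∑ j, del φ (β j) j z‖ ^ 2 * rexp (-φ z) := by
  have hqc : Continuous q := ContDiff.continuous hq
  have hφc : Continuous φ := ContDiff.continuous hφ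
  obtain ⟨w, hw⟩ : ∃ w : XX → ℂ,
    w = fun z => ((q z ^ 5 * rexp (-φ z / 2) : ℝ) : ℂ) := ⟨_, rfl⟩
  have hwc : Continuous w := by rw [hw]; fun_prop
  obtain ⟨D, hDd⟩ : ∃ D : XX → ℂ, D = fun z => ∑ j, del φ (β j) j z := ⟨_, rfl⟩
  have w0 : ∀ z, 0 < q z → w z ≠ 0 := fun z hz => by
    rw [hw]; exact Complex.ofReal_ne_zero.2 (by positivity)
  have wconj : ∀ z, conj (w z) = w z := fun z => by rw [hw]; exact Complex.conj_ofReal _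
  obtain ⟨bh, hbh⟩ : ∃ bh : Fin n → XX → ℂ,
    bh = fun j z => (β j z * rexp (-φ z)) * (w z)⁻¹ := ⟨_, rfl⟩
  have bhc : ∀ j, Continuous (bh j) := fun j => by
    rw [hbh]
    refine cont_div (f := fun z => β j z * rexp (-φ z)) ((hβ j).mul (Sm.expW hφ)).cont hwc ?_
    intro z hz
    have : z ∈ tsupport (β j) := tsupport_mul_subset_left hz
    exact w0 z (lt_of_lt_of_le (by norm_num) (hβq j z this))
  have bhm : ∀ j, MemLp (bh j) 2 := fun j => (bhc j).memLp_of_hasCompactSupport (by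
    rw [hbh]; exact HasCompactSupport.mul_right (HasCompactSupport.mul_right (hβc j)))
  have bhw : ∀ j z, bh j z * w z = β j z * rexp (-φ z) := by
    intro j z
    by_cases hz : z ∈ tsupport (β j)
    · rw [hbh]; simp only
      rw [inv_mul_cancel_right₀ (w0 z (lt_of_lt_of_le (by norm_num) (hβq j z hz)))]
    · rw [hbh]; simp [image_eq_zero_of_notMem_tsupport hz]
  obtain ⟨b, hb, hb1, hb2⟩ := exists_b {z | 0 < q z} hwc bhm
  have hDs : Sm D := by rw [hDd]; exact Sm.sum fun j => Sm.del hφ (hβ j) j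
  have hDz : ∀ z, (∀ j, z ∉ tsupport (β j)) → D z = 0 := fun z hz => by
    rw [hDd]; simp only
    refine Finset.sum_eq_zero fun j _ => ?_
    rw [del, image_eq_zero_of_notMem_tsupport (hz j),
      image_eq_zero_of_notMem_tsupport fun h => hz j (wD_tsupport _ _ _ h)]; ring
  have hDc : HasCompactSupport D := by
    refine HasCompactSupport.intro (K := ⋃ j, tsupport (β j)) (isCompact_iUnion fun j => (hβc j).isCompact)
      fun z hz => hDz z fun j hj => hz (Set.mem_iUnion.2 ⟨j, hj⟩)
  have adj : ∀ G, Sm G → ∑ j, ∫ z, bh j z * conj (w z * wD I G j z)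
      = - ∫ z, conj (G z) * D z * rexp (-φ z) := by
    intro G hG
    have e : ∀ j, ∫ z, bh j z * conj (w z * wD I G j z)
        = - ∫ z, del φ (β j) j z * conj (G z) * rexp (-φ z) := by
      intro j
      have := delta_adj hφ (hβ j) hG (hβc j) j
      simp only [del]
      rw [this, neg_neg]
      congr 1; funext z
      rw [map_mul, wconj, ← mul_assoc, bhw]; ring
    simp only [e]
    rw [Finset.sum_neg_distrib, ← integral_finsetSum]
    · congr 2; funext z; rw [hDd]; simp only [Finset.mul_sum, Finset.sum_mul]
      exact Finset.sum_congr rfl fun j _ => by ring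
    · intro j _
      exact (((Sm.del hφ (hβ j) j).mul hG.conj).mul (Sm.expW hφ)).cont.integrable_of_hasCompactSupport
        (HasCompactSupport.mul_right (HasCompactSupport.mul_right (del_cs φ (hβc j) j)))
  have P1 : ∀ G, Sm G → HasCompactSupport G → tsupport G ⊆ {z | 0 < q z} →
      ∑ j, ∫ z, b j z * conj (w z * wD I G j z)
        = - ∫ z, conj (G z) * D z * rexp (-φ z) := fun G hG hGc hGt => by
    rw [hb1 G hG hGc hGt, adj G hG]
  have P2 : ∀ j k τ, Sm τ → HasCompactSupport τ → tsupport τ ⊆ {z | 0 < q z} →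
      ∫ z, b j z * (wD I τ k z * (w z)⁻¹) = ∫ z, b k z * (wD I τ j z * (w z)⁻¹) := by
    intro j k τ hτ hτc hτt
    have cA : ∀ k, Continuous (fun z => wD I τ k z * (w z)⁻¹) := fun k =>
      cont_div (hτ.wD _ _).cont hwc fun z hz => w0 z (hτt (wD_tsupport _ _ _ hz))
    have mA : ∀ k, MemLp (fun z => wD I τ k z * (w z)⁻¹) 2 := fun k =>
      (cA k).memLp_of_hasCompactSupport (HasCompactSupport.mul_right (wD_cs _ hτc _))
    refine hb2 j k _ _ (mA k) (mA j) fun G hG hGc hGt => ?_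
    have cancel : ∀ i k z, w z * wD I G i z * (wD I τ k z * (w z)⁻¹) = wD I G i z * wD I τ k z := by
      intro i k z
      by_cases hz : z ∈ tsupport τ
      · field_simp [w0 z (hτt hz)]
      · have : wD I τ k z = 0 := image_eq_zero_of_notMem_tsupport fun h => hz (wD_tsupport _ _ _ h)
        simp [this]
    simp only [cancel]
    rw [wD_ibp I (hG.wD _ _) hτ (wD_cs _ hGc _) k, wD_ibp I (hG.wD _ _) hτ (wD_cs _ hGc _) j]
    simp only [wD_comm I I hG j k]
  obtain ⟨Cs, hCs0, hCs, hCs'⟩ := st_deriv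
  have exC : ∀ c j, ∃ C, ∀ z ∈ {z | 0 ≤ q z}, ‖wD c (fun z => (q z : ℂ)) j z‖ ≤ C := fun c j =>
    hK.exists_bound_of_continuousOn (hq.ofReal.wD c j).cont.continuousOn
  choose C hC using exC
  obtain ⟨Cq, hCqd⟩ : ∃ Cq, Cq = ∑ j, (|C I j| + |C (-I) j|) := ⟨_, rfl⟩
  have hCqj : ∀ j, |C I j| + |C (-I) j| ≤ Cq := fun j => by
    rw [hCqd]
    exact Finset.single_le_sum (f := fun j => |C I j| + |C (-I) j|) (fun j _ => by positivity)
      (Finset.mem_univ j)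
  have hCq0 : 0 ≤ Cq := by rw [hCqd]; positivity
  have hsum : Integrable (fun z => ∑ j, ‖b j z‖ ^ 2) :=
    integrable_finsetSum _ fun j _ => (hb j).integrable_norm_pow (p := 2) (by norm_num)
  have hT : MeasurableSet (tsupport F) := (isClosed_tsupport F).measurableSet
  have est := fun (ν : ℕ) => prop_A1 hq hφ hK h1 h2 hT (fun z hz => (hFq z hz).1) hlam h3 hb hDs.cont
    (fun z hz => by
      by_contra hlt
      exact hz (hDz z fun j hj => hlt (hβq j z hj))) hDc
    (by simpa only [hw] using P1) (by simpa only [hw] using P2) hCs0 hCs hCs' hCq0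
    (fun z hz j => ⟨(hC I j z hz).trans ((le_abs_self _).trans
        ((le_add_of_nonneg_right (abs_nonneg _)).trans (hCqj j))),
      (hC (-I) j z hz).trans ((le_abs_self _).trans
        ((le_add_of_nonneg_left (abs_nonneg _)).trans (hCqj j)))⟩)
    (ν := (ν : ℝ) + 4) (by linarith [(Nat.cast_nonneg ν : (0:ℝ) ≤ ν)])
  have lim : Tendsto (fun ν : ℕ => ∫ z in {z | 0 < q z ∧ ((ν : ℝ) + 4) * q z ≤ 2}, ∑ j, ‖b j z‖ ^ 2)
      atTop (𝓝 0) := by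
    have := tendsto_setIntegral_of_antitone (μ := (volume : Measure XX))
      (f := fun z => ∑ j, ‖b j z‖ ^ 2)
      (s := fun ν : ℕ => {z | 0 < q z ∧ ((ν : ℝ) + 4) * q z ≤ 2})
      (fun ν => (measurableSet_lt measurable_const hqc.measurable).inter
        (measurableSet_le (hqc.measurable.const_mul _) measurable_const))
      (fun a c hac z hz => ⟨hz.1, le_trans (by
        have : (a : ℝ) ≤ c := by exact_mod_cast hac
        have := hz.1
        gcongr) hz.2⟩) ⟨0, hsum.integrableOn⟩
    have he : (⋂ ν : ℕ, {z | 0 < q z ∧ ((ν : ℝ) + 4) * q z ≤ 2}) = ∅ := by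
      ext z
      simp only [Set.mem_iInter, Set.mem_empty_iff_false, iff_false]
      intro h
      have hz0 : 0 < q z := (h 0).1
      obtain ⟨N, hN⟩ := exists_nat_gt (2 / q z)
      have := (h N).2
      rw [div_lt_iff₀ hz0] at hN
      nlinarith
    rw [he] at this
    simpa using this
  have fin1 : lam / 4 * ∫ z in tsupport F, ∑ j, ‖b j z‖ ^ 2
      ≤ 768 * (∫ z, ‖D z‖ ^ 2 * rexp (-φ z)) := by
    have lim2 := (tendsto_const_nhds (x := 768 * (∫ z, ‖D z‖ ^ 2 * rexp (-φ z)))).add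
      (lim.const_mul (5 * n * (2 * Cs * Cq) ^ 2))
    rw [mul_zero, add_zero] at lim2
    exact ge_of_tendsto' lim2 est
  have hL : ∑ j, ∫ z, β j z * conj (wD I F j z) * rexp (-φ z)
      = ∑ j, ∫ z, (tsupport F).indicator (b j) z * conj (w z * wD I F j z) := by
    have e1 : ∀ j, ∫ z, β j z * conj (wD I F j z) * rexp (-φ z)
        = ∫ z, bh j z * conj (w z * wD I F j z) := fun j => by
      congr 1; funext z
      rw [map_mul, wconj, ← mul_assoc, bhw]; ring
    simp only [e1]
    rw [← hb1 F hF hFc fun z hz => lt_of_lt_of_le (by norm_num) (hFq z hz).1]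
    refine Finset.sum_congr rfl fun j _ => ?_
    congr 1; funext z
    by_cases hz : z ∈ tsupport F
    · rw [Set.indicator_of_mem hz]
    · have : wD I F j z = 0 := image_eq_zero_of_notMem_tsupport fun h => hz (wD_tsupport _ _ _ h)
      simp [this]
  have cs := cs_sum (f := fun j => (tsupport F).indicator (b j)) (g := fun j z => w z * wD I F j z)
    (fun j => (hb j).indicator hT) (fun j => (hwc.mul (hF.wD _ _).cont).memLp_of_hasCompactSupport
      (HasCompactSupport.mul_left (wD_cs _ hFc _)))
  rw [hL]
  refine cs.trans ?_
  have g1 : ∫ z, ∑ j, ‖(tsupport F).indicator (b j) z‖ ^ 2 = ∫ z in tsupport F, ∑ j, ‖b j z‖ ^ 2 := by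
    rw [← integral_indicator hT]
    congr 1; funext z
    by_cases hz : z ∈ tsupport F
    · simp [hz]
    · simp [hz]
  have g2 : ∫ z, ∑ j, ‖w z * wD I F j z‖ ^ 2
      ≤ 2 ^ 10 * ∫ z, (∑ j, ‖wD I F j z‖ ^ 2) * rexp (-φ z) := by
    rw [← integral_const_mul]
    have csF : ∀ j, HasCompactSupport (fun z => ‖wD I F j z‖ ^ 2) := fun j =>
      (wD_cs I hFc j).comp_left (g := fun x : ℂ => ‖x‖ ^ 2) (by simp)
    have c0 : ∀ j, Continuous (wD I F j) := fun j => (hF.wD _ _).cont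
    refine integral_mono ?_ ?_ fun z => ?_
    · refine integrable_finsetSum _ fun j _ => ?_
      refine Continuous.integrable_of_hasCompactSupport (by fun_prop) ?_
      exact (HasCompactSupport.mul_left (wD_cs I hFc j) : HasCompactSupport fun z => w z * wD I F j z).comp_left
        (g := fun x : ℂ => ‖x‖ ^ 2) (by simp)
    · refine Integrable.const_mul ?_ _
      simp only [Finset.sum_mul]
      refine integrable_finsetSum _ fun j _ => ?_
      exact Continuous.integrable_of_hasCompactSupport (by fun_prop) (csF j).mul_right
    · simp only
      rw [Finset.sum_mul, Finset.mul_sum]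
      refine Finset.sum_le_sum fun j _ => ?_
      by_cases hz : z ∈ tsupport F
      · have hq2 := hFq z hz
        have q0 : 0 ≤ q z := by linarith [hq2.1]
        have : ‖w z‖ ^ 2 ≤ 2 ^ 10 * rexp (-φ z) := by
          rw [hw]; simp only
          rw [Complex.norm_real, Real.norm_eq_abs, sq_abs, mul_pow, ← pow_mul, ← Real.exp_nat_mul]
          have : ((2:ℕ):ℝ) * (-φ z / 2) = -φ z := by push_cast; ring
          rw [this]
          gcongr
          exact hq2.2
        rw [norm_mul, mul_pow]
        calc ‖w z‖ ^ 2 * ‖wD I F j z‖ ^ 2 ≤ (2 ^ 10 * rexp (-φ z)) * ‖wD I F j z‖ ^ 2 := by gcongr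
          _ = _ := by ring
      · have : wD I F j z = 0 := image_eq_zero_of_notMem_tsupport fun h => hz (wD_tsupport _ _ _ h)
        simp [this]
  have i0 : 0 ≤ ∫ z, ‖D z‖ ^ 2 * rexp (-φ z) := integral_nonneg fun z => by positivity
  have i1 : 0 ≤ ∫ z, ∑ j, ‖w z * wD I F j z‖ ^ 2 := integral_nonneg fun z => by positivity
  have f2 : ∫ z in tsupport F, ∑ j, ‖b j z‖ ^ 2 ≤ 3072 / lam * ∫ z, ‖D z‖ ^ 2 * rexp (-φ z) := by
    rw [div_mul_eq_mul_div, le_div_iff₀ hlam]; linarith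
  rw [g1]
  have hDe : ∀ z, D z = ∑ j, del φ (β j) j z := fun z => by rw [hDd]
  simp only [← hDe]
  calc _ ≤ (3072 / lam * ∫ z, ‖D z‖ ^ 2 * rexp (-φ z))
        * (2 ^ 10 * ∫ z, (∑ j, ‖wD I F j z‖ ^ 2) * rexp (-φ z)) := by gcongr
    _ = _ := by ring
lemma fd_wD {f : XX → ℂ} (z w : XX) :
    fderiv ℝ f z w = ∑ j, (dz f j z * w j + wD I f j z * conj (w j)) := by
  have hw : w = ∑ j, ((w j).re • (Pi.single j (1:ℂ) : XX) + (w j).im • (Pi.single j I : XX)) := by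
    funext i
    rw [Finset.sum_apply, Finset.sum_eq_single i]
    · simp
    · intro b _ hb; simp [Pi.single_eq_of_ne (Ne.symm hb)]
    · simp
  conv_lhs => rw [hw]
  rw [map_sum]
  refine Finset.sum_congr rfl fun j _ => ?_
  rw [map_add, map_smul, map_smul]
  simp only [wD, Complex.real_smul]
  have h1 : w j = (w j).re + (w j).im * I := (Complex.re_add_im _).symm
  have h2 : conj (w j) = (w j).re - (w j).im * I := by
    apply Complex.ext <;> simp
  rw [h2]
  nth_rw 3 [h1]
  ring_nf
  simp only [I_sq]
  ring
def hpol (φ : XX → ℝ) (z w : XX) : ℂ :=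
  2 * ∑ j, dz (fun z => (φ z : ℂ)) j z * w j
    + ∑ j, ∑ k, dz (dz (fun z => (φ z : ℂ)) j) k z * w k * w j
def d2 (φ : XX → ℝ) (z w : XX) : ℝ :=
  (∑ j, (2 * ∑ k, (dz (dz (fun z => (φ z : ℂ)) j) k z * w k
    + wD I (dz (fun z => (φ z : ℂ)) j) k z * conj (w k))) * w j).re
lemma d2_eq (φ : XX → ℝ) (z w : XX) :
    d2 φ z w / 2 = (∑ j, ∑ k, dz (dz (fun z => (φ z : ℂ)) j) k z * w k * w j).re
      + lev φ z w := by
  rw [d2, lev, ← Complex.add_re]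
  have : ∀ x : ℂ, x.re / 2 = ((1/2 : ℂ) * x).re := fun x => by
    rw [show (1/2 : ℂ) = ((1/2 : ℝ) : ℂ) by norm_num, Complex.re_ofReal_mul]; ring
  rw [this]; congr 1
  simp only [cHessian_eq]
  rw [Finset.mul_sum, ← Finset.sum_add_distrib]
  refine Finset.sum_congr rfl fun j _ => ?_
  rw [Finset.sum_add_distrib, ← Finset.sum_add_distrib, ← Finset.sum_add_distrib]
  rw [mul_assoc, ← mul_assoc, Finset.sum_mul]
  rw [show (1/2 : ℂ) * 2 = 1 by norm_num, one_mul]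
  refine Finset.sum_congr rfl fun k _ => ?_
  ring
lemma unif_cont {f : XX → ℂ} {K : Set XX} (hK : IsCompact K) (hf : Continuous f)
    {η : ℝ} (hη : 0 < η) : ∃ δ > 0, ∀ z ∈ K, ∀ w : XX, ‖w‖ < δ → ‖f (z + w) - f z‖ < η := by
  have := hK.uniformContinuousAt_of_continuousAt f (fun a _ => hf.continuousAt)
    (Metric.dist_mem_uniformity hη)
  obtain ⟨δ, hδ, h⟩ := Metric.mem_uniformity_dist.1 this
  refine ⟨δ, hδ, fun z hz w hw => ?_⟩
  have h2 := h (a := z) (b := z + w) (by rw [dist_comm, dist_eq_norm]; simpa using hw) hz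
  rw [← dist_eq_norm, dist_comm]; exact h2
lemma taylor2 {φ : XX → ℝ} (hφ : SmR φ) {K : Set XX} (hK : IsCompact K)
    {ε : ℝ} (hε : 0 < ε) : ∃ δ > 0, ∀ z ∈ K, ∀ w : XX, ‖w‖ < δ →
      |φ (z + w) - φ z - (hpol φ z w).re - lev φ z w| ≤ ε * ‖w‖ ^ 2 := by
  obtain ⟨η, hη⟩ : ∃ η : ℝ, η = ε / (4 * ((n:ℝ) ^ 2 + 1)) := ⟨_, rfl⟩
  have hη0 : 0 < η := hη ▸ by positivity
  have sφ := hφ.ofReal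
  have ex : ∀ p : Fin n × Fin n × Bool, ∃ δ > 0, ∀ z ∈ K, ∀ w : XX, ‖w‖ < δ →
      ‖wD (bif p.2.2 then I else -I) (dz (fun z => (φ z : ℂ)) p.1) p.2.1 (z + w)
       - wD (bif p.2.2 then I else -I) (dz (fun z => (φ z : ℂ)) p.1) p.2.1 z‖ < η :=
    fun p => unif_cont hK ((sφ.wD _ _).wD _ _).cont hη0
  choose δ hδ0 hδ using ex
  obtain ⟨δ0, hδ00, hδ0'⟩ : ∃ δ0 > 0, ∀ p, δ0 ≤ δ p := by
    have : ∀ᶠ x : ℝ in 𝓝[>] 0, ∀ p, x ≤ δ p := by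
      rw [eventually_all]; intro p
      exact nhdsWithin_le_nhds ((eventually_lt_nhds (hδ0 p)).mono fun x hx => hx.le)
    obtain ⟨x, hx1, hx2⟩ := (this.and self_mem_nhdsWithin).exists
    exact ⟨x, hx2, hx1⟩
  refine ⟨δ0, hδ00, fun z hz w hw => ?_⟩
  have dbd : ∀ s ∈ Set.Icc (0:ℝ) 1, |d2 φ (z + s • w) w - d2 φ z w| ≤ ε * ‖w‖ ^ 2 := by
    intro s hs
    have hsw : ‖s • w‖ < δ0 := by
      rw [norm_smul, Real.norm_eq_abs, abs_of_nonneg hs.1]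
      exact lt_of_le_of_lt (mul_le_of_le_one_left (norm_nonneg _) hs.2) hw
    have b1 : ∀ j k, ‖dz (dz (fun z => (φ z : ℂ)) j) k (z + s • w)
        - dz (dz (fun z => (φ z : ℂ)) j) k z‖ ≤ η := fun j k =>
      (hδ (j, k, false) z hz _ (hsw.trans_le (hδ0' _))).le
    have b2 : ∀ j k, ‖wD I (dz (fun z => (φ z : ℂ)) j) k (z + s • w)
        - wD I (dz (fun z => (φ z : ℂ)) j) k z‖ ≤ η := fun j k =>
      (hδ (j, k, true) z hz _ (hsw.trans_le (hδ0' _))).le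
    have hwj : ∀ j, ‖w j‖ ≤ ‖w‖ := fun j => norm_le_pi_norm w j
    rw [d2, d2, ← Complex.sub_re]
    refine (Complex.abs_re_le_norm _).trans ?_
    rw [← Finset.sum_sub_distrib]
    calc _ ≤ ∑ j : Fin n, ∑ k : Fin n, 4 * η * ‖w‖ ^ 2 := by
          refine (norm_sum_le _ _).trans (Finset.sum_le_sum fun j _ => ?_)
          rw [← sub_mul, ← mul_sub, ← Finset.sum_sub_distrib, norm_mul, norm_mul]
          have : ‖∑ k, (dz (dz (fun z => (φ z : ℂ)) j) k (z + s • w) * w k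
    + wD I (dz (fun z => (φ z : ℂ)) j) k (z + s • w) * conj (w k) -
      (dz (dz (fun z => (φ z : ℂ)) j) k z * w k
    + wD I (dz (fun z => (φ z : ℂ)) j) k z * conj (w k)))‖ ≤ ∑ k : Fin n, 2 * η * ‖w‖ := by
            refine (norm_sum_le _ _).trans (Finset.sum_le_sum fun k _ => ?_)
            calc _ = ‖(dz (dz (fun z => (φ z : ℂ)) j) k (z + s • w)
                    - dz (dz (fun z => (φ z : ℂ)) j) k z) * w k
                  + (wD I (dz (fun z => (φ z : ℂ)) j) k (z + s • w)
                    - wD I (dz (fun z => (φ z : ℂ)) j) k z) * conj (w k)‖ := by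
                    congr 1; ring
              _ ≤ η * ‖w‖ + η * ‖w‖ := by
                refine (norm_add_le _ _).trans ?_
                rw [norm_mul, norm_mul, RCLike.norm_conj]
                gcongr
                exacts [b1 j k, hwj k, b2 j k, hwj k]
              _ = _ := by ring
          calc _ ≤ ‖(2:ℂ)‖ * (∑ k : Fin n, 2 * η * ‖w‖) * ‖w‖ := by gcongr; exact hwj j
            _ = _ := by simp; ring
      _ = (n:ℝ) ^ 2 / ((n:ℝ) ^ 2 + 1) * (ε * ‖w‖ ^ 2) := by
          simp only [Finset.sum_const, Finset.card_univ, Fintype.card_fin, nsmul_eq_mul, hη]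
          field_simp
      _ ≤ 1 * (ε * ‖w‖ ^ 2) := by
          gcongr
          rw [div_le_one (by positivity)]; linarith
      _ = _ := one_mul _
  have line : ∀ s : ℝ, HasDerivAt (fun s : ℝ => z + s • w) w s := fun s => by
    simpa using ((hasDerivAt_id s).smul_const w).const_add z
  have gd : ∀ {f : XX → ℂ}, Sm f → ∀ s : ℝ, HasDerivAt (fun s : ℝ => f (z + s • w))
      (∑ k, (dz f k (z + s • w) * w k + wD I f k (z + s • w) * conj (w k))) s := by
    intro f hf s
    rw [← fd_wD]
    exact (hf.diff (z + s • w)).hasFDerivAt.comp_hasDerivAt s (line s)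
  obtain ⟨g1, hg1⟩ : ∃ g1 : ℝ → ℝ, g1 = fun s => (∑ j, 2 * dz (fun z => (φ z : ℂ)) j (z + s • w) * w j).re := ⟨_, rfl⟩
  have reD : ∀ {u : ℝ → ℂ} {u' : ℂ} {s : ℝ}, HasDerivAt u u' s → HasDerivAt (fun s => (u s).re) u'.re s :=
    fun {u u' s} h => Complex.reCLM.hasFDerivAt.comp_hasDerivAt s h
  have d0 : ∀ s : ℝ, HasDerivAt (fun s : ℝ => φ (z + s • w)) (g1 s) s := by
    intro s
    have := reD (gd sφ s)
    simp only [Complex.ofReal_re] at this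
    convert this using 1
    rw [hg1]; simp only [Complex.re_sum]
    refine Finset.sum_congr rfl fun j _ => ?_
    rw [wD_real_conj hφ I]
    simp only [Complex.conj_I, Complex.add_re, ← map_mul, Complex.conj_re]
    rw [mul_assoc]; simp [Complex.mul_re]; ring
  have d1 : ∀ s : ℝ, HasDerivAt g1 (d2 φ (z + s • w) w) s := by
    intro s
    rw [hg1]
    refine reD (u := fun s : ℝ => ∑ j, 2 * dz (fun z => (φ z : ℂ)) j (z + s • w) * w j) ?_
    refine HasDerivAt.fun_sum fun j _ => ?_
    exact ((gd (sφ.wD (-I) j) s).const_mul 2).mul_const (w j)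
  have step1 : ∀ s ∈ Set.Icc (0:ℝ) 1, |g1 s - g1 0 - s * d2 φ z w| ≤ ε * ‖w‖ ^ 2 := by
    intro s hs
    have := norm_image_sub_le_of_norm_deriv_le_segment' (f := fun s => g1 s - s * d2 φ z w)
      (f' := fun s => d2 φ (z + s • w) w - d2 φ z w) (a := 0) (b := 1) (C := ε * ‖w‖ ^ 2)
      (fun x _ => ((d1 x).sub (by simpa using (hasDerivAt_id x).mul_const (d2 φ z w))).hasDerivWithinAt)
      (fun x hx => dbd x ⟨hx.1, hx.2.le⟩) s hs
    simp only [Real.norm_eq_abs] at this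
    have e : g1 s - g1 0 - s * d2 φ z w = g1 s - s * d2 φ z w - (g1 0 - 0 * d2 φ z w) := by ring
    rw [e]
    refine this.trans ?_
    have := hs.2
    have h0 : 0 ≤ ε * ‖w‖ ^ 2 := by positivity
    nlinarith
  have step2 := norm_image_sub_le_of_norm_deriv_le_segment'
      (f := fun s : ℝ => φ (z + s • w) - s * g1 0 - s ^ 2 * (d2 φ z w / 2))
      (f' := fun s => g1 s - g1 0 - s * d2 φ z w) (a := 0) (b := 1) (C := ε * ‖w‖ ^ 2)
      (fun x _ => by
        have a1 : HasDerivAt (fun s : ℝ => s * g1 0) (g1 0) x := by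
          simpa using (hasDerivAt_id x).mul_const (g1 0)
        have a2 : HasDerivAt (fun s : ℝ => s ^ 2 * (d2 φ z w / 2)) (x * d2 φ z w) x := by
          have := (hasDerivAt_pow 2 x).mul_const (d2 φ z w / 2)
          exact this.congr_deriv (by push_cast; ring)
        exact (((d0 x).sub a1).sub a2).hasDerivWithinAt)
      (fun x hx => step1 x ⟨hx.1, hx.2.le⟩) 1 ⟨zero_le_one, le_rfl⟩
  simp only [Real.norm_eq_abs] at step2
  have e : φ (z + w) - φ z - (hpol φ z w).re - lev φ z w
      = φ (z + (1:ℝ) • w) - 1 * g1 0 - 1 ^ 2 * (d2 φ z w / 2)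
        - (φ (z + (0:ℝ) • w) - 0 * g1 0 - 0 ^ 2 * (d2 φ z w / 2)) := by
    rw [d2_eq, hg1, hpol]
    simp only [one_smul, zero_smul, add_zero, Complex.add_re, Finset.mul_sum, mul_assoc]
    ring
  rw [e]
  refine step2.trans (by simp)
lemma lev_csmul (φ : XX → ℝ) (z : XX) (ζ : ℂ) (b : XX) :
    lev φ z (ζ • b) = ‖ζ‖ ^ 2 * lev φ z b := by
  simp only [lev]
  rw [← Complex.re_ofReal_mul, Finset.mul_sum]
  congr 1
  refine Finset.sum_congr rfl fun j _ => ?_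
  rw [Finset.mul_sum]
  refine Finset.sum_congr rfl fun k _ => ?_
  simp only [Pi.smul_apply, smul_eq_mul, map_mul, Complex.ofReal_pow]
  rw [← Complex.mul_conj']; ring
lemma exp_circ (m : ℕ) (hm : m ≠ 0) : ∫ θ in (0:ℝ)..(2*π), Complex.exp (θ * I) ^ m = 0 := by
  have : ∀ θ : ℝ, Complex.exp (θ * I) ^ m = Complex.exp ((m * I) * θ) := fun θ => by
    rw [← Complex.exp_nat_mul]; congr 1; ring
  simp only [this]
  rw [integral_exp_mul_complex (by simp [hm])]
  have : (m * I) * ((2 * π : ℝ) : ℂ) = m * (2 * π * I) := by push_cast; ring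
  rw [this, Complex.exp_nat_mul_two_pi_mul_I]; simp
lemma hpol_smul (φ : XX → ℝ) (z : XX) (b : XX) :
    ∃ A B : ℂ, ∀ ζ : ℂ, hpol φ z (ζ • b) = ζ ^ 1 * A + ζ ^ 2 * B := by
  refine ⟨2 * ∑ j, dz (fun z => (φ z : ℂ)) j z * b j,
    ∑ j, ∑ k, dz (dz (fun z => (φ z : ℂ)) j) k z * b k * b j, fun ζ => ?_⟩
  simp only [hpol, Pi.smul_apply, smul_eq_mul, Finset.mul_sum]
  congr 1
  · exact Finset.sum_congr rfl fun j _ => by ring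
  · exact Finset.sum_congr rfl fun j _ => Finset.sum_congr rfl fun k _ => by ring
lemma hpol_circ (φ : XX → ℝ) (z : XX) (b : XX) :
    ∫ θ in (0:ℝ)..(2*π), (hpol φ z (Complex.exp (θ * I) • b)).re = 0 := by
  obtain ⟨A, B, h⟩ := hpol_smul φ z b
  simp only [h]
  have hi : ∀ m : ℕ, ∀ A : ℂ, IntervalIntegrable (fun θ : ℝ => Complex.exp (θ * I) ^ m * A) volume 0 (2*π) :=
    fun m A => Continuous.intervalIntegrable (by fun_prop) _ _
  have : ∫ θ in (0:ℝ)..(2*π), (Complex.exp (θ * I) ^ 1 * A + Complex.exp (θ * I) ^ 2 * B) = 0 := by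
    rw [intervalIntegral.integral_add (hi 1 A) (hi 2 B), intervalIntegral.integral_mul_const,
      intervalIntegral.integral_mul_const, exp_circ 1 one_ne_zero, exp_circ 2 two_ne_zero]; simp
  have h2 := Complex.reCLM.intervalIntegral_comp_comm ((hi 1 A).add (hi 2 B))
  simp only [Complex.reCLM_apply, Pi.add_apply] at h2
  rw [h2, this]; simp
lemma lev_nonneg_of_submean {f : XX → ℝ} (hf : SmR f) {z b : XX} {r : ℝ} (hr : 0 < r)
    (h : ∀ t : ℝ, 0 < t → t < r → f z ≤ (2 * π)⁻¹ * ∫ θ in (0:ℝ)..(2*π),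
      f (z + Complex.exp (θ * I) • ((t : ℂ) • b))) : 0 ≤ lev f z b := by
  by_contra hc
  push Not at hc
  obtain ⟨ε, hε⟩ : ∃ ε : ℝ, ε = - lev f z b / (2 * (‖b‖ ^ 2 + 1)) := ⟨_, rfl⟩
  have hε0 : 0 < ε := hε ▸ div_pos (by linarith) (by positivity)
  have hεb : ε * ‖b‖ ^ 2 ≤ - lev f z b / 2 := by
    rw [hε, div_mul_eq_mul_div, div_le_div_iff₀ (by positivity) (by norm_num)]
    nlinarith [sq_nonneg ‖b‖]
  obtain ⟨δ, hδ, H⟩ := taylor2 hf (isCompact_singleton (x := z)) hε0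
  obtain ⟨t, ht1, ht2, ht0⟩ : ∃ t : ℝ, t < r ∧ t * ‖b‖ < δ ∧ 0 < t := by
    have e1 : ∀ᶠ t : ℝ in 𝓝[>] 0, t < r := nhdsWithin_le_nhds (eventually_lt_nhds hr)
    have e2 : ∀ᶠ t : ℝ in 𝓝[>] 0, t * ‖b‖ < δ := by
      refine nhdsWithin_le_nhds ?_
      have : Tendsto (fun t : ℝ => t * ‖b‖) (𝓝 0) (𝓝 (0 * ‖b‖)) := tendsto_id.mul_const _
      rw [zero_mul] at this
      exact this.eventually (eventually_lt_nhds hδ)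
    exact (e1.and (e2.and self_mem_nhdsWithin)).exists
  have hn : ∀ θ : ℝ, ‖Complex.exp (θ * I)‖ = 1 := fun θ => Complex.norm_exp_ofReal_mul_I θ
  have hnw : ∀ θ : ℝ, ‖Complex.exp (θ * I) • ((t : ℂ) • b)‖ = t * ‖b‖ := fun θ => by
    rw [norm_smul, hn, one_mul, norm_smul, Complex.norm_real, Real.norm_eq_abs, abs_of_pos ht0]
  have hfc : Continuous f := ContDiff.continuous hf
  have hpc : Continuous (fun θ : ℝ => (hpol f z (Complex.exp (θ * I) • ((t : ℂ) • b))).re) := by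
    obtain ⟨A, B, h⟩ := hpol_smul f z ((t : ℂ) • b)
    simp only [h]; fun_prop
  have le : ∫ θ in (0:ℝ)..(2*π), f (z + Complex.exp (θ * I) • ((t : ℂ) • b))
      ≤ ∫ θ in (0:ℝ)..(2*π), ((f z + t ^ 2 * (lev f z b + ε * ‖b‖ ^ 2))
        + (hpol f z (Complex.exp (θ * I) • ((t : ℂ) • b))).re) := by
    refine intervalIntegral.integral_mono_on (by positivity) (Continuous.intervalIntegrable (by fun_prop) _ _)
      (Continuous.intervalIntegrable (by fun_prop) _ _) fun θ _ => ?_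
    have := (abs_le.1 (H z rfl (Complex.exp (θ * I) • ((t : ℂ) • b)) (by rw [hnw]; exact ht2))).2
    rw [hnw, lev_csmul, hn, lev_csmul, Complex.norm_real, Real.norm_eq_abs, sq_abs] at this
    nlinarith
  rw [intervalIntegral.integral_add (Continuous.intervalIntegrable (by fun_prop) _ _)
    (Continuous.intervalIntegrable (by fun_prop) _ _), hpol_circ, intervalIntegral.integral_const] at le
  simp only [sub_zero, smul_eq_mul, add_zero] at le
  have h1 := h t ht0 ht1
  have h2 := mul_le_mul_of_nonneg_left le (show 0 ≤ (2 * π)⁻¹ by positivity)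
  rw [inv_mul_cancel_left₀ (by positivity)] at h2
  have : 0 < t ^ 2 := by positivity
  nlinarith
lemma lev_const_sub {f : XX → ℝ} (hf : SmR f) (a c : ℝ) (z b : XX) :
    lev (fun z => a - c * f z) z b = - c * lev f z b := by
  have h1 : ∀ j, dz (fun z => ((a - c * f z : ℝ) : ℂ)) j
      = fun z => (((-c : ℝ)) : ℂ) * dz (fun z => (f z : ℂ)) j z := by
    intro j; funext z
    refine wD_comp (-I) (g := fun t => a - c * t) j (hf.diff z) ?_
    simpa using ((hasDerivAt_id (f z)).const_mul c).const_sub a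
  simp only [lev, cHessian_eq, h1]
  have h2 : ∀ j k, wD I (fun z => (((-c : ℝ)) : ℂ) * dz (fun z => (f z : ℂ)) j z) k z
      = ((-c : ℝ) : ℂ) * wD I (dz (fun z => (f z : ℂ)) j) k z := by
    intro j k
    rw [wD_mul _ _ (differentiableAt_const _) ((hf.ofReal.wD _ _).diff z), wD_const]; ring
  simp only [h2]
  rw [← Complex.re_ofReal_mul, Finset.mul_sum]
  congr 1
  refine Finset.sum_congr rfl fun j _ => ?_
  rw [Finset.mul_sum]
  exact Finset.sum_congr rfl fun k _ => by ring
lemma exhaust {Ω : Set XX} (hΩo : IsOpen Ω)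
    (hΩb : Bornology.IsBounded Ω) (hΩp : Pseudoconvex Ω) {L : Set XX} (hL : IsCompact L)
    (hLΩ : L ⊆ Ω) : ∃ q : XX → ℝ, SmR q ∧ IsCompact {z | 0 ≤ q z} ∧ {z | 0 ≤ q z} ⊆ Ω ∧
      (∀ z, 0 < q z → ∀ b, lev q z b ≤ 0) ∧ ∀ z ∈ L, 1/2 ≤ q z ∧ q z ≤ 2 := by
  by_cases hne : Ωᶜ = ∅
  · rw [Set.compl_empty_iff] at hne
    refine ⟨fun _ => 1, contDiff_const, ?_, by simp [hne], fun z _ b => ?_, fun z _ => by norm_num⟩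
    · exact Metric.isCompact_of_isClosed_isBounded (isClosed_le continuous_const continuous_const)
        (hΩb.subset (by simp [hne]))
    · have : lev (fun _ => (1:ℝ)) z b = 0 := by
        have h1 : ∀ j, dz (fun _ : XX => ((1:ℝ):ℂ)) j = fun _ => 0 := fun j => by
          funext z; exact wD_const _ _ _ _
        simp only [lev, cHessian_eq, h1, wD_const]; simp
      exact this.le
  have hne : (Ωᶜ).Nonempty := Set.nonempty_iff_ne_empty.2 hne
  obtain ⟨d, hd⟩ : ∃ d : XX → ℝ, d = fun z => Metric.infDist z Ωᶜ := ⟨_, rfl⟩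
  have dlip : ∀ x y, d x ≤ d y + ‖x - y‖ := fun x y => by
    rw [hd, ← dist_eq_norm]; exact Metric.infDist_le_infDist_add_dist
  have dc : Continuous d := hd ▸ Metric.continuous_infDist_pt _
  have dpos : ∀ z, 0 < d z → z ∈ Ω := fun z hz => by
    by_contra h
    rw [hd] at hz
    have : Metric.infDist z Ωᶜ = 0 := Metric.infDist_zero_of_mem h
    simp only [this, lt_self_iff_false] at hz
  have posd : ∀ z ∈ Ω, 0 < d z := fun z hz => by
    rw [hd]
    exact (hΩo.isClosed_compl.notMem_iff_infDist_pos hne).1 (by simpa using hz)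
  obtain ⟨m, hm0, hm⟩ : ∃ m : ℝ, 0 ≤ m ∧ ∀ z ∈ L, |Real.log (d z)| ≤ m := by
    obtain ⟨C, hC⟩ := hL.exists_bound_of_continuousOn (f := fun z => Real.log (d z))
      (fun z hz => (dc.continuousAt.log (posd z (hLΩ hz)).ne').continuousWithinAt)
    exact ⟨|C|, abs_nonneg _, fun z hz => (hC z hz).trans (le_abs_self _)⟩
  obtain ⟨R, hR⟩ : ∃ R : ℝ, R = 2 * (m + 1) := ⟨_, rfl⟩
  have hR0 : 0 < R := by rw [hR]; linarith
  obtain ⟨e, he⟩ : ∃ e : ℝ, e = rexp (-(R + 3)) := ⟨_, rfl⟩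
  have he0 : 0 < e := he ▸ Real.exp_pos _
  obtain ⟨ρ, hρ⟩ : ∃ ρ : XX → ℝ, ρ = fun z => - Real.log (max (d z) e) := ⟨_, rfl⟩
  have mpos : ∀ z, 0 < max (d z) e := fun z => lt_max_of_lt_right he0
  have ρc : Continuous ρ := by
    rw [hρ]
    exact ((dc.max continuous_const).log fun z => (mpos z).ne').neg
  have ρlip : ∀ x y, ‖x - y‖ ≤ e → ρ x ≤ ρ y + 1 := by
    intro x y hxy
    have h1 : max (d y) e ≤ max (d x) e + e := by
      have := dlip y x
      rw [norm_sub_rev] at this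
      apply max_le
      · have := le_max_left (d x) e; linarith
      · have := le_max_right (d x) e; linarith
    have h2 : max (d y) e / max (d x) e ≤ 2 := by
      rw [div_le_iff₀ (mpos x)]
      have := le_max_right (d x) e; linarith
    have h3 := Real.log_le_sub_one_of_pos (div_pos (mpos y) (mpos x))
    rw [Real.log_div (mpos y).ne' (mpos x).ne'] at h3
    rw [hρ]; simp only; linarith
  obtain ⟨Cρ, hCρ⟩ : ∃ C, ∀ z, ‖ρ z‖ ≤ C := by
    have dcs : HasCompactSupport d := by
      refine HasCompactSupport.intro (K := closure Ω) hΩb.isCompact_closure fun z hz => ?_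
      rw [hd]; exact Metric.infDist_zero_of_mem (fun h => hz (subset_closure h))
    obtain ⟨C, hC⟩ := dc.bounded_above_of_compact_support dcs
    have hC0 : 0 ≤ C := (norm_nonneg _).trans (hC 0)
    refine ⟨|Real.log (C + e)| + |Real.log e|, fun z => ?_⟩
    have h1 : Real.log e ≤ Real.log (max (d z) e) := Real.log_le_log he0 (le_max_right _ _)
    have h2 : Real.log (max (d z) e) ≤ Real.log (C + e) := Real.log_le_log (mpos z) (max_le
      (by linarith [(le_abs_self _).trans (hC z)]) (by linarith))
    rw [hρ]; simp only
    rw [Real.norm_eq_abs, abs_neg, abs_le]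
    constructor
    · linarith [neg_abs_le (Real.log e), abs_nonneg (Real.log (C + e))]
    · linarith [le_abs_self (Real.log (C + e)), abs_nonneg (Real.log e)]
  obtain ⟨μ, hμ⟩ := exists_moll n he0
  have hLI : LocallyIntegrable (fun z => (ρ z : ℂ)) :=
    (Complex.continuous_ofReal.comp ρc).locallyIntegrable
  obtain ⟨f, hf⟩ : ∃ f : XX → ℝ, f = fun z => (mol μ (fun z => (ρ z : ℂ)) z).re := ⟨_, rfl⟩
  have sf : SmR f := by
    rw [hf]; exact Complex.reCLM.contDiff.comp (mol_sm hμ hLI)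
  have fI : ∀ z, f z = ∫ y, ρ (z - y) * μ y := fun z => by
    rw [hf]; simp only
    rw [mol_eq, ← Complex.ofReal_re (∫ y, ρ (z - y) * μ y), ← integral_complex_ofReal]
    simp
  have ρi : ∀ z, Integrable (fun y => ρ (z - y) * μ y) := fun z =>
    Continuous.integrable_of_hasCompactSupport ((ρc.comp (by fun_prop)).mul hμ.cont) hμ.cs.mul_left
  have fle : ∀ z, f z ≤ ρ z + 1 := fun z => by
    have : ρ z + 1 = ∫ y, (ρ z + 1) * μ y := by rw [integral_const_mul, hμ.int, mul_one]
    rw [fI, this]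
    refine integral_mono (ρi z) (hμ.integrable.const_mul _) fun y => ?_
    by_cases hy : e ≤ ‖y‖
    · simp [hμ.supp y hy]
    · exact mul_le_mul_of_nonneg_right (ρlip _ _ (by simpa using (not_le.1 hy).le)) (hμ.nn y)
  have lef : ∀ z, ρ z ≤ f z + 1 := fun z => by
    have : ρ z - 1 = ∫ y, (ρ z - 1) * μ y := by rw [integral_const_mul, hμ.int, mul_one]
    have : ρ z - 1 ≤ f z := by
      rw [fI, this]
      refine integral_mono (hμ.integrable.const_mul _) (ρi z) fun y => ?_
      by_cases hy : e ≤ ‖y‖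
      · simp [hμ.supp y hy]
      · refine mul_le_mul_of_nonneg_right ?_ (hμ.nn y)
        have := ρlip z (z - y) (by simpa using (not_le.1 hy).le)
        linarith
    linarith
  have fR : ∀ z, f z ≤ R → rexp (-(R + 1)) ≤ d z := by
    intro z hz
    have h1 : ρ z ≤ R + 1 := by linarith [lef z]
    have h2 : rexp (-(R + 1)) ≤ max (d z) e := by
      rw [Real.le_log_iff_exp_le (mpos z) |>.symm]
      rw [hρ] at h1; simp only at h1; linarith
    rcases le_max_iff.1 h2 with h | h
    · exact h
    · exfalso
      rw [he, Real.exp_le_exp] at h; linarith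
  have levf : ∀ z, f z ≤ R → ∀ b, 0 ≤ lev f z b := by
    intro z hz b
    have hdz := fR z hz
    obtain ⟨r, hr⟩ : ∃ r : ℝ, r = e / (‖b‖ + 1) := ⟨_, rfl⟩
    have hr0 : 0 < r := hr ▸ by positivity
    refine lev_nonneg_of_submean sf hr0 fun t ht0 htr => ?_
    have tb : t * ‖b‖ ≤ e := by
      rw [hr, lt_div_iff₀ (by positivity)] at htr; nlinarith
    have e3 : 3 * e ≤ rexp (-(R + 1)) := by
      have : rexp (-(R + 1)) = e * Real.exp 2 := by rw [he, ← Real.exp_add]; congr 1; ring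
      rw [this]
      have := Real.add_one_le_exp (2:ℝ)
      nlinarith
    have big : ∀ y, ‖y‖ < e → ∀ ζ : ℂ, ‖ζ‖ ≤ 1 → e ≤ d (z - y + ζ • ((t:ℂ) • b)) := by
      intro y hy ζ hζ
      have h1 := dlip z (z - y + ζ • ((t:ℂ) • b))
      have h2 : ‖z - (z - y + ζ • ((t:ℂ) • b))‖ ≤ e + e := by
        have : z - (z - y + ζ • ((t:ℂ) • b)) = y - ζ • ((t:ℂ) • b) := by abel
        rw [this]
        refine (norm_sub_le _ _).trans (add_le_add hy.le ?_)
        rw [norm_smul, norm_smul, Complex.norm_real, Real.norm_eq_abs, abs_of_pos ht0]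
        calc ‖ζ‖ * (t * ‖b‖) ≤ 1 * (t * ‖b‖) := by gcongr
          _ ≤ e := by linarith
      linarith
    have ρeq : ∀ x, e ≤ d x → ρ x = - Real.log (Metric.infDist x Ωᶜ) := fun x hx => by
      rw [hρ]; simp only
      rw [max_eq_left hx, hd]
    have sub : ∀ y, ‖y‖ < e → ρ (z - y) ≤ (2 * π)⁻¹ * ∫ θ in (0:ℝ)..(2*π),
        ρ (z - y + Complex.exp (θ * I) • ((t:ℂ) • b)) := by
      intro y hy
      have := hΩp.2 (z - y) ((t:ℂ) • b) (fun ζ hζ => dpos _ (he0.trans_le (big y hy ζ hζ)))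
      have h0 := big y hy 0 (by simp)
      rw [zero_smul, add_zero] at h0
      rw [ρeq _ h0]
      refine this.trans (le_of_eq ?_)
      congr 2; funext θ
      rw [ρeq _ (big y hy _ (Complex.norm_exp_ofReal_mul_I θ).le)]
    have joint : Integrable (Function.uncurry fun (θ : ℝ) (y : XX) =>
        ρ (z + Complex.exp (θ * I) • ((t:ℂ) • b) - y) * μ y)
        ((volume.restrict (Set.Ioc 0 (2*π))).prod volume) := by
      have : Integrable (fun p : ℝ × XX => Cρ * μ p.2)
        ((volume.restrict (Set.Ioc 0 (2*π))).prod volume) :=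
          (hμ.integrable.const_mul Cρ).comp_snd _
      refine this.mono' (Continuous.aestronglyMeasurable ?_) (Eventually.of_forall fun p => ?_)
      · have := hμ.cont
        simp only [Function.uncurry_def]
        fun_prop
      · simp only [Function.uncurry]
        rw [norm_mul, Real.norm_of_nonneg (hμ.nn _)]
        exact mul_le_mul_of_nonneg_right (hCρ _) (hμ.nn _)
    have swap := integral_integral_swap joint
    have i2 : Integrable (fun y => ∫ θ in Set.Ioc 0 (2*π), ρ (z + Complex.exp (θ * I) • ((t:ℂ) • b) - y) * μ y) :=
      joint.swap.integral_prod_left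
    rw [intervalIntegral.integral_of_le (by positivity)]
    simp only [fI (_ + _)]
    rw [swap, fI, ← integral_const_mul]
    refine integral_mono (ρi z) (i2.const_mul _) fun y => ?_
    by_cases hy : e ≤ ‖y‖
    · simp [hμ.supp y hy]
    · have := mul_le_mul_of_nonneg_right (sub y (not_le.1 hy)) (hμ.nn y)
      refine this.trans (le_of_eq ?_)
      rw [integral_mul_const, intervalIntegral.integral_of_le (by positivity), mul_assoc]
      congr 3; ext θ; congr 1; abel
  refine ⟨fun z => 1 - R⁻¹ * f z, contDiff_const.sub (contDiff_const.mul sf), ?_, ?_, ?_, ?_⟩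
  · have hsub : {z | 0 ≤ 1 - R⁻¹ * f z} ⊆ Ω := fun z hz => dpos z ((Real.exp_pos _).trans_le (fR z (by
      have hz : 0 ≤ 1 - R⁻¹ * f z := hz
      have : R⁻¹ * f z ≤ 1 := by linarith
      rwa [inv_mul_le_iff₀ hR0, mul_one] at this)))
    exact Metric.isCompact_of_isClosed_isBounded (isClosed_le continuous_const
      (continuous_const.sub (continuous_const.mul (ContDiff.continuous sf)))) (hΩb.subset hsub)
  · exact fun z hz => dpos z ((Real.exp_pos _).trans_le (fR z (by
      have hz : 0 ≤ 1 - R⁻¹ * f z := hz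
      have : R⁻¹ * f z ≤ 1 := by linarith
      rwa [inv_mul_le_iff₀ hR0, mul_one] at this)))
  · intro z hz b
    rw [lev_const_sub sf]
    have hz : 0 < 1 - R⁻¹ * f z := hz
    have h1 : R⁻¹ * f z ≤ 1 := by linarith
    rw [inv_mul_le_iff₀ hR0, mul_one] at h1
    have := mul_nonneg (inv_nonneg.2 hR0.le) (levf z h1 b)
    linarith
  · intro z hz
    have h1 := hm z hz
    have hez : e ≤ d z := by
      rw [he, ← Real.le_log_iff_exp_le (posd z (hLΩ hz))]
      have := (abs_le.1 h1).1; linarith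
    have h2 : ρ z = - Real.log (d z) := by rw [hρ]; simp only [max_eq_left hez]
    have h3 := fle z
    have h4 := lef z
    rw [h2] at h3 h4
    have h5 := abs_le.1 h1
    have a1 : R⁻¹ * f z ≤ 1/2 := by rw [inv_mul_le_iff₀ hR0]; linarith
    have a2 : -1 ≤ R⁻¹ * f z := by
      rw [inv_mul_eq_div, le_div_iff₀ hR0]; linarith
    constructor <;> linarith
lemma ext_smooth {Ω : Set XX} (hΩo : IsOpen Ω)
    (hΩb : Bornology.IsBounded Ω) (hΩp : Pseudoconvex Ω) {L : Set XX} (hL : IsCompact L)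
    (hLΩ : L ⊆ Ω) {ψ : XX → ℝ} (hψ : ContDiffOn ℝ ∞ ψ Ω) :
    ∃ φ : XX → ℝ, SmR φ ∧ ∃ U, IsOpen U ∧ L ⊆ U ∧ U ⊆ Ω ∧ ∀ z ∈ U, φ z = ψ z := by
  obtain ⟨q, hq, -, hqΩ, -, hqL⟩ := exhaust hΩo hΩb hΩp hL hLΩ
  have qc : Continuous q := ContDiff.continuous hq
  have hχ : SmR fun z => Real.smoothTransition (4 * q z - 1/2) :=
    Real.smoothTransition.contDiff.comp ((contDiff_const.mul hq).sub contDiff_const)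
  refine ⟨fun z => Real.smoothTransition (4 * q z - 1/2) * ψ z, ?_, {z | 3/8 < q z}, 
    isOpen_lt continuous_const qc, fun z hz => ?_, fun z hz => hqΩ ?_, fun z hz => ?_⟩
  · refine contDiff_iff_contDiffAt.2 fun z => ?_
    by_cases h : 0 < q z
    · exact hχ.contDiffAt.mul (hψ.contDiffAt (hΩo.mem_nhds (hqΩ h.le)))
    · have : (fun z => Real.smoothTransition (4 * q z - 1/2) * ψ z) =ᶠ[𝓝 z] fun _ => 0 := by
        have : {z | q z < 1/8} ∈ 𝓝 z := (isOpen_lt qc continuous_const).mem_nhds 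
          (by simp only [Set.mem_ofPred_eq]; linarith)
        filter_upwards [this] with y hy
        have hy : q y < 1/8 := hy
        rw [Real.smoothTransition.zero_of_nonpos (by linarith), zero_mul]
      exact contDiffAt_const.congr_of_eventuallyEq this
  · have := (hqL z hz).1
    simp only [Set.mem_ofPred_eq]; linarith
  · have hz : 3/8 < q z := hz
    simp only [Set.mem_ofPred_eq]; linarith
  · have hz : 3/8 < q z := hz
    simp only [Real.smoothTransition.one_of_one_le (show 1 ≤ 4 * q z - 1/2 by linarith), one_mul]
lemma lev_congr' {φ ψ : XX → ℝ} {U : Set XX} (hU : IsOpen U)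
    (h : ∀ z ∈ U, φ z = ψ z) {z : XX} (hz : z ∈ U) (b : XX) : lev φ z b = lev ψ z b := by
  have e : ∀ j k, cHessian φ z j k = cHessian ψ z j k := by
    intro j k
    rw [cHessian_eq, cHessian_eq]
    refine wD_congr _ _ ?_
    filter_upwards [hU.mem_nhds hz] with y hy
    refine wD_congr _ _ ?_
    filter_upwards [hU.mem_nhds hy] with x hx
    rw [h x hx]
  simp only [lev, e]
lemma core_C {Ω : Set XX} (hΩo : IsOpen Ω)
    (hΩb : Bornology.IsBounded Ω) (hΩp : Pseudoconvex Ω) 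
    {ψ : XX → ℝ} (hψ : ContDiffOn ℝ ∞ ψ Ω) (hpsh : ∀ z ∈ Ω, ∀ b, 0 ≤ lev ψ z b)
    {F : XX → ℂ} (hF : Sm F) (hFc : HasCompactSupport F) (hFΩ : tsupport F ⊆ Ω)
    {lam : ℝ} (hlam : 0 < lam) (h3 : ∀ z ∈ tsupport F, ∀ b, lam * ∑ j, ‖b j‖^2 ≤ lev ψ z b)
    {τ : Fin n → XX → ℂ} (hτ : ∀ j, Sm (τ j)) (hτc : ∀ j, HasCompactSupport (τ j))
    (hτΩ : ∀ j, tsupport (τ j) ⊆ Ω) :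
    ‖∑ j, ∫ z, τ j z * wD I F j z‖^2 ≤ 3*2^20/lam * 
      (∫ z, (∑ j, ‖wD I F j z‖^2) * rexp (-ψ z)) * 
      ∫ z, ‖∑ j, wD I (τ j) j z‖^2 * rexp (ψ z) := by
  have hL : IsCompact (tsupport F ∪ ⋃ j, tsupport (τ j)) := 
    IsCompact.union hFc (isCompact_iUnion hτc)
  have hLΩ : (tsupport F ∪ ⋃ j, tsupport (τ j)) ⊆ Ω := 
    Set.union_subset hFΩ (Set.iUnion_subset hτΩ)
  obtain ⟨q, hq, hqK, hqΩ, hq2, hqL⟩ := exhaust hΩo hΩb hΩp hL hLΩ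
  obtain ⟨φ, hφ, U, hUo, hKU, hUΩ, hφψ⟩ := ext_smooth hΩo hΩb hΩp hqK hqΩ hψ
  have hqU : ∀ z, 0 < q z → z ∈ U := fun z hz => hKU hz.le
  have hLU : ∀ z ∈ (tsupport F ∪ ⋃ j, tsupport (τ j)), z ∈ U := fun z hz => 
    hqU z (by have := (hqL z hz).1; linarith)
  have hE : Sm fun z => ((rexp (φ z) : ℝ) : ℂ) := SmR.ofReal (Real.contDiff_exp.comp hφ)
  have hβ : ∀ j, Sm fun z => ((rexp (φ z) : ℝ) : ℂ) * conj (τ j z) := 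
    fun j => hE.mul (hτ j).conj
  have sub : ∀ j, tsupport (fun z => ((rexp (φ z) : ℝ) : ℂ) * conj (τ j z)) ⊆ tsupport (τ j) := by
    intro j
    refine closure_mono fun z hz => ?_
    rw [Function.mem_support] at hz ⊢
    intro h; apply hz; simp [h]
  have key := prop_A hq hφ hqK (fun z hz b => by
      rw [lev_congr' hUo hφψ (hqU z hz)]; exact hpsh z (hUΩ (hqU z hz)) b) hq2 hF hFc 
      (fun z hz => hqL z (Or.inl hz)) hlam (fun z hz b => by
        rw [lev_congr' hUo hφψ (hLU z (Or.inl hz))]; exact h3 z hz b) hβ 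
      (fun j => (hτc j).of_isClosed_subset (isClosed_tsupport _) (sub j)) 
      (fun j z hz => (hqL z (Or.inr (Set.mem_iUnion.2 ⟨j, sub j hz⟩))).1)
  have e1 : ∀ j, ∫ z, ((rexp (φ z) : ℝ) : ℂ) * conj (τ j z) * conj (wD I F j z) 
      * rexp (-φ z) = conj (∫ z, τ j z * wD I F j z) := by
    intro j
    rw [← integral_conj]
    congr 1; ext z
    have : ((rexp (φ z) : ℝ) : ℂ) * ((rexp (-φ z) : ℝ) : ℂ) = 1 := by
      rw [← ofReal_mul, ← Real.exp_add]; simp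
    rw [map_mul]
    linear_combination conj (τ j z) * conj (wD I F j z) * this
  have e2 : ∀ j z, del φ (fun z => ((rexp (φ z) : ℝ) : ℂ) * conj (τ j z)) j z 
      = rexp (φ z) * conj (wD I (τ j) j z) := by
    intro j z
    rw [del, wD_mul _ _ (hE.diff z) ((hτ j).conj.diff z), wD_conj _ _ ((hτ j).diff z), 
      wD_comp (-I) (g := Real.exp) j (hφ.diff z) (Real.hasDerivAt_exp _)]
    simp only [map_neg, conj_I, neg_neg]; ring
  simp only [e1, e2] at key
  rw [← map_sum, RCLike.norm_conj] at key
  refine key.trans (le_of_eq ?_)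
  congr 1
  · congr 2; ext z
    by_cases hz : z ∈ tsupport F
    · rw [hφψ z (hLU z (Or.inl hz))]
    · have : ∀ j, wD I F j z = 0 := fun j => image_eq_zero_of_notMem_tsupport (fun h => hz (wD_tsupport _ _ _ h))
      simp [this]
  · congr 1; ext z
    rw [← Finset.mul_sum, ← map_sum, norm_mul, RCLike.norm_conj, Complex.norm_real, Real.norm_eq_abs, 
      abs_of_pos (Real.exp_pos _), mul_pow]
    have : rexp (φ z) ^ 2 * rexp (-φ z) = rexp (φ z) := by
      rw [sq, mul_assoc, ← Real.exp_add]; simp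
    rw [mul_right_comm, this, mul_comm]
    by_cases hz : z ∈ ⋃ j, tsupport (τ j)
    · rw [hφψ z (hLU z (Or.inr hz))]
    · have : ∀ j, wD I (τ j) j z = 0 := fun j => image_eq_zero_of_notMem_tsupport 
        (fun h => hz (Set.mem_iUnion.2 ⟨j, wD_tsupport _ _ _ h⟩))
      simp [this]
lemma cont_ext {Ω : Set XX} (hΩo : IsOpen Ω) {a : XX → ℂ} (ha : ContinuousOn a Ω)
    {G : XX → ℂ} (hG : Continuous G) (hGΩ : tsupport G ⊆ Ω) :
    Continuous fun z => a z * G z := by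
  refine continuous_iff_continuousAt.2 fun z => ?_
  by_cases hz : z ∈ Ω
  · exact (ha.continuousAt (hΩo.mem_nhds hz)).mul hG.continuousAt
  · have : (fun z => a z * G z) =ᶠ[𝓝 z] fun _ => 0 := by
      filter_upwards [(isClosed_tsupport G).isOpen_compl.mem_nhds (fun h => hz (hGΩ h))] with y hy
      rw [image_eq_zero_of_notMem_tsupport hy, mul_zero]
    exact continuousAt_const.congr this.symm
lemma toLp_norm {f : XX → ℂ} (hf : MemLp f 2) : ‖hf.toLp f‖^2 = ∫ z, ‖f z‖^2 := by
  have h := toLp_inner hf hf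
  rw [inner_self_eq_norm_sq_to_K] at h
  have : ∀ z, f z * conj (f z) = ((‖f z‖^2 : ℝ) : ℂ) := fun z => by
    rw [Complex.mul_conj, Complex.normSq_eq_norm_sq]
  simp only [this] at h
  rw [integral_complex_ofReal] at h
  exact Complex.ofReal_injective (by rw [ofReal_pow]; exact h)
set_option maxHeartbeats 800000 in
lemma prop_C1 {Ω : Set XX} (hΩo : IsOpen Ω)
    (hΩb : Bornology.IsBounded Ω) (hΩp : Pseudoconvex Ω) 
    {ψ : XX → ℝ} (hψ : ContDiffOn ℝ ∞ ψ Ω) (hpsh : ∀ z ∈ Ω, ∀ b, 0 ≤ lev ψ z b)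
    {F : XX → ℂ} (hF : Sm F) (hFc : HasCompactSupport F) (hFΩ : tsupport F ⊆ Ω)
    {lam : ℝ} (hlam : 0 < lam) (h3 : ∀ z ∈ tsupport F, ∀ b, lam * ∑ j, ‖b j‖^2 ≤ lev ψ z b) :
    ∃ u, MemLp u 2 ∧ ∫ z, ‖u z‖^2 ≤ 3*2^20/lam * 
      (∫ z, (∑ j, ‖wD I F j z‖^2) * rexp (-ψ z)) ∧ 
      ∀ j τ, Sm τ → HasCompactSupport τ → tsupport τ ⊆ Ω → 
        ∫ z, ((rexp (ψ z / 2) : ℝ) : ℂ) * u z * wD I τ j z = ∫ z, F z * wD I τ j z := by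
  obtain ⟨C2, hC2⟩ : ∃ C2, C2 = 3*2^20/lam * 
      (∫ z, (∑ j, ‖wD I F j z‖^2) * rexp (-ψ z)) := ⟨_, rfl⟩
  have hC20 : 0 ≤ C2 := by
    rw [hC2]; refine mul_nonneg (by positivity) (integral_nonneg fun z => ?_)
    have : ∀ j ∈ Finset.univ, 0 ≤ ‖wD I F j z‖^2 := fun j _ => by positivity
    exact mul_nonneg (Finset.sum_nonneg this) (Real.exp_pos _).le
  have ec : ∀ c : ℝ, ContinuousOn (fun z => ((rexp (c * ψ z) : ℝ) : ℂ)) Ω := fun c => 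
    Complex.continuous_ofReal.comp_continuousOn 
      (Real.continuous_exp.comp_continuousOn (continuousOn_const.mul hψ.continuousOn))
  have ml : ∀ c G, Continuous G → HasCompactSupport G → tsupport G ⊆ Ω → 
      MemLp (fun z => ((rexp (c * ψ z) : ℝ) : ℂ) * G z) 2 := fun c G h1 h2 h3 => 
    (cont_ext hΩo (ec c) h1 h3).memLp_of_hasCompactSupport h2.mul_left
  have mF := ml (-1/2) F hF.cont hFc hFΩ
  have gG : ∀ τ : Fin n → XX → ℂ, (∀ j, Sm (τ j) ∧ HasCompactSupport (τ j) ∧ tsupport (τ j) ⊆ Ω) → 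
      MemLp (fun z => ((rexp ((1/2) * ψ z) : ℝ) : ℂ) * conj (∑ j, wD I (τ j) j z)) 2 := by
    intro τ hτ
    have : (fun z => ((rexp ((1/2) * ψ z) : ℝ) : ℂ) * conj (∑ j, wD I (τ j) j z)) 
        = fun z => ∑ j, ((rexp ((1/2) * ψ z) : ℝ) : ℂ) * conj (wD I (τ j) j z) := by
      ext z; rw [map_sum, Finset.mul_sum]
    rw [this]
    refine memLp_finsetSum _ fun j _ => ml _ (fun z => conj (wD I (τ j) j z)) 
      ((hτ j).1.wD _ _).conj.cont ((wD_cs _ (hτ j).2.1 _).comp_left (map_zero _)) ?_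
    refine (closure_mono fun z hz => ?_).trans ((wD_tsupport I (τ j) j).trans (hτ j).2.2)
    rw [Function.mem_support] at hz ⊢
    intro h; apply hz; simp [h]
  have inn : ∀ τ hτ, Inner.inner ℂ ((gG τ hτ).toLp _) (mF.toLp _) = ∑ j, ∫ z, F z * wD I (τ j) j z := by
    intro τ hτ
    rw [toLp_inner, ← integral_finsetSum]
    · congr 1; ext z
      rw [map_mul, conj_ofReal, Complex.conj_conj, ← Finset.mul_sum]
      have : ((rexp (-1/2 * ψ z) : ℝ) : ℂ) * ((rexp (1/2 * ψ z) : ℝ) : ℂ) = 1 := by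
        rw [← ofReal_mul, ← Real.exp_add]; ring_nf; simp
      linear_combination (F z * ∑ j, wD I (τ j) j z) * this
    · exact fun j _ => (hF.mul ((hτ j).1.wD I j)).cont.integrable_of_hasCompactSupport hFc.mul_right
  obtain ⟨S, hS⟩ : ∃ S : Set (Lp ℂ 2 (volume : Measure XX)), S = {X : Lp ℂ 2 (volume : Measure XX) | ∃ τ : Fin n → XX → ℂ, (∀ j, Sm (τ j) ∧ HasCompactSupport (τ j) ∧ tsupport (τ j) ⊆ Ω) ∧ (X : XX → ℂ) =ᵐ[volume] 
    fun z => ((rexp ((1/2) * ψ z) : ℝ) : ℂ) * conj (∑ j, wD I (τ j) j z)} := ⟨_, rfl⟩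
  have hSm : ∀ X, X ∈ S ↔ ∃ τ : Fin n → XX → ℂ, (∀ j, Sm (τ j) ∧ HasCompactSupport (τ j) ∧ tsupport (τ j) ⊆ Ω) ∧ (X : XX → ℂ) =ᵐ[volume] 
    fun z => ((rexp ((1/2) * ψ z) : ℝ) : ℂ) * conj (∑ j, wD I (τ j) j z) := fun X => by rw [hS]; rfl
  obtain ⟨u, hu1, -, hu3⟩ := proj_abs S (mF.toLp _)
  have un := Lp.memLp u
  refine ⟨u, un, ?_, ?_⟩
  · rw [← hC2]
    have := hu3 (Real.sqrt C2) (Real.sqrt_nonneg _) ?_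
    · have h1 : ‖u‖^2 = ∫ z, ‖u z‖^2 := by
        rw [← toLp_norm un, Lp.toLp_coeFn]
      rw [← h1, ← Real.sq_sqrt hC20]
      exact pow_le_pow_left₀ (norm_nonneg _) this 2
    intro X hX
    have hX' : X ∈ S := by
      induction hX using Submodule.span_induction with
      | mem x h => exact h
      | zero => 
        refine (hSm _).2 ⟨fun _ _ => 0, fun j => ⟨contDiff_const, HasCompactSupport.zero, ?_⟩, ?_⟩
        · have : tsupport (fun _ : XX => (0:ℂ)) = ∅ := tsupport_eq_empty_iff.2 rfl
          rw [this]; exact Set.empty_subset _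
        · filter_upwards [Lp.coeFn_zero ℂ 2 (volume : Measure XX)] with z hz
          rw [hz]; simp [wD_const]
      | add x y _ _ hx hy =>
        obtain ⟨τ, hτ, hx⟩ := (hSm _).1 hx
        obtain ⟨σ, hσ, hy⟩ := (hSm _).1 hy
        refine (hSm _).2 ⟨fun j z => τ j z + σ j z, fun j => ⟨(hτ j).1.add (hσ j).1, (hτ j).2.1.add (hσ j).2.1, 
          (tsupport_add _ _).trans (Set.union_subset (hτ j).2.2 (hσ j).2.2)⟩, ?_⟩
        filter_upwards [Lp.coeFn_add x y, hx, hy] with z h1 h2 h3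
        rw [h1, Pi.add_apply, h2, h3]
        rw [← mul_add, ← map_add, ← Finset.sum_add_distrib]
        congr 3; ext j
        rw [wD_add _ _ ((hτ j).1.diff z) ((hσ j).1.diff z)]
      | smul c x _ hx =>
        obtain ⟨τ, hτ, hx⟩ := (hSm _).1 hx
        refine (hSm _).2 ⟨fun j z => conj c * τ j z, fun j => ⟨(Sm.const _).mul (hτ j).1, (hτ j).2.1.mul_left, 
          (closure_mono (Function.support_mul_subset_right _ _)).trans (hτ j).2.2⟩, ?_⟩
        filter_upwards [Lp.coeFn_smul c x, hx] with z h1 h2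
        rw [h1, Pi.smul_apply, h2, smul_eq_mul]
        have : ∀ j, wD I (fun z => conj c * τ j z) j z = conj c * wD I (τ j) j z := by
          intro j
          rw [wD_mul _ _ (differentiableAt_const _) ((hτ j).1.diff z), wD_const]; simp
        simp only [this]
        rw [← Finset.mul_sum, map_mul, Complex.conj_conj]; ring
    obtain ⟨τ, hτ, hX2⟩ := (hSm _).1 hX'
    have hX3 : X = (gG τ hτ).toLp _ := Lp.ext (hX2.trans (MemLp.coeFn_toLp _).symm)
    rw [hX3]
    refine abs_le_of_sq_le_sq' ?_ (by positivity) |>.2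
    rw [mul_pow, Real.sq_sqrt hC20, inn τ hτ, toLp_norm, hC2]
    have hk := core_C hΩo hΩb hΩp hψ hpsh hF hFc hFΩ hlam h3 (fun j => (hτ j).1) (fun j => (hτ j).2.1) 
      (fun j => (hτ j).2.2)
    have e1 : ∑ j, ∫ z, F z * wD I (τ j) j z = - ∑ j, ∫ z, τ j z * wD I F j z := by
      rw [← Finset.sum_neg_distrib]
      refine Finset.sum_congr rfl fun j _ => ?_
      rw [wD_ibp I hF (hτ j).1 hFc]; congr 2; ext z; ring
    rw [e1, norm_neg]
    refine hk.trans (le_of_eq ?_)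
    congr 2; ext z
    rw [norm_mul, RCLike.norm_conj, Complex.norm_real, Real.norm_eq_abs, 
      abs_of_pos (Real.exp_pos _), mul_pow, ← Real.exp_nat_mul, mul_comm]
    congr 2; push_cast; ring
  · intro j τ h1 h2 h3
    have e0 : ∀ τ : XX → ℂ, ∀ z, ∑ i, wD I ((Pi.single j τ : Fin n → XX → ℂ) i) i z = wD I τ j z := by
      intro τ z
      rw [Finset.sum_eq_single j]
      · simp
      · intro i _ hi
        rw [Pi.single_eq_of_ne hi]; exact wD_const I 0 i z
      · simp
    have hτ : ∀ i, Sm ((Pi.single j τ : Fin n → XX → ℂ) i) ∧ HasCompactSupport ((Pi.single j τ : Fin n → XX → ℂ) i) 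
        ∧ tsupport ((Pi.single j τ : Fin n → XX → ℂ) i) ⊆ Ω := by
      intro i
      by_cases hi : i = j
      · subst hi; simpa using ⟨h1, h2, h3⟩
      · rw [Pi.single_eq_of_ne hi]
        refine ⟨contDiff_const, HasCompactSupport.zero, ?_⟩
        have : tsupport (0 : XX → ℂ) = ∅ := tsupport_eq_empty_iff.2 rfl
        rw [this]; exact Set.empty_subset _
    have h := hu1 ((gG _ hτ).toLp _) ((hSm _).2 ⟨Pi.single j τ, hτ, MemLp.coeFn_toLp _⟩)
    rw [inn _ hτ] at h
    have hu' : u = un.toLp u := (Lp.toLp_coeFn u un).symm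
    rw [hu', toLp_inner un] at h
    have e2 : ∑ i, ∫ z, F z * wD I ((Pi.single j τ : Fin n → XX → ℂ) i) i z = ∫ z, F z * wD I τ j z := by
      rw [Finset.sum_eq_single j]
      · simp
      · intro i _ hi
        rw [Pi.single_eq_of_ne hi]
        have : ∀ z, wD I (0 : XX → ℂ) i z = 0 := fun z => wD_const I 0 i z
        simp [this]
      · simp
    rw [e2] at h
    rw [← h]
    congr 1; ext z
    rw [e0, map_mul, conj_ofReal, Complex.conj_conj]
    ring_nf
lemma rot_int {F : Type*} [NormedAddCommGroup F] [NormedSpace ℝ F] (G : XX → F) (a : ℂ) (ha : ‖a‖ = 1) :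
    ∫ w, G (a • w) = ∫ w, G w := by
  have h1 : MeasurePreserving (fun z : ℂ => a * z) := by
    have := LinearIsometryEquiv.measurePreserving (rotation ⟨a, by simp [Submonoid.unitSphere, ha]⟩)
    exact this
  have h2 : MeasurePreserving (fun w : XX => a • w) :=
    volume_preserving_pi (fun _ : Fin n => h1)
  refine h2.integral_comp ?_ G
  have ha0 : a ≠ 0 := by rintro rfl; simp at ha
  exact (Homeomorph.smulOfNeZero a ha0).measurableEmbedding
lemma circ_mean {h : XX → ℂ} {ρ ρ' : ℝ} (hρ : ρ' < ρ) 
    (hh : DifferentiableOn ℂ h (Metric.ball 0 ρ)) {W : XX → ℝ} (hW : Integrable W)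
    (hWc : ∀ a : ℂ, ‖a‖ = 1 → ∀ w, W (a • w) = W w) (hW0 : ∀ w, ρ' < ‖w‖ → W w = 0) :
    ∫ w, h w * (W w : ℂ) = h 0 * ((∫ w, W w : ℝ) : ℂ) := by
  have hsub : Metric.closedBall (0 : XX) ρ' ⊆ Metric.ball 0 ρ := Metric.closedBall_subset_ball hρ
  have hcont : ContinuousOn h (Metric.closedBall 0 ρ') := hh.continuousOn.mono hsub
  obtain ⟨M, hM⟩ := (isCompact_closedBall (0 : XX) ρ').exists_bound_of_continuousOn hcont
  obtain ⟨h', hh'⟩ : ∃ h', h' = (Metric.closedBall (0 : XX) ρ').indicator h := ⟨_, rfl⟩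
  have hm : Measurable h' := by
    rw [hh']
    classical
    rw [← Set.piecewise_eq_indicator]
    exact hcont.measurable_piecewise continuousOn_const Metric.isClosed_closedBall.measurableSet
  have hb : ∀ w, ‖h' w‖ ≤ |M| := by
    intro w; rw [hh']
    by_cases hw : w ∈ Metric.closedBall (0 : XX) ρ'
    · rw [Set.indicator_of_mem hw]; exact (hM w hw).trans (le_abs_self _)
    · rw [Set.indicator_of_notMem hw]; simp
  have hWC : Integrable (fun w => (W w : ℂ)) := hW.ofReal
  have e0 : ∀ w, h' w * (W w : ℂ) = h w * W w := by
    intro w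
    by_cases hw : w ∈ Metric.closedBall (0 : XX) ρ'
    · rw [hh', Set.indicator_of_mem hw]
    · have : W w = 0 := hW0 w (by simpa using hw)
      simp [this]
  have en : ∀ θ : ℝ, ‖Complex.exp (θ * I)‖ = 1 := fun θ => Complex.norm_exp_ofReal_mul_I θ
  have e1 : ∀ θ : ℝ, ∫ w, h' (Complex.exp (θ * I) • w) * (W w : ℂ) = ∫ w, h' w * (W w : ℂ) := by
    intro θ
    rw [← rot_int (fun w => h' w * (W w : ℂ)) (Complex.exp (θ * I)) (en θ)]
    simp only [hWc _ (en θ)]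
  have e2 : ∀ w, (∫ θ in (0:ℝ)..2*π, h' (Complex.exp (θ * I) • w)) * (W w : ℂ) = (2 * π : ℝ) * h 0 * W w := by
    intro w
    by_cases hw : w ∈ Metric.closedBall (0 : XX) ρ'
    · congr 1
      have hw' : ‖w‖ ≤ ρ' := by simpa using hw
      have : ∀ θ : ℝ, h' (Complex.exp (θ * I) • w) = (fun ζ : ℂ => h (ζ • w)) (circleMap 0 1 θ) := by
        intro θ
        rw [hh', Set.indicator_of_mem]
        · simp [circleMap]
        · simp only [mem_closedBall_zero_iff, norm_smul, en, one_mul, hw']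
      simp only [this]
      have hd : DiffContOnCl ℂ (fun ζ : ℂ => h (ζ • w)) (Metric.ball 0 |1|) := by
        apply DifferentiableOn.diffContOnCl
        rw [abs_one, closure_ball _ one_ne_zero]
        refine hh.comp (by fun_prop) fun ζ hζ => hsub ?_
        rw [mem_closedBall_zero_iff] at hζ ⊢
        rw [norm_smul]
        nlinarith [norm_nonneg w]
      have := hd.circleAverage
      rw [Real.circleAverage] at this
      simp only [zero_smul] at this
      rw [← this, Complex.real_smul]
      push_cast
      have hpi : (π : ℂ) ≠ 0 := by exact_mod_cast Real.pi_ne_zero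
      field_simp
    · have : W w = 0 := hW0 w (by simpa using hw)
      simp [this]
  have fub : ∫ θ in (0:ℝ)..2*π, ∫ w, h' (Complex.exp (θ * I) • w) * (W w : ℂ) 
      = ∫ w, ∫ θ in (0:ℝ)..2*π, h' (Complex.exp (θ * I) • w) * (W w : ℂ) := by
    simp only [intervalIntegral.integral_of_le (show (0:ℝ) ≤ 2*π by positivity)]
    rw [integral_integral_swap]
    have hWs : Integrable (fun p : ℝ × XX => (W p.2 : ℂ)) ((volume.restrict (Set.Ioc 0 (2*π))).prod volume) :=
      hWC.comp_snd _
    refine hWs.bdd_mul (c := |M|) ?_ (Filter.Eventually.of_forall fun p => hb _)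
    refine (hm.comp ?_).aestronglyMeasurable
    have : Continuous (fun p : ℝ × XX => Complex.exp (p.1 * I) • p.2) := by fun_prop
    exact this.measurable
  simp only [e1, intervalIntegral.integral_mul_const, e2] at fub
  rw [intervalIntegral.integral_const, integral_const_mul, sub_zero, Complex.real_smul, integral_complex_ofReal] at fub
  simp only [e0] at fub
  have hpi : ((2 * π : ℝ) : ℂ) ≠ 0 := by exact_mod_cast (by positivity : (2 * π : ℝ) ≠ 0)
  rw [mul_assoc] at fub
  exact mul_left_cancel₀ hpi fub
lemma holo_of_dbar {f : XX → ℂ} {z : XX} (hf : DifferentiableAt ℝ f z) 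
    (h : ∀ j, wD I f j z = 0) : DifferentiableAt ℂ f z := by
  have h1 := hf.hasFDerivAt
  let L : XX →L[ℂ] ℂ := ∑ j, dz f j z • ContinuousLinearMap.proj (R := ℂ) (φ := fun _ : Fin n => ℂ) j
  have hL : fderiv ℝ f z = L.restrictScalars ℝ := by
    ext w
    rw [fd_wD]
    simp [h, L]
  rw [hL] at h1
  exact (hasFDerivAt_of_restrictScalars ℝ h1 rfl).differentiableAt
lemma Moll.mono {ε ε' : ℝ} (h : ε' ≤ ε) {m : XX → ℝ} (hm : Moll ε' m) : Moll ε m :=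
  ⟨hm.sm, hm.nn, fun w hw => hm.supp w (h.trans hw), hm.int, hm.circ⟩
lemma mol_sup {ε : ℝ} {m : XX → ℝ} (hm : Moll ε m) (u : XX → ℂ) (hu : MemLp u 2) (x : XX) : 
    ‖mol m u x‖ₑ ≤ eLpNorm m 2 * eLpNorm u 2 := by
  have h1 : ‖mol m u x‖ₑ ≤ ∫⁻ y, ‖u y‖ₑ * ‖m (x - y)‖ₑ := by
    refine (enorm_integral_le_lintegral_enorm _).trans (le_of_eq ?_)
    congr 1; ext y; rw [enorm_mul]; congr 1
    simp [enorm_eq_nnnorm]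
  have h2 := ENNReal.lintegral_mul_le_Lp_mul_Lq volume (Real.HolderConjugate.two_two) (f := fun y => ‖u y‖ₑ) 
    (g := fun y => ‖m (x - y)‖ₑ) hu.1.enorm (by
      exact (hm.cont.comp (continuous_const.sub continuous_id)).enorm.measurable.aemeasurable)
  have h3 : ∫⁻ y, ‖m (x - y)‖ₑ ^ (2:ℝ) = ∫⁻ y, ‖m y‖ₑ ^ (2:ℝ) := 
    lintegral_sub_left_eq_self (fun y => ‖m y‖ₑ ^ (2:ℝ)) x
  rw [h3] at h2
  have e : ∀ {F : Type} [NormedAddCommGroup F] (f : XX → F), (∫⁻ y, ‖f y‖ₑ ^ (2:ℝ)) ^ (1/2 : ℝ) = eLpNorm f 2 := by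
    intro F _ f
    rw [eLpNorm_eq_lintegral_rpow_enorm_toReal (by simp) (by simp)]; simp
  rw [e, e] at h2
  rw [mul_comm]
  exact h1.trans h2
lemma weyl_local {Ω : Set XX} {h : XX → ℂ} 
    (hK : ∀ K ⊆ Ω, IsCompact K → MemLp (K.indicator h) 2)
    (hd : ∀ j τ, Sm τ → HasCompactSupport τ → tsupport τ ⊆ Ω → ∫ z, h z * wD I τ j z = 0) 
    {z0 : XX} {r : ℝ} (hr : 0 < r) (hB : Metric.closedBall z0 (3*r) ⊆ Ω) : 
    ∃ g, DifferentiableOn ℂ g (Metric.ball z0 r) ∧ ∀ᵐ z, z ∈ Metric.ball z0 r → g z = h z := by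
  obtain ⟨f, hf⟩ : ∃ f, f = (Metric.closedBall z0 (3*r)).indicator h := ⟨_, rfl⟩
  have fm : MemLp f 2 := by rw [hf]; exact hK _ hB (isCompact_closedBall _ _)
  have fl : LocallyIntegrable f := fm.locallyIntegrable (by norm_num)
  have holo : ∀ m ε, ε ≤ r → Moll ε m → ∀ x ∈ Metric.ball z0 (2*r), DifferentiableAt ℂ (mol m f) x := by
    intro m ε hε hm x hx
    refine holo_of_dbar ((mol_sm hm fl).diff x) fun j => ?_
    rw [mol_wD hm fl]
    have hts : tsupport (fun y => (m (x - y) : ℂ)) ⊆ Metric.closedBall x ε := by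
      refine closure_minimal (fun y hy => ?_) Metric.isClosed_closedBall
      rw [Function.mem_support] at hy
      rw [Metric.mem_closedBall, dist_comm, dist_eq_norm]
      by_contra hc
      exact hy (by rw [hm.supp _ (not_le.1 hc).le]; simp)
    have hsub : Metric.closedBall x ε ⊆ Metric.closedBall z0 (3*r) := 
      Metric.closedBall_subset_closedBall' (by rw [Metric.mem_ball] at hx; linarith)
    have := hd j (fun y => (m (x - y) : ℂ)) (hm.refl_sm x) (hm.refl_cs x) (hts.trans (hsub.trans hB))
    rw [neg_eq_zero, ← this]
    congr 1; ext y
    by_cases hy : y ∈ Metric.closedBall x ε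
    · rw [hf, Set.indicator_of_mem (hsub hy)]
    · rw [image_eq_zero_of_notMem_tsupport (fun h => hy (hts (wD_tsupport _ _ _ h)))]; simp
  obtain ⟨m', hm'⟩ := exists_moll n (show 0 < r/2 by positivity)
  refine ⟨mol m' f, fun x hx => (holo m' (r/2) (by linarith) hm' x (Metric.ball_subset_ball (by linarith) hx)).differentiableWithinAt, ?_⟩
  have key : eLpNorm (fun x => mol m' f x - f x) 2 (volume.restrict (Metric.ball z0 r)) = 0 := by
    obtain ⟨A, hA⟩ : ∃ A : ℝ≥0∞, A = 1 + (volume (Metric.ball z0 r)) ^ (1/2:ℝ) * eLpNorm m' 2 := ⟨_, rfl⟩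
    have hAt : A ≠ ⊤ := by
      rw [hA]
      refine ENNReal.add_ne_top.2 ⟨by simp, ENNReal.mul_ne_top ?_ ?_⟩
      · exact ENNReal.rpow_ne_top_of_nonneg (by norm_num) measure_ball_lt_top.ne
      · exact (hm'.cont.memLp_of_hasCompactSupport hm'.cs).2.ne
    have bd : ∀ η : ℝ≥0∞, 0 < η → eLpNorm (fun x => mol m' f x - f x) 2 (volume.restrict (Metric.ball z0 r)) ≤ A * η := by
      intro η hη
      obtain ⟨ε, hε, H⟩ := mol_L2 fm hη
      obtain ⟨m, hm⟩ := exists_moll n (lt_min hε hr)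
      have H1 := H m (hm.mono (min_le_left _ _))
      have gs := mol_sm hm fl
      have gl : LocallyIntegrable (mol m f) := gs.cont.locallyIntegrable
      obtain ⟨u, hu⟩ : ∃ u : XX → ℂ, u = fun x => mol m f x - f x := ⟨_, rfl⟩
      rw [← hu] at H1
      have um : AEStronglyMeasurable u volume := by
        rw [hu]; exact gs.cont.aestronglyMeasurable.sub fm.1
      by_cases hηt : η = ⊤
      · rw [hηt, ENNReal.mul_top]; · exact le_top
        rw [hA]; simp
      have uL : MemLp u 2 := ⟨um, H1.trans_lt (lt_top_iff_ne_top.2 hηt)⟩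
      have mu : ∀ x ∈ Metric.ball z0 r, mol m' f x - f x = u x - mol m' u x := by
        intro x hx
        have i1 := mul_int_test gl (hm'.refl_sm x).cont (hm'.refl_cs x)
        have i2 := mul_int_test fl (hm'.refl_sm x).cont (hm'.refl_cs x)
        have e1 : mol m' u x = mol m' (mol m f) x - mol m' f x := by
          have : ∀ y, u y * (m' (x - y) : ℂ) = mol m f y * (m' (x-y) : ℂ) - f y * (m' (x-y) : ℂ) := by
            intro y; rw [hu]; ring
          rw [mol, mol, mol]
          simp only [this]
          rw [integral_sub i1 i2]
        have e2 : mol m' (mol m f) x = mol m f x := by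
          rw [mol_eq]
          have := circ_mean (h := fun y => mol m f (x - y)) (ρ := r) (ρ' := r/2) (by linarith) ?_ hm'.integrable 
            (fun a ha w => hm'.circ a w ha) (fun w hw => hm'.supp w hw.le)
          · rw [this, hm'.int]; simp
          · intro y hy
            have : DifferentiableAt ℂ (mol m f) (x - y) := holo m _ (min_le_right _ _) hm (x - y) (by
              rw [Metric.mem_ball, dist_eq_norm] at hx ⊢
              rw [mem_ball_zero_iff] at hy
              calc ‖x - y - z0‖ = ‖(x - z0) - y‖ := by congr 1; abel
                _ ≤ ‖x - z0‖ + ‖y‖ := norm_sub_le _ _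
                _ < 2 * r := by linarith)
            exact (this.comp y (differentiableAt_const x |>.sub differentiableAt_id)).differentiableWithinAt
        rw [e1, e2, hu]; ring
      have mc : Continuous (mol m' u) := (mol_sm hm' (uL.locallyIntegrable (by norm_num))).cont
      calc eLpNorm (fun x => mol m' f x - f x) 2 (volume.restrict (Metric.ball z0 r)) 
          = eLpNorm (u - mol m' u) 2 (volume.restrict (Metric.ball z0 r)) := by
            refine eLpNorm_congr_ae ?_
            filter_upwards [ae_restrict_mem Metric.isOpen_ball.measurableSet] with x hx
            exact mu x hx
        _ ≤ eLpNorm u 2 (volume.restrict (Metric.ball z0 r)) + eLpNorm (mol m' u) 2 (volume.restrict (Metric.ball z0 r)) := 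
            eLpNorm_sub_le um.restrict mc.aestronglyMeasurable (by norm_num)
        _ ≤ η + (volume (Metric.ball z0 r)) ^ (1/2:ℝ) * eLpNorm m' 2 * η := by
            refine add_le_add ((eLpNorm_mono_measure _ Measure.restrict_le_self).trans H1) ?_
            refine (eLpNorm_le_of_ae_enorm_bound (C := eLpNorm m' 2 * η) (Filter.Eventually.of_forall fun x => 
              (mol_sup hm' u uL x).trans ?_)).trans (le_of_eq ?_)
            · gcongr
            · rw [Measure.restrict_apply_univ, smul_eq_mul, mul_assoc]; simp; ring
        _ = A * η := by rw [hA]; ring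
    have hlim : Tendsto (fun η : ℝ≥0∞ => A * η) (𝓝[>] 0) (𝓝 0) := by
      have := ENNReal.Tendsto.const_mul (a := A) (tendsto_id (x := 𝓝 (0:ℝ≥0∞))) (Or.inr hAt)
      simp only [id, mul_zero] at this
      exact this.mono_left nhdsWithin_le_nhds
    refine le_antisymm (ge_of_tendsto hlim ?_) (zero_le)
    filter_upwards [self_mem_nhdsWithin] with η hη using bd η hη
  rw [eLpNorm_eq_zero_iff ?_ (by norm_num)] at key
  · rw [Filter.EventuallyEq, ae_restrict_iff' Metric.isOpen_ball.measurableSet] at key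
    filter_upwards [key] with x hx hxb
    have := hx hxb
    simp only [Pi.zero_apply, sub_eq_zero] at this
    rw [this, hf, Set.indicator_of_mem (Metric.ball_subset_closedBall (Metric.ball_subset_ball (by linarith) hxb))]
  · exact ((mol_sm hm' fl).cont.aestronglyMeasurable.sub fm.1).restrict
lemma weyl {Ω : Set XX} (hΩo : IsOpen Ω) {h : XX → ℂ} 
    (hK : ∀ K ⊆ Ω, IsCompact K → MemLp (K.indicator h) 2)
    (hd : ∀ j τ, Sm τ → HasCompactSupport τ → tsupport τ ⊆ Ω → ∫ z, h z * wD I τ j z = 0) : 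
    ∃ f, DifferentiableOn ℂ f Ω ∧ ∀ᵐ z, z ∈ Ω → f z = h z := by
  have loc : ∀ z : Ω, ∃ r > 0, ∃ g : XX → ℂ, DifferentiableOn ℂ g (Metric.ball z r) ∧ (∀ᵐ w, w ∈ Metric.ball z.1 r → g w = h w) := by
    intro z
    obtain ⟨ε, hε, hb⟩ := Metric.isOpen_iff.1 hΩo z z.2
    obtain ⟨g, hg⟩ := weyl_local hK hd (z0 := z) (r := ε/4) (by positivity) 
      ((Metric.closedBall_subset_ball (by linarith)).trans hb)
    exact ⟨ε/4, by positivity, g, hg⟩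
  choose r hr g hg1 hg2 using loc
  have agree : ∀ z w : Ω, w.1 ∈ Metric.ball z.1 (r z) → g w w = g z w := by
    intro z w hw
    have hU : IsOpen (Metric.ball z.1 (r z) ∩ Metric.ball w.1 (r w)) := Metric.isOpen_ball.inter Metric.isOpen_ball
    refine Measure.eqOn_open_of_ae_eq (μ := volume) (f := g w) (g := g z) (U := Metric.ball z.1 (r z) ∩ Metric.ball w.1 (r w)) ?_ hU 
      ((hg1 w).continuousOn.mono Set.inter_subset_right) ((hg1 z).continuousOn.mono Set.inter_subset_left) 
      ⟨hw, Metric.mem_ball_self (hr w)⟩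
    rw [Filter.EventuallyEq, ae_restrict_iff' hU.measurableSet]
    filter_upwards [hg2 z, hg2 w] with x h1 h2 hx
    rw [h1 hx.1, h2 hx.2]
  classical
  obtain ⟨f, hf⟩ : ∃ f : XX → ℂ, f = fun z => if hz : z ∈ Ω then g ⟨z, hz⟩ z else 0 := ⟨_, rfl⟩
  have fe : ∀ z : Ω, ∀ w ∈ Metric.ball z.1 (r z), w ∈ Ω → f w = g z w := by
    intro z w hw hwΩ
    rw [hf]; simp only [hwΩ, dif_pos]; exact agree z ⟨w, hwΩ⟩ hw
  refine ⟨f, fun z hz => ?_, ?_⟩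
  · have : f =ᶠ[𝓝 z] g ⟨z, hz⟩ := by
      filter_upwards [Metric.ball_mem_nhds z (hr ⟨z, hz⟩), hΩo.mem_nhds hz] with w h1 h2 using fe ⟨z, hz⟩ w h1 h2
    exact (((hg1 ⟨z, hz⟩).differentiableAt (Metric.ball_mem_nhds z (hr ⟨z, hz⟩))).congr_of_eventuallyEq this).differentiableWithinAt
  · rw [ae_iff]
    refine measure_null_of_locally_null _ fun x hx => ?_
    simp only [Set.mem_ofPred_eq, Classical.not_imp] at hx
    refine ⟨_, inter_mem_nhdsWithin _ (Metric.ball_mem_nhds x (hr ⟨x, hx.1⟩)), ?_⟩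
    refine measure_mono_null (fun w hw => ?_) (ae_iff.1 (hg2 ⟨x, hx.1⟩))
    simp only [Set.mem_ofPred_eq, Classical.not_imp, Set.mem_inter_iff] at hw ⊢
    refine ⟨hw.2, fun h => hw.1.2 ?_⟩
    rw [fe ⟨x, hx.1⟩ w hw.2 hw.1.1, h]
lemma prop_C {Ω : Set XX} (hΩo : IsOpen Ω)
    (hΩb : Bornology.IsBounded Ω) (hΩp : Pseudoconvex Ω) 
    {ψ : XX → ℝ} (hψ : ContDiffOn ℝ ∞ ψ Ω) (hpsh : ∀ z ∈ Ω, ∀ b, 0 ≤ lev ψ z b)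
    {F : XX → ℂ} (hF : Sm F) (hFc : HasCompactSupport F) (hFΩ : tsupport F ⊆ Ω)
    {lam : ℝ} (hlam : 0 < lam) (h3 : ∀ z ∈ tsupport F, ∀ b, lam * ∑ j, ‖b j‖^2 ≤ lev ψ z b) :
    ∃ f, DifferentiableOn ℂ f Ω ∧ wnorm2 Ω ψ (fun z => F z - f z) ≤ ENNReal.ofReal (3*2^20/lam * 
      (∫ z, (∑ j, ‖wD I F j z‖^2) * rexp (-ψ z))) := by
  obtain ⟨u, hu, hu2, hu3⟩ := prop_C1 hΩo hΩb hΩp hψ hpsh hF hFc hFΩ hlam h3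
  have ec : ContinuousOn (fun z => ((rexp (ψ z / 2) : ℝ) : ℂ)) Ω := 
    Complex.continuous_ofReal.comp_continuousOn 
      (Real.continuous_exp.comp_continuousOn (hψ.continuousOn.div_const _))
  have hW := weyl hΩo (h := fun z => F z - ((rexp (ψ z / 2) : ℝ) : ℂ) * u z) ?_ ?_
  · obtain ⟨f, hf1, hf2⟩ := hW
    refine ⟨f, hf1, ?_⟩
    refine le_trans ?_ (ENNReal.ofReal_le_ofReal hu2)
    rw [wnorm2, ofReal_integral_eq_lintegral_ofReal (hu.integrable_norm_pow (p := 2) (by norm_num)) 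
      (Filter.Eventually.of_forall fun z => by positivity)]
    refine le_trans (le_of_eq ?_) (setLIntegral_le_lintegral Ω _)
    refine lintegral_congr_ae ?_
    rw [Filter.EventuallyEq, ae_restrict_iff' hΩo.measurableSet]
    filter_upwards [hf2] with z hz hzΩ
    rw [hz hzΩ, sub_sub_cancel, norm_mul, mul_pow, Complex.norm_real, Real.norm_eq_abs, abs_of_pos (Real.exp_pos _), 
      ← Real.exp_nat_mul, mul_right_comm, ← Real.exp_add]
    congr 1
    have : ((2:ℕ):ℝ) * (ψ z / 2) + -ψ z = 0 := by push_cast; ring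
    rw [this, Real.exp_zero, one_mul]
  · intro K hK hKc
    have e : K.indicator (fun z => F z - ((rexp (ψ z / 2) : ℝ) : ℂ) * u z) = 
        fun z => K.indicator F z - K.indicator (fun z => ((rexp (ψ z / 2) : ℝ) : ℂ)) z * u z := by
      ext z
      by_cases hz : z ∈ K
      · simp [hz]
      · simp [hz]
    rw [e]
    refine MemLp.sub ((hF.cont.memLp_of_hasCompactSupport hFc).indicator hKc.measurableSet) ?_
    obtain ⟨M, hM⟩ := hKc.exists_bound_of_continuousOn (ec.mono hK)
    refine memLp_bmul (C := |M|) ?_ ?_ hu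
    · rw [aestronglyMeasurable_indicator_iff hKc.measurableSet]
      exact (ec.mono hK).aestronglyMeasurable hKc.measurableSet
    · intro z
      by_cases hz : z ∈ K
      · rw [Set.indicator_of_mem hz]; exact (hM z hz).trans (le_abs_self _)
      · rw [Set.indicator_of_notMem hz]; simp
  · intro j τ h1 h2 h3
    have i1 : Integrable fun z => F z * wD I τ j z := 
      (hF.mul (h1.wD I j)).cont.integrable_of_hasCompactSupport hFc.mul_right
    have c2 := cont_ext hΩo ec (h1.wD I j).cont ((wD_tsupport I τ j).trans h3)
    have i2 : Integrable fun z => ((rexp (ψ z / 2) : ℝ) : ℂ) * u z * wD I τ j z := by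
      have := hu.integrable_mul (q := 2) (c2.memLp_of_hasCompactSupport (p := 2) (wD_cs I h2 j).mul_left)
      refine this.congr (Filter.Eventually.of_forall fun z => ?_)
      simp only [Pi.mul_apply]; ring
    have : ∀ z, (F z - ((rexp (ψ z / 2) : ℝ) : ℂ) * u z) * wD I τ j z 
      = F z * wD I τ j z - ((rexp (ψ z / 2) : ℝ) : ℂ) * u z * wD I τ j z := fun z => by ring
    simp only [this]
    rw [integral_sub i1 i2, hu3 j τ h1 h2 h3, sub_self]
lemma taylor_loc {Ω : Set XX} (hΩo : IsOpen Ω)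
    (hΩb : Bornology.IsBounded Ω) (hΩp : Pseudoconvex Ω) {K : Set XX} (hK : IsCompact K)
    (hKΩ : K ⊆ Ω) {φ : XX → ℝ} (hφ : ContDiffOn ℝ ∞ φ Ω) :
    ∃ P : XX → ℝ, SmR P ∧ (∀ z ∈ K, cHessian P z = cHessian φ z) ∧
      ∀ ε > 0, ∃ δ > 0, ∀ z ∈ K, ∀ w, ‖w‖ < δ → z + w ∈ Ω ∧
        |φ (z + w) - φ z - (hpol P z w).re - lev φ z w| ≤ ε * ‖w‖^2 := by
  obtain ⟨P, hP, U, hU, hKU, hUΩ, hPφ⟩ := ext_smooth hΩo hΩb hΩp hK hKΩ hφ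
  have hc : ∀ z ∈ K, cHessian P z = cHessian φ z := by
    intro z hz
    ext j k
    rw [cHessian_eq, cHessian_eq]
    refine wD_congr _ _ ?_
    filter_upwards [hU.mem_nhds (hKU hz)] with y hy
    refine wD_congr _ _ ?_
    filter_upwards [hU.mem_nhds hy] with x hx
    rw [hPφ x hx]
  refine ⟨P, hP, hc, fun ε hε => ?_⟩
  obtain ⟨δ, hδ, hT⟩ := taylor2 hP hK hε
  obtain ⟨δ', hδ', hT'⟩ := hK.exists_thickening_subset_open hU hKU
  refine ⟨min δ δ', lt_min hδ hδ', fun z hz w hw => ?_⟩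
  have hzU : z + w ∈ U := hT' (Metric.mem_thickening_iff.2 ⟨z, hz, by
    rw [dist_eq_norm, add_sub_cancel_left]; exact hw.trans_le (min_le_right _ _)⟩)
  refine ⟨hUΩ hzU, ?_⟩
  have := hT z hz w (hw.trans_le (min_le_left _ _))
  rw [hPφ _ hzU, hPφ _ (hKU hz)] at this
  have e : lev P z w = lev φ z w := by simp only [lev, hc z hz]
  rwa [e] at this
open scoped MatrixOrder in
lemma lev_pos {φ : XX → ℝ} {z : XX} (h : (cHessian φ z).PosDef) :
    ∃ B : Matrix (Fin n) (Fin n) ℂ, (∀ b, lev φ z b = ∑ j, ‖B.mulVec b j‖^2) ∧ B.det ≠ 0 ∧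
      (cHessian φ z).det.re = ‖B.det‖^2 := by
  have hT := h.transpose
  obtain ⟨B, hB, hBe⟩ : ∃ B : Matrix (Fin n) (Fin n) ℂ, B.det ≠ 0 ∧ (cHessian φ z).transpose = B.conjTranspose * B := by
    obtain ⟨B, hB⟩ := CStarAlgebra.nonneg_iff_eq_star_mul_self.mp hT.posSemidef.nonneg
    rw [Matrix.star_eq_conjTranspose] at hB
    refine ⟨B, fun h0 => ?_, hB⟩
    have := hT.det_pos
    rw [hB, Matrix.det_mul, h0, mul_zero] at this
    exact lt_irrefl _ this
  refine ⟨B, fun b => ?_, hB, ?_⟩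
  · have e1 : ∑ j, ∑ k, cHessian φ z j k * b j * conj (b k) = star b ⬝ᵥ (cHessian φ z).transpose.mulVec b := by
      simp only [dotProduct, Matrix.mulVec, Matrix.transpose_apply, Finset.mul_sum, Pi.star_apply]
      rw [Finset.sum_comm]
      refine Finset.sum_congr rfl fun k _ => Finset.sum_congr rfl fun j _ => ?_
      rw [starRingEnd_apply]; ring
    rw [lev, e1, hBe, ← Matrix.mulVec_mulVec, Matrix.dotProduct_mulVec, Matrix.vecMul_conjTranspose, star_star]
    simp only [dotProduct, Pi.star_apply, Complex.re_sum]
    refine Finset.sum_congr rfl fun j _ => ?_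
    have : star (B.mulVec b j) * B.mulVec b j = ((‖B.mulVec b j‖^2 : ℝ) : ℂ) := by
      rw [mul_comm]; exact (Complex.mul_conj _).trans (by rw [Complex.normSq_eq_norm_sq])
    rw [this, ofReal_re]
  · rw [← Matrix.det_transpose, hBe, Matrix.det_mul, Matrix.det_conjTranspose]
    have : star B.det * B.det = ((‖B.det‖^2 : ℝ) : ℂ) := by
      rw [mul_comm]; exact (Complex.mul_conj _).trans (by rw [Complex.normSq_eq_norm_sq])
    rw [this, ofReal_re]
lemma hess_cont {P : XX → ℝ} (hP : SmR P) (j k : Fin n) : Continuous fun z => cHessian P z j k := by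
  simp only [cHessian_eq]
  exact ((hP.ofReal.wD _ _).wD _ _).cont
lemma lev_cont {P : XX → ℝ} (hP : SmR P) : Continuous fun p : XX × XX => lev P p.1 p.2 := by
  unfold lev
  refine Complex.continuous_re.comp (continuous_finsetSum _ fun j _ => continuous_finsetSum _ fun k _ => ?_)
  refine (((hess_cont hP j k).comp continuous_fst).mul ?_).mul ?_
  · fun_prop
  · exact Complex.continuous_conj.comp (by fun_prop)
lemma norm_sq_le (b : XX) : ‖b‖^2 ≤ ∑ j, ‖b j‖^2 := by
  have h0 : 0 ≤ ∑ j, ‖b j‖^2 := Finset.sum_nonneg fun j _ => by positivity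
  rw [← Real.sq_sqrt h0]
  refine pow_le_pow_left₀ (norm_nonneg _) ((pi_norm_le_iff_of_nonneg (Real.sqrt_nonneg _)).2 fun j => ?_) 2
  refine Real.le_sqrt_of_sq_le ?_
  exact Finset.single_le_sum (f := fun j => ‖b j‖^2) (fun j _ => by positivity) (Finset.mem_univ j)
lemma lev_bounds {P : XX → ℝ} (hP : SmR P) {K : Set XX} (hK : IsCompact K) 
    (hpd : ∀ z ∈ K, (cHessian P z).PosDef) : ∃ lam > 0, ∃ Λ, ∀ z ∈ K, ∀ b, 
      lam * ∑ j, ‖b j‖^2 ≤ lev P z b ∧ lev P z b ≤ Λ * ‖b‖^2 := by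
  have up : ∃ Λ, ∀ z ∈ K, ∀ b, lev P z b ≤ Λ * ‖b‖^2 := by
    have : ∀ j k, ∃ M, ∀ z ∈ K, ‖cHessian P z j k‖ ≤ M := fun j k => 
      hK.exists_bound_of_continuousOn (hess_cont hP j k).continuousOn
    choose M hM using this
    refine ⟨∑ j, ∑ k, M j k, fun z hz b => ?_⟩
    unfold lev
    refine (Complex.re_le_norm _).trans ((norm_sum_le _ _).trans ?_)
    rw [Finset.sum_mul]
    refine Finset.sum_le_sum fun j _ => (norm_sum_le _ _).trans ?_
    rw [Finset.sum_mul]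
    refine Finset.sum_le_sum fun k _ => ?_
    rw [norm_mul, norm_mul, RCLike.norm_conj, mul_assoc, sq]
    have := (norm_nonneg _).trans (hM j k z hz)
    gcongr
    · exact hM j k z hz
    · exact norm_le_pi_norm b j
    · exact norm_le_pi_norm b k
  obtain ⟨Λ, hΛ⟩ := up
  have hSc : IsCompact {b : XX | ∑ j, ‖b j‖^2 = 1} := by
    refine Metric.isCompact_of_isClosed_isBounded (isClosed_eq (by fun_prop) continuous_const) ?_
    refine (Metric.isBounded_closedBall (x := (0 : XX)) (r := 1)).subset fun b hb => ?_
    have hb : ∑ j, ‖b j‖^2 = 1 := hb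
    have := norm_sq_le b
    rw [mem_closedBall_zero_iff]; nlinarith [norm_nonneg b]
  have lo : ∃ lam > 0, ∀ z ∈ K, ∀ b, ∑ j, ‖b j‖^2 = 1 → lam ≤ lev P z b := by
    by_cases hne : (K ×ˢ {b : XX | ∑ j, ‖b j‖^2 = 1}).Nonempty
    · obtain ⟨p, hp, hmin⟩ := (hK.prod hSc).exists_isMinOn hne (lev_cont hP).continuousOn
      refine ⟨lev P p.1 p.2, ?_, fun z hz b hb => hmin (a := (z, b)) ⟨hz, hb⟩⟩
      obtain ⟨B, hB, hBd, -⟩ := lev_pos (hpd p.1 hp.1)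
      rw [hB]
      have h0 : p.2 ≠ 0 := by
        intro h; have := hp.2; simp [h] at this
      have h1 : B.mulVec p.2 ≠ 0 := fun h => hBd (Matrix.exists_mulVec_eq_zero_iff.1 ⟨p.2, h0, h⟩)
      have h2 := norm_sq_le (B.mulVec p.2)
      have h3 : 0 < ‖B.mulVec p.2‖^2 := by positivity
      exact lt_of_lt_of_le h3 h2
    · refine ⟨1, one_pos, fun z hz b hb => absurd ⟨(z, b), hz, hb⟩ hne⟩
  obtain ⟨lam, hlam, hlo⟩ := lo
  refine ⟨lam, hlam, Λ, fun z hz b => ⟨?_, hΛ z hz b⟩⟩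
  by_cases h0 : ∑ j, ‖b j‖^2 = 0
  · have h2 := norm_sq_le b
    rw [h0] at h2
    have : b = 0 := by
      rw [← norm_eq_zero]; nlinarith [norm_nonneg b]
    rw [h0, this]; simp [lev]
  · have hp : 0 < ∑ j, ‖b j‖^2 := lt_of_le_of_ne (Finset.sum_nonneg fun j _ => by positivity) (Ne.symm h0)
    obtain ⟨s, hs⟩ : ∃ s, s = Real.sqrt (∑ j, ‖b j‖^2) := ⟨_, rfl⟩
    have hs0 : 0 < s := by rw [hs]; exact Real.sqrt_pos.2 hp
    have hs2 : s^2 = ∑ j, ‖b j‖^2 := by rw [hs, Real.sq_sqrt hp.le]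
    have := hlo z hz (((s⁻¹ : ℝ) : ℂ) • b) (by
      simp only [Pi.smul_apply, norm_smul, mul_pow, Complex.norm_real, Real.norm_eq_abs, sq_abs]
      rw [← Finset.mul_sum, ← hs2]; field_simp)
    rw [lev_csmul, Complex.norm_real, Real.norm_eq_abs, sq_abs] at this
    rw [← hs2]
    calc lam * s^2 ≤ (s⁻¹^2 * lev P z b) * s^2 := by gcongr
      _ = lev P z b := by field_simp
lemma levc (φ : XX → ℝ) (z : XX) : Continuous fun v => lev φ z v := by
  unfold lev
  refine Complex.continuous_re.comp (continuous_finsetSum _ fun j _ => continuous_finsetSum _ fun k _ => ?_)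
  refine (continuous_const.mul (by fun_prop)).mul (Complex.continuous_conj.comp (by fun_prop))
lemma gauss_c : Integrable (fun x : ℂ => rexp (-‖x‖^2)) ∧ ∫ x : ℂ, rexp (-‖x‖^2) = π := by
  have h1 := GaussianFourier.integral_rexp_neg_mul_sq_norm (V := ℂ) (b := 1) one_pos
  have h2 : ∫ x : ℂ, rexp (-‖x‖^2) = π := by
    simpa using h1
  refine ⟨?_, h2⟩
  by_contra h
  rw [integral_undef h] at h2
  exact Real.pi_ne_zero h2.symm
lemma gauss_n : Integrable (fun v : XX => rexp (-∑ j, ‖v j‖^2)) ∧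
    ∫ v : XX, rexp (-∑ j, ‖v j‖^2) = π^n := by
  have e : (fun v : XX => rexp (-∑ j, ‖v j‖^2)) = fun v => ∏ j, rexp (-‖v j‖^2) := by
    ext v; rw [← Real.exp_sum, Finset.sum_neg_distrib]
  rw [e]
  refine ⟨Integrable.fintype_prod (f := fun _ x => rexp (-‖x‖^2)) fun _ => gauss_c.1, ?_⟩
  rw [integral_fintype_prod_volume_eq_pow (fun x : ℂ => rexp (-‖x‖^2)), gauss_c.2, Fintype.card_fin]
lemma gauss_lin (B : Matrix (Fin n) (Fin n) ℂ) (hB : B.det ≠ 0) :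
    Integrable (fun v : XX => rexp (-∑ j, ‖B.mulVec v j‖^2)) ∧
    ∫ v : XX, rexp (-∑ j, ‖B.mulVec v j‖^2) = π^n / ‖B.det‖^2 := by
  obtain ⟨L, hL⟩ : ∃ L, L = (Matrix.toLin' B).restrictScalars ℝ := ⟨_, rfl⟩
  have hLa : ∀ v, L v = B.mulVec v := fun v => by rw [hL]; simp
  have hd : LinearMap.det L = ‖B.det‖^2 := by
    rw [hL, LinearMap.det_restrictScalars, LinearMap.det_toLin', Algebra.norm_complex_apply, Complex.normSq_eq_norm_sq]
  have hd0 : LinearMap.det L ≠ 0 := by rw [hd]; positivity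
  have hm := Measure.map_linearMap_addHaar_eq_smul_addHaar (volume : Measure XX) hd0
  have hLm : AEMeasurable L volume := L.continuous_of_finiteDimensional.measurable.aemeasurable
  have hc : ∀ μ : Measure XX, AEStronglyMeasurable (fun v : XX => rexp (-∑ j, ‖v j‖^2)) μ :=
    fun μ => (by fun_prop : Continuous fun v : XX => rexp (-∑ j, ‖v j‖^2)).aestronglyMeasurable
  simp only [← hLa]
  constructor
  · refine (integrable_map_measure (hc _) hLm).1 ?_
    rw [hm]; exact gauss_n.1.smul_measure ENNReal.ofReal_ne_top
  · rw [← integral_map hLm (hc _), hm, integral_smul_measure, gauss_n.2, hd, ENNReal.toReal_ofReal (abs_nonneg _),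
      abs_of_nonneg (by positivity), smul_eq_mul]
    field_simp
lemma gauss_lev {φ : XX → ℝ} {z : XX} (h : (cHessian φ z).PosDef) :
    Integrable (fun v => rexp (-lev φ z v)) ∧ 0 < (cHessian φ z).det.re ∧
      ∫ v, rexp (-lev φ z v) = π^n / (cHessian φ z).det.re := by
  obtain ⟨B, hB, hd, he⟩ := lev_pos h
  simp only [hB, he]
  exact ⟨(gauss_lin B hd).1, by positivity, (gauss_lin B hd).2⟩
lemma gauss_c_n {c : ℝ} (hc : 0 < c) : Integrable (fun v : XX => rexp (-(c * ∑ j, ‖v j‖^2))) := by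
  have := (gauss_n (n := n)).1.comp_smul (R := Real.sqrt c) (by positivity)
  refine this.congr (.of_forall fun v => ?_)
  simp only [Pi.smul_apply, norm_smul, mul_pow, ← Finset.mul_sum, Real.norm_eq_abs, sq_abs, Real.sq_sqrt hc.le]
lemma hpol_diff (P : XX → ℝ) (z : XX) : Differentiable ℂ fun w => hpol P z w := by
  unfold hpol; fun_prop
lemma scale_int (g : XX → ℝ) {k : ℕ} (hk : 0 < k) :
    ∫ w, g (Real.sqrt k • w) = ((k:ℝ)^n)⁻¹ * ∫ v, g v := by
  rw [Measure.integral_comp_smul, smul_eq_mul]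
  congr 1
  have : Module.finrank ℝ XX = 2 * n := by
    rw [Module.finrank_pi_fintype]; simp [Complex.finrank_real_complex, mul_comm]
  rw [this, pow_mul, Real.sq_sqrt (by positivity), abs_of_nonneg (by positivity)]
lemma lev_rsmul (φ : XX → ℝ) (z : XX) (s : ℝ) (b : XX) : lev φ z (s • b) = s^2 * lev φ z b := by
  have : s • b = (s:ℂ) • b := by ext j; simp
  rw [this, lev_csmul, Complex.norm_real, Real.norm_eq_abs, sq_abs]
lemma upper {Ω : Set XX} (hΩo : IsOpen Ω) {φ P : XX → ℝ} {f : XX → ℂ}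
    {z : XX} {δ ε R : ℝ} {k : ℕ} (hf : DifferentiableOn ℂ f (Metric.ball z δ))
    (hT : ∀ w, ‖w‖ < δ → z + w ∈ Ω ∧ φ (z + w) ≤ φ z + (hpol P z w).re + lev φ z w + ε * ‖w‖^2)
    (hk : 0 < k) (hR0 : 0 ≤ R) (hR : R < δ * Real.sqrt k) :
    ENNReal.ofReal (‖f z‖^2 * rexp (-(k * φ z)) * ((k:ℝ)^n)⁻¹ *
      ∫ v in Metric.closedBall 0 R, rexp (-lev φ z v - ε * ‖v‖^2)) ≤ wnorm2 Ω (fun w => k * φ w) f := by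
  have hk' : (0:ℝ) < k := by exact_mod_cast hk
  have hs : 0 < Real.sqrt k := Real.sqrt_pos.2 hk'
  have hs2 : Real.sqrt k ^ 2 = k := Real.sq_sqrt hk'.le
  obtain ⟨V, hV⟩ : ∃ V : XX → ℝ, V = (Metric.closedBall 0 R).indicator
    fun v => rexp (-lev φ z v - ε * ‖v‖^2) := ⟨_, rfl⟩
  obtain ⟨W, hW⟩ : ∃ W : XX → ℝ, W = fun w => V (Real.sqrt k • w) := ⟨_, rfl⟩
  have hVi : Integrable V := by
    rw [hV, integrable_indicator_iff Metric.isClosed_closedBall.measurableSet]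
    refine ContinuousOn.integrableOn_compact (isCompact_closedBall _ _) (Continuous.continuousOn ?_)
    exact Real.continuous_exp.comp ((levc φ z).neg.sub (by fun_prop))
  have hV0 : ∀ v, 0 ≤ V v := fun v => by rw [hV]; exact Set.indicator_nonneg (fun _ _ => (Real.exp_pos _).le) _
  have hWI : ∫ w, W w = ((k:ℝ)^n)⁻¹ * ∫ v in Metric.closedBall 0 R, rexp (-lev φ z v - ε * ‖v‖^2) := by
    rw [hW, scale_int V hk, hV, integral_indicator Metric.isClosed_closedBall.measurableSet]
  have hWi : Integrable W := by rw [hW]; exact hVi.comp_smul hs.ne'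
  have hW1 : ∀ w, ‖w‖ ≤ R / Real.sqrt k → W w = rexp (-(k * lev φ z w) - k * (ε * ‖w‖^2)) := by
    intro w hw
    rw [hW, hV]; dsimp only
    rw [Set.indicator_of_mem]
    · rw [lev_rsmul, norm_smul, mul_pow, Real.norm_eq_abs, sq_abs, hs2]; congr 1; ring
    · rw [mem_closedBall_zero_iff, norm_smul, Real.norm_eq_abs, abs_of_pos hs, mul_comm]
      exact (le_div_iff₀ hs).1 hw
  have hW0 : ∀ w, R / Real.sqrt k < ‖w‖ → W w = 0 := by
    intro w hw
    rw [hW, hV]; dsimp only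
    rw [Set.indicator_of_notMem]
    rw [mem_closedBall_zero_iff, norm_smul, Real.norm_eq_abs, abs_of_pos hs, mul_comm, not_le]
    exact (div_lt_iff₀ hs).1 hw
  have hWc : ∀ a : ℂ, ‖a‖ = 1 → ∀ w, W (a • w) = W w := by
    intro a ha w
    have hn : ‖a • w‖ = ‖w‖ := by rw [norm_smul, ha, one_mul]
    rcases le_or_gt ‖w‖ (R / Real.sqrt k) with h | h
    · rw [hW1 _ h, hW1 _ (hn.le.trans h), hn, lev_csmul, ha]; simp
    · rw [hW0 _ h, hW0 _ (hn ▸ h)]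
  have hRδ : R / Real.sqrt k < δ := (div_lt_iff₀ hs).2 hR
  obtain ⟨h, hh⟩ : ∃ h : XX → ℂ, h = fun w => f (z + w)^2 * Complex.exp (-(k * hpol P z w)) := ⟨_, rfl⟩
  have hhd : DifferentiableOn ℂ h (Metric.ball 0 δ) := by
    rw [hh]
    refine DifferentiableOn.mul (DifferentiableOn.pow ?_ 2) ((hpol_diff P z).const_mul _).neg.cexp.differentiableOn
    refine hf.comp (by fun_prop) fun w hw => ?_
    simpa [dist_eq_norm] using hw
  have hm := circ_mean hRδ hhd hWi hWc hW0
  have h0 : h 0 = f z ^ 2 := by rw [hh]; simp [hpol]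
  have key : ‖∫ w, h w * (W w : ℂ)‖ₑ ≤ ∫⁻ w, ENNReal.ofReal (rexp (k * φ z)) *
      Ω.indicator (fun w => ENNReal.ofReal (‖f w‖^2 * rexp (-(k * φ w)))) (z + w) := by
    refine (enorm_integral_le_lintegral_enorm _).trans (lintegral_mono fun w => ?_)
    rcases le_or_gt ‖w‖ (R / Real.sqrt k) with hw | hw
    · obtain ⟨hzw, hle⟩ := hT w (hw.trans_lt hRδ)
      rw [Set.indicator_of_mem hzw, ← ENNReal.ofReal_mul (Real.exp_pos _).le, ← ofReal_norm]
      refine ENNReal.ofReal_le_ofReal ?_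
      rw [hW1 _ hw, norm_mul, Complex.norm_real, Real.norm_eq_abs, abs_of_pos (Real.exp_pos _), hh]
      dsimp only
      rw [norm_mul, norm_pow, Complex.norm_exp, mul_assoc, ← Real.exp_add, mul_left_comm (rexp (k * φ z)), ← Real.exp_add]
      refine mul_le_mul_of_nonneg_left (Real.exp_le_exp.2 ?_) (by positivity)
      have : (-((k:ℂ) * hpol P z w)).re = -(k * (hpol P z w).re) := by simp
      rw [this]
      nlinarith [mul_le_mul_of_nonneg_left hle hk'.le]
    · rw [hW0 _ hw]; simp
  rw [lintegral_const_mul' _ _ ENNReal.ofReal_ne_top, lintegral_add_left_eq_self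
    (Ω.indicator (fun w => ENNReal.ofReal (‖f w‖^2 * rexp (-(k * φ w))))) z, lintegral_indicator hΩo.measurableSet,
    hm, h0, hWI] at key
  have e : ‖f z‖^2 * rexp (-(k * φ z)) * ((k:ℝ)^n)⁻¹ * ∫ v in Metric.closedBall 0 R, rexp (-lev φ z v - ε * ‖v‖^2)
     = rexp (-(k * φ z)) * ‖f z ^ 2 * ((((k:ℝ)^n)⁻¹ * ∫ v in Metric.closedBall 0 R, rexp (-lev φ z v - ε * ‖v‖^2) : ℝ) : ℂ)‖ := by
    rw [norm_mul, norm_pow, Complex.norm_real, Real.norm_eq_abs, abs_of_nonneg]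
    · ring
    · rw [← hWI]; refine integral_nonneg fun w => ?_
      rw [hW]; exact hV0 _
  rw [e, ENNReal.ofReal_mul (Real.exp_pos _).le, ofReal_norm]
  calc _ ≤ ENNReal.ofReal (rexp (-(k * φ z))) * (ENNReal.ofReal (rexp (k * φ z)) * wnorm2 Ω (fun w => k * φ w) f) :=
        mul_le_mul_right key _
    _ = _ := by rw [← mul_assoc, ← ENNReal.ofReal_mul (Real.exp_pos _).le, ← Real.exp_add]; simp
lemma expball {φ : XX → ℝ} {z : XX} {ε R : ℝ} (hR : 0 < R) :
    IntegrableOn (fun v => rexp (-lev φ z v - ε * ‖v‖^2)) (Metric.closedBall 0 R) ∧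
    0 < ∫ v in Metric.closedBall 0 R, rexp (-lev φ z v - ε * ‖v‖^2) := by
  have hi : IntegrableOn (fun v => rexp (-lev φ z v - ε * ‖v‖^2)) (Metric.closedBall 0 R) := by
    refine ContinuousOn.integrableOn_compact (isCompact_closedBall _ _) (Continuous.continuousOn ?_)
    exact Real.continuous_exp.comp ((levc φ z).neg.sub (by fun_prop))
  have : NeZero (volume.restrict (Metric.closedBall (0 : XX) R)) :=
    ⟨by rw [Ne, Measure.restrict_eq_zero]; exact (Metric.measure_closedBall_pos _ _ hR).ne'⟩
  exact ⟨hi, integral_exp_pos hi⟩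
lemma diag_bd {Ω : Set XX} (hΩo : IsOpen Ω) {φ P : XX → ℝ}
    {z : XX} {δ ε R : ℝ} {k : ℕ}
    (hT : ∀ w, ‖w‖ < δ → z + w ∈ Ω ∧ φ (z + w) ≤ φ z + (hpol P z w).re + lev φ z w + ε * ‖w‖^2)
    (hk : 0 < k) (hR0 : 0 < R) (hR : R < δ * Real.sqrt k) :
    BddAbove {t : ℝ | ∃ f : XX → ℂ, DifferentiableOn ℂ f Ω ∧ wnorm2 Ω (fun w => k * φ w) f ≤ 1 ∧ t = ‖f z‖^2} ∧
    ((k:ℝ)^n)⁻¹ * bergmanDiag Ω (fun w => k * φ w) z * rexp (-(k * φ z)) ≤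
      (∫ v in Metric.closedBall 0 R, rexp (-lev φ z v - ε * ‖v‖^2))⁻¹ := by
  obtain ⟨I, hI⟩ : ∃ I, I = ∫ v in Metric.closedBall 0 R, rexp (-lev φ z v - ε * ‖v‖^2) := ⟨_, rfl⟩
  have hI0 : 0 < I := hI ▸ (expball hR0).2
  have hk' : (0:ℝ) < (k:ℝ)^n := by positivity
  have key : ∀ t ∈ {t : ℝ | ∃ f : XX → ℂ, DifferentiableOn ℂ f Ω ∧ wnorm2 Ω (fun w => k * φ w) f ≤ 1 ∧ t = ‖f z‖^2},
      t ≤ (k:ℝ)^n * rexp (k * φ z) * I⁻¹ := by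
    rintro t ⟨f, hf, hw, rfl⟩
    have hb : Metric.ball z δ ⊆ Ω := fun w hw => by
      have := (hT (w - z) (by rwa [← dist_eq_norm])).1
      rwa [add_sub_cancel] at this
    have := (upper hΩo (hf.mono hb) hT hk hR0.le hR).trans hw
    rw [← hI, ← ENNReal.ofReal_one, ENNReal.ofReal_le_ofReal_iff zero_le_one, Real.exp_neg] at this
    have hE := Real.exp_pos (k * φ z)
    calc ‖f z‖^2 = (‖f z‖^2 * (rexp (k * φ z))⁻¹ * ((k:ℝ)^n)⁻¹ * I) * ((k:ℝ)^n * rexp (k * φ z) * I⁻¹) := by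
          field_simp
      _ ≤ 1 * _ := by gcongr
      _ = _ := one_mul _
  refine ⟨⟨_, key⟩, ?_⟩
  have hB : bergmanDiag Ω (fun w => k * φ w) z ≤ (k:ℝ)^n * rexp (k * φ z) * I⁻¹ :=
    csSup_le ⟨0, fun _ => 0, by fun_prop, by simp [wnorm2], by simp⟩ key
  rw [← hI, Real.exp_neg]
  have hE := Real.exp_pos (k * φ z)
  calc _ ≤ ((k:ℝ)^n)⁻¹ * ((k:ℝ)^n * rexp (k * φ z) * I⁻¹) * (rexp (k * φ z))⁻¹ := by gcongr
    _ = I⁻¹ := by field_simp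
lemma taylor_up {Ω : Set XX} {φ P : XX → ℝ} {K : Set XX} {ε δ : ℝ}
    (h : ∀ z ∈ K, ∀ w, ‖w‖ < δ → z + w ∈ Ω ∧
        |φ (z + w) - φ z - (hpol P z w).re - lev φ z w| ≤ ε * ‖w‖^2) {z : XX} (hz : z ∈ K) :
    ∀ w, ‖w‖ < δ → z + w ∈ Ω ∧ φ (z + w) ≤ φ z + (hpol P z w).re + lev φ z w + ε * ‖w‖^2 :=
  fun w hw => ⟨(h z hz w hw).1, by linarith [(abs_le.1 (h z hz w hw).2).2]⟩
lemma ev_sqrt {δ : ℝ} (hδ : 0 < δ) (R : ℝ) : ∀ᶠ k : ℕ in atTop, 0 < k ∧ R < δ * Real.sqrt k := by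
  refine (eventually_gt_atTop 0).and ?_
  have : Tendsto (fun k : ℕ => δ * Real.sqrt k) atTop atTop :=
    (Real.tendsto_sqrt_atTop.comp tendsto_natCast_atTop_atTop).const_mul_atTop hδ
  exact this.eventually_gt_atTop R
lemma diag_bdd {Ω : Set XX} (hΩo : IsOpen Ω)
    (hΩb : Bornology.IsBounded Ω) (hΩp : Pseudoconvex Ω) {φ : XX → ℝ} (hφ : ContDiffOn ℝ ∞ φ Ω)
    {k : ℕ} (hk : 0 < k) {z : XX} (hz : z ∈ Ω) :
    BddAbove {t : ℝ | ∃ f : XX → ℂ, DifferentiableOn ℂ f Ω ∧ wnorm2 Ω (fun w => k * φ w) f ≤ 1 ∧ t = ‖f z‖^2} := by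
  obtain ⟨P, -, -, h⟩ := taylor_loc hΩo hΩb hΩp (isCompact_singleton (x := z)) (by simpa using hz) hφ
  obtain ⟨δ, hδ, hT⟩ := h 1 one_pos
  have hk' : (0:ℝ) < k := by exact_mod_cast hk
  have : 0 < δ * Real.sqrt k := by positivity
  exact (diag_bd hΩo (taylor_up hT rfl) hk (half_pos this) (half_lt_self this)).1
lemma diag_meas {Ω : Set XX} (hΩo : IsOpen Ω)
    (hΩb : Bornology.IsBounded Ω) (hΩp : Pseudoconvex Ω) {φ : XX → ℝ} (hφ : ContDiffOn ℝ ∞ φ Ω)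
    {k : ℕ} (hk : 0 < k) : AEMeasurable (bergmanDiag Ω (fun w => k * φ w)) (volume.restrict Ω) := by
  refine aemeasurable_restrict_of_measurable_subtype hΩo.measurableSet (measurable_of_Ioi fun a => ?_)
  have : (fun x : Ω => bergmanDiag Ω (fun w => k * φ w) x) ⁻¹' Set.Ioi a =
      ⋃ f ∈ {f : XX → ℂ | DifferentiableOn ℂ f Ω ∧ wnorm2 Ω (fun w => k * φ w) f ≤ 1}, 
        {x : Ω | a < ‖f x‖^2} := by
    ext x
    simp only [Set.mem_preimage, Set.mem_Ioi, Set.mem_iUnion, Set.mem_ofPred_eq, bergmanDiag]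
    rw [lt_csSup_iff (diag_bdd hΩo hΩb hΩp hφ hk x.2) ⟨0, fun _ => 0, by fun_prop, by simp [wnorm2], by simp⟩]
    constructor
    · rintro ⟨t, ⟨f, h1, h2, rfl⟩, ht⟩; exact ⟨f, ⟨h1, h2⟩, ht⟩
    · rintro ⟨f, ⟨h1, h2⟩, ht⟩; exact ⟨_, ⟨f, h1, h2, rfl⟩, ht⟩
  rw [this]
  refine IsOpen.measurableSet (isOpen_biUnion fun f hf => ?_)
  exact isOpen_lt continuous_const ((continuousOn_iff_continuous_domRestrict.1 hf.1.continuousOn).norm.pow 2)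
lemma diag_unif {Ω : Set XX} (hΩo : IsOpen Ω)
    (hΩb : Bornology.IsBounded Ω) (hΩp : Pseudoconvex Ω) {φ : XX → ℝ} (hφ : ContDiffOn ℝ ∞ φ Ω)
    (hpd : ∀ z ∈ Ω, (cHessian φ z).PosDef) {K : Set XX} (hK : IsCompact K) (hKΩ : K ⊆ Ω) :
    ∃ C, ∀ᶠ k : ℕ in atTop, ∀ z ∈ K, ((k:ℝ)^n)⁻¹ * bergmanDiag Ω (fun w => k * φ w) z * rexp (-(k * φ z)) ≤ C := by
  obtain ⟨P, hP, hPc, h⟩ := taylor_loc hΩo hΩb hΩp hK hKΩ hφ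
  obtain ⟨δ, hδ, hT⟩ := h 1 one_pos
  obtain ⟨lam, hlam, Λ, hL⟩ := lev_bounds hP hK (fun z hz => (hPc z hz) ▸ hpd z (hKΩ hz))
  have hv : 0 < volume.real (Metric.closedBall (0 : XX) 1) :=
    ENNReal.toReal_pos (Metric.measure_closedBall_pos _ _ one_pos).ne' measure_closedBall_lt_top.ne
  refine ⟨(volume.real (Metric.closedBall (0 : XX) 1) * rexp (-|Λ| - 1))⁻¹, ?_⟩
  filter_upwards [ev_sqrt hδ 1] with k hk z hz
  refine (diag_bd hΩo (taylor_up hT hz) hk.1 one_pos hk.2).2.trans ?_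
  refine inv_anti₀ (by positivity) ?_
  have : ∫ v in Metric.closedBall (0 : XX) 1, rexp (-|Λ| - 1) =
    volume.real (Metric.closedBall (0 : XX) 1) * rexp (-|Λ| - 1) := by
    rw [setIntegral_const, smul_eq_mul]
  rw [← this]
  refine setIntegral_mono_on (integrableOn_const measure_closedBall_lt_top.ne) (expball one_pos).1
    Metric.isClosed_closedBall.measurableSet fun v hv => Real.exp_le_exp.2 ?_
  rw [mem_closedBall_zero_iff] at hv
  have h1 := (hL z hz v).2
  have e : lev P z v = lev φ z v := by simp only [lev, hPc z hz]
  rw [e] at h1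
  have h2 : ‖v‖^2 ≤ 1 := pow_le_one₀ (norm_nonneg _) hv
  have h3 : Λ * ‖v‖^2 ≤ |Λ| * 1 := mul_le_mul (le_abs_self _) h2 (by positivity) (abs_nonneg _)
  linarith
lemma lim_up {Ω : Set XX} (hΩo : IsOpen Ω)
    (hΩb : Bornology.IsBounded Ω) (hΩp : Pseudoconvex Ω) {φ : XX → ℝ} (hφ : ContDiffOn ℝ ∞ φ Ω)
    (hpd : ∀ z ∈ Ω, (cHessian φ z).PosDef) {z : XX} (hz : z ∈ Ω) {a : ℝ} 
    (ha : (π^n)⁻¹ * (cHessian φ z).det.re < a) :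
    ∀ᶠ k : ℕ in atTop, ((k:ℝ)^n)⁻¹ * bergmanDiag Ω (fun w => k * φ w) z * rexp (-(k * φ z)) < a := by
  obtain ⟨hgi, hd, hge⟩ := gauss_lev (hpd z hz)
  have hlim : Tendsto (fun m : ℕ => ∫ v, (Metric.closedBall 0 ((m:ℝ)+1)).indicator 
      (fun v => rexp (-lev φ z v - 1 / ((m:ℝ)+1) * ‖v‖^2)) v) atTop (𝓝 (∫ v, rexp (-lev φ z v))) := by
    refine tendsto_integral_of_dominated_convergence _ (fun m => ?_) hgi (fun m => .of_forall fun v => ?_) (.of_forall fun v => ?_)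
    · exact ((Real.continuous_exp.comp ((levc φ z).neg.sub (by fun_prop))).measurable.indicator 
        Metric.isClosed_closedBall.measurableSet).aestronglyMeasurable
    · refine (norm_indicator_le_norm_self _ _).trans ?_
      rw [Real.norm_eq_abs, abs_of_pos (Real.exp_pos _)]
      refine Real.exp_le_exp.2 ?_
      have : 0 ≤ 1 / ((m:ℝ)+1) * ‖v‖^2 := by positivity
      linarith
    · have h1 : Tendsto (fun m : ℕ => rexp (-lev φ z v - 1 / ((m:ℝ)+1) * ‖v‖^2)) atTop (𝓝 (rexp (-lev φ z v - 0 * ‖v‖^2))) :=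
        (Real.continuous_exp.tendsto _).comp (tendsto_const_nhds.sub (tendsto_one_div_add_atTop_nhds_zero_nat.mul_const _))
      rw [zero_mul, sub_zero] at h1
      refine h1.congr' ?_
      filter_upwards [eventually_ge_atTop ⌈‖v‖⌉₊] with m hm
      rw [Set.indicator_of_mem]
      rw [mem_closedBall_zero_iff]
      have := (Nat.le_ceil ‖v‖).trans (Nat.cast_le.2 hm)
      linarith
  have h2 := hlim.inv₀ (by rw [hge]; positivity)
  rw [hge] at h2
  have h3 := h2.eventually_lt_const (u := a) (by rwa [inv_div, div_eq_inv_mul])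
  obtain ⟨m, hm⟩ := h3.exists
  rw [integral_indicator Metric.isClosed_closedBall.measurableSet] at hm
  obtain ⟨P, -, -, h⟩ := taylor_loc hΩo hΩb hΩp (isCompact_singleton (x := z)) (by simpa using hz) hφ
  obtain ⟨δ, hδ, hT⟩ := h (1 / ((m:ℝ)+1)) (by positivity)
  filter_upwards [ev_sqrt hδ ((m:ℝ)+1)] with k hk
  exact (diag_bd hΩo (taylor_up hT rfl) hk.1 (by positivity) hk.2).2.trans_lt hm
lemma wD_cmul (c a : ℂ) (f : XX → ℂ) (j : Fin n) : wD c (fun z => a * f z) j = fun z => a * wD c f j z := by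
  funext z
  have : fderiv ℝ (fun z => a * f z) z = a • fderiv ℝ f z :=
    congrFun (fderiv_const_smul_field (𝕜 := ℝ) (f := f) a) z
  simp only [wD, this, smul_apply, smul_eq_mul]; ring
lemma lev_kmul (φ : XX → ℝ) (k : ℝ) (z b : XX) : lev (fun w => k * φ w) z b = k * lev φ z b := by
  simp only [lev, cHessian_eq, ofReal_mul, wD_cmul]
  rw [← Complex.re_ofReal_mul, Finset.mul_sum]
  simp only [Finset.mul_sum, mul_assoc]
lemma wD_holo {f : XX → ℂ} {z : XX} (hf : DifferentiableAt ℂ f z) (j : Fin n) : wD I f j z = 0 := by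
  have h : fderiv ℝ f z = (fderiv ℂ f z).restrictScalars ℝ := (hf.hasFDerivAt.restrictScalars ℝ).fderiv
  have e : (Pi.single j I : XX) = I • Pi.single j 1 := by rw [← Pi.single_smul]; simp
  rw [wD, h, e]
  simp only [ContinuousLinearMap.coe_restrictScalars', map_smul, smul_eq_mul]
  rw [← mul_assoc, Complex.I_mul_I]; ring
lemma cutoff (z₀ : XX) {ρ : ℝ} (hρ : 0 < ρ) : ∃ χ : XX → ℂ, Sm χ ∧ (∀ z, ‖χ z‖ ≤ 1) ∧
    (∀ z, ∑ j, ‖z j - z₀ j‖^2 ≤ ρ^2 → χ z = 1) ∧ (∀ z, 2 * ρ^2 ≤ ∑ j, ‖z j - z₀ j‖^2 → χ z = 0) := by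
  refine ⟨fun z => (Real.smoothTransition (2 - (ρ^2)⁻¹ * ∑ j, ‖z j - z₀ j‖^2) : ℂ), SmR.ofReal ?_, fun z => ?_, fun z hz => ?_, fun z hz => ?_⟩
  · refine Real.smoothTransition.contDiff.comp ?_
    refine contDiff_const.sub (contDiff_const.mul (ContDiff.sum fun j _ => ?_))
    exact (contDiff_norm_sq ℝ (E := ℂ)).comp ((contDiff_apply ℝ ℂ j).sub contDiff_const)
  · rw [Complex.norm_real, Real.norm_eq_abs, abs_of_nonneg (Real.smoothTransition.nonneg _)]
    exact Real.smoothTransition.le_one _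
  · dsimp only; rw [Real.smoothTransition.one_of_one_le, ofReal_one]
    have : (ρ^2)⁻¹ * ∑ j, ‖z j - z₀ j‖^2 ≤ 1 := by rw [inv_mul_le_iff₀ (by positivity)]; linarith
    linarith
  · dsimp only; rw [Real.smoothTransition.zero_of_nonpos, ofReal_zero]
    have : 2 ≤ (ρ^2)⁻¹ * ∑ j, ‖z j - z₀ j‖^2 := by rw [le_inv_mul_iff₀ (by positivity)]; linarith
    linarith
lemma jt_int {φ : XX → ℝ} {z : XX} {lam t : ℝ} (hlam : 0 < lam)
    (h : ∀ b, lam * ∑ j, ‖b j‖^2 ≤ lev φ z b) (ht : t ≤ lam / 2) :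
    (∀ v, rexp (-lev φ z v + t * ‖v‖^2) ≤ rexp (-(lam / 2 * ∑ j, ‖v j‖^2))) ∧
    Integrable fun v => rexp (-lev φ z v + t * ‖v‖^2) := by
  have h1 : ∀ v, rexp (-lev φ z v + t * ‖v‖^2) ≤ rexp (-(lam / 2 * ∑ j, ‖v j‖^2)) := fun v => by
    refine Real.exp_le_exp.2 ?_
    have h1 : t * ‖v‖^2 ≤ lam / 2 * ∑ j, ‖v j‖^2 := mul_le_mul ht (norm_sq_le v) (by positivity) (by positivity)
    linarith [h v]
  refine ⟨h1, (gauss_c_n (half_pos hlam)).mono' 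
    (Real.continuous_exp.comp ((levc φ z).neg.add (by fun_prop))).aestronglyMeasurable (.of_forall fun v => ?_)⟩
  rw [Real.norm_eq_abs, abs_of_pos (Real.exp_pos _)]; exact h1 v
lemma wnorm2_add {Ω : Set XX} (hΩo : IsOpen Ω) {ψ : XX → ℝ} (hψ : ContinuousOn ψ Ω) {f F : XX → ℂ}
    (hF : Continuous F) {t A B : ℝ} (ht : 0 < t) (hA0 : 0 ≤ A) (hB0 : 0 ≤ B) (hA : wnorm2 Ω ψ F ≤ ENNReal.ofReal A)
    (hB : wnorm2 Ω ψ (fun z => F z - f z) ≤ ENNReal.ofReal B) :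
    wnorm2 Ω ψ f ≤ ENNReal.ofReal ((1 + t) * A + (1 + t⁻¹) * B) := by
  have h1 : wnorm2 Ω ψ f ≤ ∫⁻ z in Ω, (ENNReal.ofReal (1 + t) * ENNReal.ofReal (‖F z‖ ^ 2 * rexp (-ψ z)) + 
      ENNReal.ofReal (1 + t⁻¹) * ENNReal.ofReal (‖F z - f z‖ ^ 2 * rexp (-ψ z))) := by
    refine lintegral_mono fun z => ?_
    rw [← ENNReal.ofReal_mul (by positivity), ← ENNReal.ofReal_mul (by positivity), ← ENNReal.ofReal_add (by positivity) (by positivity)]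
    refine ENNReal.ofReal_le_ofReal ?_
    rw [← mul_assoc, ← mul_assoc, ← add_mul]
    refine mul_le_mul_of_nonneg_right ?_ (Real.exp_pos _).le
    obtain ⟨x, hx⟩ : ∃ x, x = ‖F z‖ := ⟨_, rfl⟩
    obtain ⟨y, hy⟩ : ∃ y, y = ‖F z - f z‖ := ⟨_, rfl⟩
    have h2 : ‖f z‖ ≤ x + y := by
      have := norm_sub_le (F z) (F z - f z); rw [sub_sub_cancel] at this; rwa [hx, hy]
    rw [← hx, ← hy]
    have h3 : ‖f z‖^2 ≤ (x + y)^2 := pow_le_pow_left₀ (norm_nonneg _) h2 2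
    have h4 : (1 + t) * x^2 + (1 + t⁻¹) * y^2 - (x + y)^2 = t⁻¹ * (t * x - y)^2 := by field_simp; ring
    have h5 : 0 ≤ t⁻¹ * (t * x - y)^2 := by positivity
    linarith
  refine h1.trans ?_
  rw [lintegral_add_left', lintegral_const_mul' _ _ ENNReal.ofReal_ne_top, lintegral_const_mul' _ _ ENNReal.ofReal_ne_top,
    ENNReal.ofReal_add (p := (1 + t) * A) (by positivity) (by positivity), ENNReal.ofReal_mul (p := 1 + t) (by positivity),
    ENNReal.ofReal_mul (p := 1 + t⁻¹) (by positivity)]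
  · exact add_le_add (mul_le_mul_right hA _) (mul_le_mul_right hB _)
  · refine AEMeasurable.const_mul (ENNReal.measurable_ofReal.comp_aemeasurable (ContinuousOn.aemeasurable ?_ hΩo.measurableSet)) _
    exact (hF.norm.pow 2).continuousOn.mul (Real.continuous_exp.comp_continuousOn hψ.neg)
lemma peak {φ P : XX → ℝ} {z₀ w : XX} {t : ℝ} {k : ℕ}
    (h : φ z₀ + (hpol P z₀ w).re + lev φ z₀ w - t * ‖w‖^2 ≤ φ (z₀ + w)) :
    ‖Complex.exp (k / 2 * hpol P z₀ w)‖^2 * rexp (-(k * φ (z₀ + w))) ≤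
      rexp (-(k * φ z₀)) * rexp (-lev φ z₀ (Real.sqrt k • w) + t * ‖Real.sqrt k • w‖^2) := by
  have hk : (0:ℝ) ≤ k := Nat.cast_nonneg k
  rw [Complex.norm_exp, ← Real.exp_nat_mul, ← Real.exp_add, ← Real.exp_add, lev_rsmul, norm_smul, mul_pow, Real.norm_eq_abs,
    sq_abs, Real.sq_sqrt hk]
  refine Real.exp_le_exp.2 ?_
  have : ((k:ℂ) / 2 * hpol P z₀ w).re = k / 2 * (hpol P z₀ w).re := by
    have : (k:ℂ) / 2 = ((k / 2 : ℝ) : ℂ) := by push_cast; rfl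
    rw [this, Complex.re_ofReal_mul]
  rw [this]; push_cast
  nlinarith [mul_le_mul_of_nonneg_left h hk]
lemma low_core {Ω : Set XX} (hΩo : IsOpen Ω)
    (hΩb : Bornology.IsBounded Ω) (hΩp : Pseudoconvex Ω) {φ : XX → ℝ} (hφ : ContDiffOn ℝ ∞ φ Ω)
    (hpd : ∀ z ∈ Ω, (cHessian φ z).PosDef) {z₀ : XX} (hz : z₀ ∈ Ω) :
    ∃ lam > 0, (∀ b, lam * ∑ j, ‖b j‖^2 ≤ lev φ z₀ b) ∧ ∀ t, 0 < t → t ≤ lam / 2 → ∃ C c, 0 ≤ C ∧ 0 < c ∧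
      ∀ᶠ k : ℕ in atTop, ∃ f, DifferentiableOn ℂ f Ω ∧
        wnorm2 Ω (fun w => k * φ w) f ≤ ENNReal.ofReal (((k:ℝ)^n)⁻¹ * rexp (-(k * φ z₀)) *
          ((1 + t) * (∫ v, rexp (-lev φ z₀ v + t * ‖v‖^2)) + C * ((k:ℝ)^n * rexp (-(k * c))))) ∧
        ‖1 - f z₀‖^2 ≤ C * ((k:ℝ)^n * rexp (-(k * c))) := by
  obtain ⟨r, hr, hrΩ⟩ := Metric.nhds_basis_closedBall.mem_iff.1 (hΩo.mem_nhds hz)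
  obtain ⟨P, hP, hPc, hT⟩ := taylor_loc hΩo hΩb hΩp (isCompact_closedBall z₀ r) hrΩ hφ
  have hz0 : z₀ ∈ Metric.closedBall z₀ r := Metric.mem_closedBall_self hr.le
  obtain ⟨lam, hlam, Λ, hL⟩ := lev_bounds hP (isCompact_closedBall z₀ r) (fun z hz => (hPc z hz) ▸ hpd z (hrΩ hz))
  have hL' : ∀ z ∈ Metric.closedBall z₀ r, ∀ b, lam * ∑ j, ‖b j‖^2 ≤ lev φ z b := fun z hz b => by
    have e : lev P z b = lev φ z b := by simp only [lev, hPc z hz]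
    exact e ▸ (hL z hz b).1
  refine ⟨lam, hlam, hL' z₀ hz0, fun t ht htl => ?_⟩
  obtain ⟨δ, hδ, hT⟩ := hT t ht
  obtain ⟨ρ, hρe⟩ : ∃ ρ, ρ = min δ r / 2 := ⟨_, rfl⟩
  have hρ : 0 < ρ := by rw [hρe]; exact half_pos (lt_min hδ hr)
  obtain ⟨χ, hχ, hχ1, hχo, hχz⟩ := cutoff z₀ hρ
  obtain ⟨S, hS⟩ : ∃ S, S = {z : XX | ∑ j, ‖z j - z₀ j‖^2 ≤ 2 * ρ^2} := ⟨_, rfl⟩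
  have hSc : IsClosed S := by rw [hS]; exact isClosed_le (by fun_prop) continuous_const
  have hχS : tsupport χ ⊆ S := closure_minimal (fun z h => by
    by_contra h2; rw [hS] at h2; exact h (hχz z (not_le.1 h2).le)) hSc
  have hSn : ∀ z ∈ S, ‖z - z₀‖ < min δ r := fun z hz => by
    rw [hS] at hz
    have h1 : ‖z - z₀‖^2 ≤ 2 * ρ^2 := (norm_sq_le (z - z₀)).trans hz
    have h2 : min δ r = 2 * ρ := by rw [hρe]; ring
    rw [h2]; nlinarith [norm_nonneg (z - z₀)]
  have hSr : S ⊆ Metric.closedBall z₀ r := fun z hz => by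
    rw [Metric.mem_closedBall, dist_eq_norm]; exact ((hSn z hz).trans_le (min_le_right _ _)).le
  have hScp : IsCompact S := (isCompact_closedBall z₀ r).of_isClosed_subset hSc hSr
  have hχc : HasCompactSupport χ := hScp.of_isClosed_subset (isClosed_tsupport _) hχS
  obtain ⟨M, hM⟩ : ∃ M, M = ∫ z, ∑ j, ‖wD I χ j z‖^2 := ⟨_, rfl⟩
  have hM0 : 0 ≤ M := hM ▸ integral_nonneg fun z => Finset.sum_nonneg fun j _ => by positivity
  have hMi : Integrable fun z => ∑ j, ‖wD I χ j z‖^2 := by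
    refine integrable_finsetSum _ fun j _ => Continuous.integrable_of_hasCompactSupport ((hχ.wD _ _).cont.norm.pow 2) ?_
    exact (wD_cs I hχc j).comp_left (g := fun x : ℂ => ‖x‖^2) (by simp)
  have hlow : ∀ z ∈ S, ∀ k : ℕ, ‖Complex.exp (k / 2 * hpol P z₀ (z - z₀))‖^2 * rexp (-(k * φ z)) ≤
      rexp (-(k * φ z₀)) * rexp (-lev φ z₀ (Real.sqrt k • (z - z₀)) + t * ‖Real.sqrt k • (z - z₀)‖^2) := by
    intro z hz k
    have h1 := (hT z₀ hz0 (z - z₀) ((hSn z hz).trans_le (min_le_left _ _))).2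
    have h2 := peak (φ := φ) (P := P) (z₀ := z₀) (w := z - z₀) (t := t) (k := k) (by linarith [(abs_le.1 h1).1])
    rwa [add_sub_cancel] at h2
  obtain ⟨J, hJ⟩ : ∃ J, J = ∫ v, rexp (-lev φ z₀ v + t * ‖v‖^2) := ⟨_, rfl⟩
  have hJ0 : 0 ≤ J := hJ ▸ integral_nonneg fun v => (Real.exp_pos _).le
  obtain ⟨hJb, hJi⟩ := jt_int hlam (hL' z₀ hz0) htl
  obtain ⟨I1, hI1⟩ : ∃ I1, I1 = ∫ v in Metric.closedBall 0 1, rexp (-lev φ z₀ v - t * ‖v‖^2) := ⟨_, rfl⟩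
  have hI0 : 0 < I1 := hI1 ▸ (expball one_pos).2
  obtain ⟨M', hM'⟩ : ∃ M', M' = 3*2^20/lam * M := ⟨_, rfl⟩
  have hM'0 : 0 ≤ M' := by rw [hM']; positivity
  obtain ⟨c, hc⟩ : ∃ c, c = lam / 2 * ρ^2 := ⟨_, rfl⟩
  have hc0 : 0 < c := by rw [hc]; positivity
  obtain ⟨d, hd, hdb⟩ : ∃ d > 0, ∀ z ∈ Metric.ball z₀ d, ∑ j, ‖z j - z₀ j‖^2 < ρ^2 := by
    have ho : IsOpen {z : XX | ∑ j, ‖z j - z₀ j‖^2 < ρ^2} := isOpen_lt (by fun_prop) continuous_const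
    obtain ⟨d, hd, h⟩ := Metric.isOpen_iff.1 ho z₀ (by simp only [Set.mem_ofPred_eq, sub_self]; simpa using pow_pos hρ 2)
    exact ⟨d, hd, h⟩
  refine ⟨(1 + t⁻¹) * M' + M' / I1, c, by positivity, hc0, ?_⟩
  rw [← hJ]
  filter_upwards [ev_sqrt (lt_min hδ hd) 1] with k ⟨hk, hk1⟩
  have hk' : (1:ℝ) ≤ k := by exact_mod_cast hk
  obtain ⟨E, hE⟩ : ∃ E : XX → ℂ, E = fun z => Complex.exp (k / 2 * hpol P z₀ (z - z₀)) := ⟨_, rfl⟩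
  have hEd : Differentiable ℂ E := by
    rw [hE]; exact (((hpol_diff P z₀).comp (differentiable_id.sub_const z₀)).const_mul _).cexp
  have hEs : Sm E := by
    rw [hE]; unfold Sm hpol
    fun_prop
  obtain ⟨F, hF⟩ : ∃ F : XX → ℂ, F = fun z => χ z * E z := ⟨_, rfl⟩
  have hFs : Sm F := hF ▸ hχ.mul hEs
  have hFχ : tsupport F ⊆ tsupport χ := by rw [hF]; exact tsupport_mul_subset_left
  have hFd : ∀ j z, wD I F j z = wD I χ j z * E z := fun j z => by
    rw [hF, wD_mul I j (hχ.diff z) (hEs.diff z), wD_holo (hEd z), mul_zero, add_zero]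
  have hFE : ∀ z ∈ Metric.ball z₀ d, F z = E z := fun z hz => by
    rw [hF]; dsimp only; rw [hχo z (hdb z hz).le, one_mul]
  have hFA : wnorm2 Ω (fun w => k * φ w) F ≤ ENNReal.ofReal (((k:ℝ)^n)⁻¹ * rexp (-(k * φ z₀)) * J) := by
    have e1 : ((k:ℝ)^n)⁻¹ * rexp (-(k * φ z₀)) * J = ∫ z, rexp (-(k * φ z₀)) *
        rexp (-lev φ z₀ (Real.sqrt k • (z - z₀)) + t * ‖Real.sqrt k • (z - z₀)‖^2) := by
      rw [integral_const_mul, integral_sub_right_eq_self (fun z => rexp (-lev φ z₀ (Real.sqrt k • z) + t * ‖Real.sqrt k • z‖^2)) z₀,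
        scale_int (fun v => rexp (-lev φ z₀ v + t * ‖v‖^2)) hk, hJ]
      ring
    have e2 : Integrable fun z => rexp (-(k * φ z₀)) *
        rexp (-lev φ z₀ (Real.sqrt k • (z - z₀)) + t * ‖Real.sqrt k • (z - z₀)‖^2) :=
      (Integrable.comp_sub_right (hJi.comp_smul (R := Real.sqrt k) (by positivity)) z₀).const_mul _
    rw [e1, ofReal_integral_eq_lintegral_ofReal e2 (.of_forall fun z => (mul_pos (Real.exp_pos _) (Real.exp_pos _)).le)]
    refine (lintegral_mono fun z => ?_).trans (setLIntegral_le_lintegral Ω _)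
    refine ENNReal.ofReal_le_ofReal ?_
    by_cases hz : z ∈ S
    · refine le_trans ?_ (hlow z hz k)
      rw [hF, hE]; dsimp only
      rw [norm_mul]
      have := hχ1 z
      gcongr
      exact mul_le_of_le_one_left (norm_nonneg _) this
    · rw [image_eq_zero_of_notMem_tsupport (fun h => hz (hχS (hFχ h)))]
      rw [norm_zero, zero_pow two_ne_zero, zero_mul]; exact (mul_pos (Real.exp_pos _) (Real.exp_pos _)).le
  have hdb2 : ∫ z, (∑ j, ‖wD I F j z‖^2) * rexp (-(k * φ z)) ≤ M * (rexp (-(k * φ z₀)) * rexp (-(k * c))) := by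
    rw [hM, ← integral_mul_const]
    refine integral_mono_of_nonneg (.of_forall fun z =>
      mul_nonneg (Finset.sum_nonneg fun j _ => by positivity) (Real.exp_pos _).le) (hMi.mul_const _) (.of_forall fun z => ?_)
    dsimp only
    simp only [hFd, norm_mul, mul_pow]
    rw [← Finset.sum_mul, mul_assoc]
    by_cases hz : z ∈ S ∧ ρ^2 ≤ ∑ j, ‖z j - z₀ j‖^2
    · refine mul_le_mul_of_nonneg_left ?_ (by positivity)
      rw [hE]
      refine (hlow z hz.1 k).trans (mul_le_mul_of_nonneg_left ((hJb _).trans (Real.exp_le_exp.2 ?_)) (Real.exp_pos _).le)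
      rw [hc]
      simp only [Pi.smul_apply, Pi.sub_apply, norm_smul, mul_pow, Real.norm_eq_abs, sq_abs, Real.sq_sqrt (zero_le_one.trans hk'),
        ← Finset.mul_sum]
      have : (lam / 2 * k) * ρ^2 ≤ (lam / 2 * k) * ∑ j, ‖z j - z₀ j‖^2 := mul_le_mul_of_nonneg_left hz.2 (by positivity)
      linarith
    · have : ∀ j, wD I χ j z = 0 := by
        intro j
        by_cases hz2 : z ∈ S
        · have hlt : ∑ j, ‖z j - z₀ j‖^2 < ρ^2 := not_le.1 fun h => hz ⟨hz2, h⟩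
          have ho : IsOpen {z : XX | ∑ j, ‖z j - z₀ j‖^2 < ρ^2} := isOpen_lt (by fun_prop) continuous_const
          rw [← wD_const I 1 j z]
          refine wD_congr _ _ ?_
          filter_upwards [ho.mem_nhds hlt] with y hy
          exact hχo y (le_of_lt hy)
        · exact image_eq_zero_of_notMem_tsupport fun h => hz2 (hχS (wD_tsupport _ _ _ h))
      simp [this]
  have hC := prop_C hΩo hΩb hΩp (ψ := fun w => k * φ w) (contDiffOn_const.mul hφ) ?_ hFs
    (hχc.of_isClosed_subset (isClosed_tsupport _) hFχ) ((hFχ.trans hχS).trans (hSr.trans hrΩ)) (lam := k * lam) (by positivity) ?_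
  rotate_left
  · intro z hz b
    obtain ⟨B, hB, -⟩ := lev_pos (hpd z hz)
    rw [lev_kmul, hB]; positivity
  · intro z hz b
    rw [lev_kmul, mul_assoc]
    exact mul_le_mul_of_nonneg_left (hL' z (hSr (hχS (hFχ hz))) b) (by positivity)
  obtain ⟨f, hf, hfw⟩ := hC
  have hvB : wnorm2 Ω (fun w => k * φ w) (fun z => F z - f z) ≤
      ENNReal.ofReal (M' * (rexp (-(k * φ z₀)) * rexp (-(k * c)))) := by
    refine hfw.trans (ENNReal.ofReal_le_ofReal ?_)
    rw [hM', mul_assoc]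
    refine mul_le_mul ?_ hdb2 (integral_nonneg fun z => by positivity) (by positivity)
    exact div_le_div_of_nonneg_left (by positivity) hlam (by nlinarith)
  refine ⟨f, hf, ?_, ?_⟩
  · refine (wnorm2_add hΩo (continuousOn_const.mul hφ.continuousOn) hFs.cont ht (by positivity) (by positivity) hFA hvB).trans
      (ENNReal.ofReal_le_ofReal ?_)
    have : ((k:ℝ)^n)⁻¹ * rexp (-(k * φ z₀)) * ((1 + t) * J + ((1 + t⁻¹) * M' + M' / I1) * ((k:ℝ)^n * rexp (-(k * c)))) =
      ((1 + t) * (((k:ℝ)^n)⁻¹ * rexp (-(k * φ z₀)) * J) + (1 + t⁻¹) * (M' * (rexp (-(k * φ z₀)) * rexp (-(k * c)))))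
       + M' / I1 * (rexp (-(k * φ z₀)) * rexp (-(k * c))) := by field_simp; ring
    rw [this]
    exact le_add_of_nonneg_right (by positivity)
  · have hT2 : ∀ w, ‖w‖ < min δ d → z₀ + w ∈ Ω ∧ φ (z₀ + w) ≤ φ z₀ + (hpol P z₀ w).re + lev φ z₀ w + t * ‖w‖^2 :=
      fun w hw => taylor_up hT hz0 w (hw.trans_le (min_le_left _ _))
    have hvd : DifferentiableOn ℂ (fun z => F z - f z) (Metric.ball z₀ (min δ d)) := by
      refine DifferentiableOn.sub ?_ (hf.mono fun z hz => ?_)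
      · refine hEd.differentiableOn.congr fun z hz => hFE z (Metric.ball_subset_ball (min_le_right _ _) hz)
      · have := (hT2 (z - z₀) (by rwa [← dist_eq_norm])).1
        rwa [add_sub_cancel] at this
    have h1 := (upper hΩo hvd hT2 hk zero_le_one hk1).trans hvB
    have hFz : F z₀ = 1 := by
      rw [hFE z₀ (Metric.mem_ball_self hd), hE]; simp [hpol]
    rw [ENNReal.ofReal_le_ofReal_iff (by positivity), ← hI1, hFz] at h1
    have h2 : ‖1 - f z₀‖^2 ≤ M' / I1 * ((k:ℝ)^n * rexp (-(k * c))) := by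
      have hX := Real.exp_pos (-(k * φ z₀))
      rw [← mul_le_mul_iff_of_pos_right (by positivity : 0 < rexp (-(k * φ z₀)) * ((k:ℝ)^n)⁻¹ * I1)]
      calc _ = ‖1 - f z₀‖^2 * rexp (-(k * φ z₀)) * ((k:ℝ)^n)⁻¹ * I1 := by ring
        _ ≤ _ := h1
        _ = _ := by field_simp
    refine h2.trans ?_
    rw [add_mul]
    exact le_add_of_nonneg_left (by positivity)
lemma diag_ge {Ω : Set XX} {ψ : XX → ℝ} {f : XX → ℂ} {z : XX} {D : ℝ} (hD : 0 < D)
    (hb : BddAbove {t : ℝ | ∃ f : XX → ℂ, DifferentiableOn ℂ f Ω ∧ wnorm2 Ω ψ f ≤ 1 ∧ t = ‖f z‖^2})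
    (hf : DifferentiableOn ℂ f Ω) (hw : wnorm2 Ω ψ f ≤ ENNReal.ofReal D) : ‖f z‖^2 / D ≤ bergmanDiag Ω ψ z := by
  have e : ∀ z, ‖(((Real.sqrt D)⁻¹ : ℝ) : ℂ) * f z‖^2 = D⁻¹ * ‖f z‖^2 := fun z => by
    rw [norm_mul, mul_pow, Complex.norm_real, Real.norm_eq_abs, sq_abs, inv_pow, Real.sq_sqrt hD.le]
  refine le_csSup hb ⟨fun z => (((Real.sqrt D)⁻¹ : ℝ) : ℂ) * f z, hf.const_mul _, ?_, ?_⟩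
  · simp only [wnorm2, e, mul_assoc, ENNReal.ofReal_mul (inv_pos.2 hD).le (q := _ * _)]
    rw [lintegral_const_mul' _ _ ENNReal.ofReal_ne_top]
    refine (mul_le_mul_right hw _).trans ?_
    rw [← ENNReal.ofReal_mul (inv_pos.2 hD).le, inv_mul_cancel₀ hD.ne', ENNReal.ofReal_one]
  · rw [e, div_eq_inv_mul]
lemma lim_lo {Ω : Set XX} (hΩo : IsOpen Ω)
    (hΩb : Bornology.IsBounded Ω) (hΩp : Pseudoconvex Ω) {φ : XX → ℝ} (hφ : ContDiffOn ℝ ∞ φ Ω)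
    (hpd : ∀ z ∈ Ω, (cHessian φ z).PosDef) {z : XX} (hz : z ∈ Ω) {a : ℝ}
    (ha : a < (π^n)⁻¹ * (cHessian φ z).det.re) :
    ∀ᶠ k : ℕ in atTop, a < ((k:ℝ)^n)⁻¹ * bergmanDiag Ω (fun w => k * φ w) z * rexp (-(k * φ z)) := by
  obtain ⟨hgi, hd, hge⟩ := gauss_lev (hpd z hz)
  obtain ⟨lam, hlam, hL, hC⟩ := low_core hΩo hΩb hΩp hφ hpd hz
  have hlim : Tendsto (fun t : ℝ => ∫ v, rexp (-lev φ z v + t * ‖v‖^2)) (𝓝[>] 0) (𝓝 (∫ v, rexp (-lev φ z v))) := by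
    refine tendsto_integral_filter_of_dominated_convergence _ (.of_forall fun t => ?_) ?_ (gauss_c_n (half_pos hlam)) (.of_forall fun v => ?_)
    · exact (Real.continuous_exp.comp ((levc φ z).neg.add (by fun_prop))).aestronglyMeasurable
    · filter_upwards [Ioc_mem_nhdsGT (half_pos hlam)] with t ht
      refine .of_forall fun v => ?_
      rw [Real.norm_eq_abs, abs_of_pos (Real.exp_pos _)]
      exact (jt_int hlam hL ht.2).1 v
    · have : Continuous fun t : ℝ => rexp (-lev φ z v + t * ‖v‖^2) := by fun_prop
      have := (this.tendsto 0).mono_left (nhdsWithin_le_nhds (s := Set.Ioi 0))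
      simpa using this
  have h1 : Tendsto (fun t : ℝ => (1 + t)) (𝓝[>] 0) (𝓝 1) := by
    have := ((continuous_const.add continuous_id).tendsto (0:ℝ) (f := fun t : ℝ => (1 + t))).mono_left (nhdsWithin_le_nhds (s := Set.Ioi 0))
    simpa using this
  have h2 := h1.mul hlim
  rw [one_mul, hge] at h2
  have h3 := (h2.inv₀ (by positivity)).eventually_const_lt (u := a) (by rwa [inv_div, div_eq_inv_mul])
  obtain ⟨t, ht, ht2⟩ := (h3.and (Ioc_mem_nhdsGT (half_pos hlam))).exists
  obtain ⟨C, c, hC0, hc, hev⟩ := hC t ht2.1 ht2.2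
  obtain ⟨J, hJ⟩ : ∃ J, J = ∫ v, rexp (-lev φ z v + t * ‖v‖^2) := ⟨_, rfl⟩
  rw [← hJ] at ht hev
  have hJ0 : 0 < J := by rw [hJ]; exact integral_exp_pos (jt_int hlam hL ht2.2).2
  have ht0 := ht2.1
  have hη : Tendsto (fun k : ℕ => C * ((k:ℝ)^n * rexp (-(k * c)))) atTop (𝓝 0) := by
    have := (tendsto_rpow_mul_exp_neg_mul_atTop_nhds_zero n c hc).comp (tendsto_natCast_atTop_atTop (R := ℝ))
    have := this.const_mul C
    rw [mul_zero] at this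
    refine this.congr fun k => ?_
    simp only [Function.comp, Real.rpow_natCast]; congr 3; ring
  have hq : Tendsto (fun k : ℕ => (1 - 2 * Real.sqrt (C * ((k:ℝ)^n * rexp (-(k * c))))) /
      ((1 + t) * J + C * ((k:ℝ)^n * rexp (-(k * c))))) atTop (𝓝 (((1 + t) * J)⁻¹)) := by
    have := (((hη.sqrt).const_mul 2).const_sub 1).div (hη.const_add ((1 + t) * J)) (by positivity)
    rw [Real.sqrt_zero, mul_zero, sub_zero, add_zero, one_div] at this
    exact this
  filter_upwards [hev, hq.eventually_const_lt ht, eventually_gt_atTop 0] with k hk hk2 hk0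
  obtain ⟨f, hf, hfw, hf0⟩ := hk
  obtain ⟨η, hηe⟩ : ∃ η, η = C * ((k:ℝ)^n * rexp (-(k * c))) := ⟨_, rfl⟩
  rw [← hηe] at hfw hf0 hk2
  have hη0 : 0 ≤ η := by rw [hηe]; positivity
  have hX := Real.exp_pos (-(k * φ z))
  have hkn : (0:ℝ) < (k:ℝ)^n := by positivity
  have hB := diag_ge (by positivity) (diag_bdd hΩo hΩb hΩp hφ hk0 hz) hf hfw
  have h5 : 1 - 2 * Real.sqrt η ≤ ‖f z‖^2 := by
    have h6 : ‖1 - f z‖ ≤ Real.sqrt η := Real.le_sqrt_of_sq_le hf0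
    have h7 : 1 - ‖1 - f z‖ ≤ ‖f z‖ := by
      have := norm_sub_norm_le (1:ℂ) (1 - f z)
      rwa [sub_sub_cancel, norm_one] at this
    nlinarith [norm_nonneg (1 - f z), norm_nonneg (f z)]
  calc a < _ := hk2
    _ ≤ ‖f z‖^2 / ((1 + t) * J + η) := by gcongr
    _ = ((k:ℝ)^n)⁻¹ * (‖f z‖^2 / (((k:ℝ)^n)⁻¹ * rexp (-(k * φ z)) * ((1 + t) * J + η))) * rexp (-(k * φ z)) := by
      field_simp
    _ ≤ _ := by gcongr
theorem bergman_main
    (Ω : Set XX) (hΩo : IsOpen Ω)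
    (hΩb : Bornology.IsBounded Ω) (hΩp : Pseudoconvex Ω)
    (φ : XX → ℝ) (hφ : SPSHOn Ω φ)
    (g : XX → ℝ) (hg : Continuous g) (hgc : HasCompactSupport g)
    (hgs : tsupport g ⊆ Ω) :
    Tendsto
      (fun k : ℕ => ∫ z in Ω,
        g z * (((k : ℝ) ^ n)⁻¹ * bergmanDiag Ω (fun w => k * φ w) z * rexp (-(k * φ z))))
      atTop
      (𝓝 (((π : ℝ) ^ n)⁻¹ * ∫ z in Ω, g z * (cHessian φ z).det.re)) := by
  obtain ⟨hφ, hpd⟩ := hφ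
  have hφ : ContDiffOn ℝ ∞ φ Ω := hφ
  rw [← integral_const_mul]
  obtain ⟨C, hC⟩ := diag_unif hΩo hΩb hΩp hφ hpd hgc hgs
  have hi : Integrable fun z => |g z| * C := (hg.integrable_of_hasCompactSupport hgc).abs.mul_const C
  refine tendsto_integral_filter_of_dominated_convergence _ ?_ ?_ (hi.mono_measure Measure.restrict_le_self)
    ((ae_restrict_iff' hΩo.measurableSet).2 (.of_forall fun z hz => ?_))
  · filter_upwards [eventually_gt_atTop 0] with k hk
    refine AEMeasurable.aestronglyMeasurable (hg.measurable.aemeasurable.mul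
      (((diag_meas hΩo hΩb hΩp hφ hk).const_mul _).mul (ContinuousOn.aemeasurable ?_ hΩo.measurableSet)))
    exact Real.continuous_exp.comp_continuousOn (continuousOn_const.mul hφ.continuousOn).neg
  · filter_upwards [hC] with k hk
    refine .of_forall fun z => ?_
    rw [norm_mul, Real.norm_eq_abs]
    by_cases hz : z ∈ tsupport g
    · refine mul_le_mul_of_nonneg_left ?_ (abs_nonneg _)
      have : 0 ≤ bergmanDiag Ω (fun w => k * φ w) z := Real.sSup_nonneg (by rintro t ⟨f, -, -, rfl⟩; positivity)
      rw [Real.norm_eq_abs, abs_of_nonneg (by positivity)]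
      exact hk z hz
    · rw [image_eq_zero_of_notMem_tsupport hz]; simp
  · rw [mul_left_comm]
    refine Tendsto.const_mul _ (tendsto_order.2 ⟨fun a ha => lim_lo hΩo hΩb hΩp hφ hpd hz ha, fun a ha => ?_⟩)
    exact lim_up hΩo hΩb hΩp hφ hpd hz ha

theorem bergman_measure_convergence
    (Ω : Set (Fin n → ℂ)) (hΩo : IsOpen Ω) (hΩconn : IsConnected Ω)
    (hΩb : Bornology.IsBounded Ω) (hΩp : Pseudoconvex Ω)
    (φ : (Fin n → ℂ) → ℝ) (hφ : SPSHOn Ω φ)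
    (g : (Fin n → ℂ) → ℝ) (hg : Continuous g) (hgc : HasCompactSupport g)
    (hgs : tsupport g ⊆ Ω) :
    Tendsto
      (fun k : ℕ => ∫ z in Ω,
        g z * (((k : ℝ) ^ n)⁻¹ * bergmanDiag Ω (fun w => k * φ w) z * Real.exp (-(k * φ z))))
      atTop
      (𝓝 (((π : ℝ) ^ n)⁻¹ * ∫ z in Ω, g z * (cHessian φ z).det.re)) := by
  exact bergman_main Ω hΩo hΩb hΩp φ hφ g hg hgc hgs
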